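/- arXiv:2305.11234 — 2 statements merged into one kernel-verified Lean document; each statement's English description precedes it below -/
import Mathlib

section
/- Let n ≥ 5 be an integer and suppose f is a transcendental entire function of finite order on ℂ solving the differential-difference equation f(z)^n + w·f(z)^{n-1}·f'(z) + f^{(k)}(z+c) = p₁e^{α₁z} + p₂e^{α₂z}. Then f has the form f(z) = C·e^{az}, where a and C are nonzero complex constants satisfying a = α_i and n·a = α_j for some indices {i,j} = {1,2}, with 1 + a·w ≠ 0 and C^n·(1 + a·w) = p_j. -/
open MeasureTheory Filter Metric

noncomputable section

/-- The positive part `log⁺` of the logarithm. -/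
def logPlus (x : ℝ) : ℝ := max (Real.log x) 0

/-- The Nevanlinna proximity function `m(r,f)`.  For an entire function `f` (which has no
poles) this coincides with the Nevanlinna characteristic `T(r,f)`. -/
def nevCharEntire (f : ℂ → ℂ) (r : ℝ) : ℝ :=
  (2 * Real.pi)⁻¹ * ∫ θ in (0:ℝ)..(2 * Real.pi), logPlus ‖f (r * Complex.exp (θ * Complex.I))‖

/-- The order of growth `ρ(f) = limsup_{r→∞} log⁺ T(r,f) / log r` of an entire function,
as an extended real number. -/
def growthOrderEntire (f : ℂ → ℂ) : EReal :=
  Filter.limsup (fun r : ℝ => ((logPlus (nevCharEntire f r) / Real.log r : ℝ) : EReal))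
    Filter.atTop

/-- An entire function is transcendental if it is not a polynomial. -/
def TranscendentalEntire (f : ℂ → ℂ) : Prop := ¬ ∃ p : Polynomial ℂ, ∀ z, f z = p.eval z

open Real (posLog circleAverage)

/-- The Nevanlinna characteristic of an entire function, as a circle average. -/
def meanPosLog (f : ℂ → ℂ) (r : ℝ) : ℝ := circleAverage (fun z => posLog ‖f z‖) 0 r

theorem continuous_posLog_norm {f : ℂ → ℂ} (hf : Continuous f) :
    Continuous fun z => posLog ‖f z‖ := by
  fun_prop

/-- Sub-mean value inequality for `log⁺ ‖f‖`. -/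
theorem posLog_norm_le_circleAverage {f : ℂ → ℂ} (hf : Differentiable ℂ f) (c : ℂ) {R : ℝ}
    (hR : 0 ≤ R) : posLog ‖f c‖ ≤ circleAverage (fun z => posLog ‖f z‖) c R := by
  have hnn : 0 ≤ circleAverage (fun z => posLog ‖f z‖) c R :=
    Real.circleAverage_nonneg_of_nonneg fun x _ => Real.posLog_nonneg
  rcases le_or_gt ‖f c‖ 1 with h | h
  · rwa [(Real.posLog_eq_zero_iff _).2 (by simpa using h)]
  rcases hR.eq_or_lt with rfl | hR
  · simp
  have han : AnalyticOnNhd ℂ f (closedBall c |R|) := fun z _ => hf.analyticAt z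
  have hne : f c ≠ 0 := by
    intro h0; simp [h0] at h; linarith
  rw [Real.posLog_eq_log (by rw [abs_norm]; exact h.le)]
  have key := AnalyticOnNhd.circleAverage_log_norm hR.ne' han hne
  have hsum : 0 ≤ ∑ᶠ u : ℂ, ((MeromorphicOn.divisor f (closedBall c |R|)) u : ℝ)
      * Real.log (R * ‖c - u‖⁻¹) := by
    refine finsum_nonneg fun u => ?_
    by_cases hu : u ∈ closedBall c |R|
    · refine mul_nonneg (mod_cast MeromorphicOn.AnalyticOnNhd.divisor_nonneg han u) ?_
      by_cases hcu : c = u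
      · simp [hcu]
      have hpos : 0 < ‖c - u‖ := norm_pos_iff.2 (sub_ne_zero.2 hcu)
      apply Real.log_nonneg
      rw [← div_eq_mul_inv, le_div_iff₀ hpos, one_mul]
      rw [mem_closedBall', dist_eq_norm, abs_of_pos hR] at hu
      exact hu
    · simp [hu]
  have hmer : MeromorphicOn f (sphere c |R|) := fun z _ => (hf.analyticAt z).meromorphicAt
  calc Real.log ‖f c‖ ≤ circleAverage (fun z => Real.log ‖f z‖) c R := by rw [key]; linarith
    _ ≤ _ := Real.circleAverage_mono hmer.circleIntegrable_log_norm
        hmer.circleIntegrable_posLog_norm fun x _ => le_max_right _ _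

theorem meanPosLog_nonneg (f : ℂ → ℂ) (r : ℝ) : 0 ≤ meanPosLog f r :=
  Real.circleAverage_nonneg_of_nonneg fun _ _ => Real.posLog_nonneg

theorem continuous_meanPosLog {f : ℂ → ℂ} (hf : Continuous f) : Continuous (meanPosLog f) :=
  Real.Continuous.circleAverage (continuous_posLog_norm hf)

theorem characteristic_eq_meanPosLog {f : ℂ → ℂ} (hf : Differentiable ℂ f) :
    ValueDistribution.characteristic f ⊤ = meanPosLog f := by
  have h : ValueDistribution.logCounting f ⊤ = 0 := by
    rw [ValueDistribution.logCounting_top]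
    have := MeromorphicOn.AnalyticOnNhd.divisor_nonneg (f := f) (U := Set.univ)
      (fun z _ => hf.analyticAt z)
    rw [negPart_eq_zero.2 this]
    simp
  rw [ValueDistribution.characteristic, h, add_zero, ValueDistribution.proximity_top]
  rfl

theorem meanPosLog_mono {f : ℂ → ℂ} (hf : Differentiable ℂ f) {r s : ℝ} (hr : 0 ≤ r)
    (hrs : r ≤ s) : meanPosLog f r ≤ meanPosLog f s := by
  rcases hr.eq_or_lt with rfl | hr
  · simpa [meanPosLog] using posLog_norm_le_circleAverage hf 0 hrs
  have hm : Meromorphic f := fun z => (hf.analyticAt z).meromorphicAt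
  have := ValueDistribution.characteristic_monotoneOn hm
    (Set.mem_Ioi.2 hr) (Set.mem_Ioi.2 (hr.trans_le hrs)) hrs
  rwa [characteristic_eq_meanPosLog hf] at this

/-- A consequence of the first main theorem: `T(r, f) ≤ T(r, f Q) + T(r, Q) + O(1)`. -/
theorem exists_meanPosLog_le_mul_add {f Q : ℂ → ℂ} (hf : Differentiable ℂ f)
    (hQ : Differentiable ℂ Q) {z₀ : ℂ} (hne : Q z₀ ≠ 0) :
    ∃ C : ℝ, ∀ r, 1 ≤ r →
      meanPosLog f r ≤ meanPosLog (fun z => f z * Q z) r + meanPosLog Q r + C := by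
  refine ⟨-Real.log ‖meromorphicTrailingCoeffAt Q 0‖, fun r hr => ?_⟩
  have hr0 : r ≠ 0 := by positivity
  have hmf : Meromorphic f := fun z => (hf.analyticAt z).meromorphicAt
  have hmQ : Meromorphic Q := fun z => (hQ.analyticAt z).meromorphicAt
  have hfQ : Differentiable ℂ (fun z => f z * Q z) := hf.mul hQ
  have hmfQ : Meromorphic (fun z => f z * Q z) := fun z => (hfQ.analyticAt z).meromorphicAt
  have h1 := ValueDistribution.characteristic_sub_characteristic_inv_of_ne_zero hmQ hr0
  rw [characteristic_eq_meanPosLog hQ] at h1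
  have h2 : ValueDistribution.proximity Q⁻¹ ⊤ r ≤ ValueDistribution.characteristic Q⁻¹ ⊤ r := by
    have := ValueDistribution.logCounting_nonneg (f := Q⁻¹) (e := ⊤) hr
    simp only [ValueDistribution.characteristic, Pi.add_apply]
    linarith
  have hcod : ∀ᶠ z in codiscrete ℂ, Q z ≠ 0 := by
    have := AnalyticOnNhd.preimage_zero_mem_codiscrete
      (f := Q) (fun z _ => hQ.analyticAt z) hne
    filter_upwards [this] with z hz
    simpa using hz
  have h3 : ValueDistribution.proximity f ⊤ r
      = ValueDistribution.proximity ((fun z => f z * Q z) * Q⁻¹) ⊤ r := by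
    refine ValueDistribution.proximity_congr_codiscrete ?_ hr0
    filter_upwards [hcod] with z hz
    simp [hz]
  have h4 := ValueDistribution.proximity_mul_top_le hmfQ hmQ.inv r
  rw [← h3] at h4
  simp only [Pi.add_apply] at h4
  have e1 : ValueDistribution.proximity f ⊤ r = meanPosLog f r := by
    rw [ValueDistribution.proximity_top]; rfl
  have e2 : ValueDistribution.proximity (fun z => f z * Q z) ⊤ r
      = meanPosLog (fun z => f z * Q z) r := by
    rw [ValueDistribution.proximity_top]; rfl
  linarith

/-- The circle average of the integrals over the balls `closedBall z ρ` with `‖z‖ = r`. -/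
theorem circleAverage_setIntegral_closedBall {v : ℂ → ℝ} (hv : Continuous v) (r ρ : ℝ) :
    circleAverage (fun z => ∫ w in closedBall z ρ, v w) 0 r
      = ∫ w in closedBall (r : ℂ) ρ, circleAverage v 0 ‖w‖ := by
  have hrot (θ : ℝ) : ∫ w in closedBall (circleMap 0 r θ) ρ, v w
      = ∫ w in closedBall (r : ℂ) ρ, v (Complex.exp (θ * Complex.I) * w) := by
    have h1 := (rotation (Circle.exp θ)).measurePreserving
    have h2 := (rotation (Circle.exp θ)).toHomeomorph.measurableEmbedding
    have := h1.setIntegral_preimage_emb h2 v (closedBall (circleMap 0 r θ) ρ)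
    rw [← this]
    have hs : (rotation (Circle.exp θ)) ⁻¹' closedBall (circleMap 0 r θ) ρ
        = closedBall (r : ℂ) ρ := by
      have : circleMap 0 r θ = rotation (Circle.exp θ) (r : ℂ) := by
        simp [circleMap, mul_comm]
      rw [this, LinearIsometryEquiv.preimage_closedBall, LinearIsometryEquiv.symm_apply_apply]
    rw [hs]
    simp
  have hcirc (w : ℂ) : circleAverage v 0 ‖w‖
      = (2 * Real.pi)⁻¹ * ∫ θ in (0:ℝ)..2 * Real.pi, v (Complex.exp (θ * Complex.I) * w) := by
    rw [Real.circleAverage_eq_integral_add (Complex.arg w), smul_eq_mul]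
    congr 2
    ext θ
    congr 1
    conv_rhs => rw [← Complex.norm_mul_exp_arg_mul_I w]
    rw [circleMap, zero_add, Complex.ofReal_add, add_mul, Complex.exp_add]
    ring
  simp_rw [hcirc]
  rw [Real.circleAverage_def, smul_eq_mul]
  simp_rw [hrot]
  rw [integral_const_mul]
  congr 1
  have hpi : (0:ℝ) ≤ 2 * Real.pi := by positivity
  simp_rw [intervalIntegral.integral_of_le hpi]
  apply integral_integral_swap
  rw [Measure.prod_restrict]
  have hcont : Continuous (Function.uncurry fun (θ : ℝ) (w : ℂ) =>
      v (Complex.exp (θ * Complex.I) * w)) := by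
    simp only [Function.uncurry_def]
    fun_prop
  refine IntegrableOn.mono_set (t := Set.Icc 0 (2 * Real.pi) ×ˢ closedBall (r : ℂ) ρ) ?_
    (Set.prod_mono Set.Ioc_subset_Icc_self subset_rfl)
  exact hcont.continuousOn.integrableOn_compact (isCompact_Icc.prod (isCompact_closedBall _ _))

theorem setIntegral_closedBall_const (z : ℂ) {ρ : ℝ} (hρ : 0 ≤ ρ) (a : ℝ) :
    ∫ _ in closedBall z ρ, a = Real.pi * ρ ^ 2 * a := by
  rw [setIntegral_const, smul_eq_mul, Measure.real, Complex.volume_closedBall]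
  rw [ENNReal.toReal_mul, ENNReal.toReal_pow, ENNReal.toReal_ofReal hρ, mul_comm Real.pi]
  rfl

theorem integrableOn_closedBall {v : ℂ → ℝ} (hv : Continuous v) (z : ℂ) (ρ : ℝ) :
    IntegrableOn v (closedBall z ρ) :=
  hv.continuousOn.integrableOn_compact (isCompact_closedBall z ρ)

/-- Sub-mean value inequality for `log⁺ ‖f‖` over discs. -/
theorem posLog_norm_le_setIntegral_closedBall {f : ℂ → ℂ} (hf : Differentiable ℂ f) (ζ : ℂ) {S : ℝ}
    (hS : 0 ≤ S) : Real.pi * S ^ 2 * posLog ‖f ζ‖ ≤ ∫ w in closedBall ζ S, posLog ‖f w‖ := by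
  have hg : Differentiable ℂ fun z => f (z + ζ) := by fun_prop
  have hv : Continuous fun z => posLog ‖f (z + ζ)‖ := continuous_posLog_norm hg.continuous
  have h := circleAverage_setIntegral_closedBall hv 0 S
  simp only [Real.circleAverage_zero, Complex.ofReal_zero] at h
  have htr : ∫ w in closedBall (0 : ℂ) S, posLog ‖f (w + ζ)‖
      = ∫ w in closedBall ζ S, posLog ‖f w‖ := by
    have := (measurePreserving_add_right volume ζ).setIntegral_preimage_emb
      (MeasurableEquiv.addRight ζ).measurableEmbedding (fun w => posLog ‖f w‖) (closedBall ζ S)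
    rw [← this]
    simp
  rw [← htr, h, ← setIntegral_closedBall_const 0 hS]
  refine setIntegral_mono_on (integrableOn_closedBall continuous_const _ _)
    (integrableOn_closedBall ((Real.Continuous.circleAverage hv).comp continuous_norm) _ _)
    measurableSet_closedBall fun w _ => ?_
  have := posLog_norm_le_circleAverage hg 0 (norm_nonneg w)
  simpa using this

/-- A smoothed version of `z ↦ log⁺ ‖f z‖`, which bounds `log⁺ ‖f‖` on `closedBall z A`. -/
def discMajorant (f : ℂ → ℂ) (A S : ℝ) (z : ℂ) : ℝ :=
  (Real.pi * S ^ 2)⁻¹ * ∫ w in closedBall z (S + A), posLog ‖f w‖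

theorem continuous_discMajorant {f : ℂ → ℂ} (hf : Continuous f) (A S : ℝ) :
    Continuous (discMajorant f A S) := by
  have htr (z : ℂ) : ∫ w in closedBall z (S + A), posLog ‖f w‖
      = ∫ w in closedBall (0 : ℂ) (S + A), posLog ‖f (w + z)‖ := by
    have := (measurePreserving_add_right volume z).setIntegral_preimage_emb
      (MeasurableEquiv.addRight z).measurableEmbedding (fun w => posLog ‖f w‖)
      (closedBall z (S + A))
    rw [← this]
    simp
  unfold discMajorant
  simp_rw [htr]
  refine continuous_const.mul (continuous_parametric_integral_of_continuous ?_
    (isCompact_closedBall _ _))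
  simp only [Function.uncurry_def]
  fun_prop

theorem posLog_norm_le_discMajorant {f : ℂ → ℂ} (hf : Differentiable ℂ f) {A S : ℝ} (hS : 0 < S)
    {z ζ : ℂ} (h : dist ζ z ≤ A) : posLog ‖f ζ‖ ≤ discMajorant f A S z := by
  rw [discMajorant, le_inv_mul_iff₀ (by positivity)]
  refine (posLog_norm_le_setIntegral_closedBall hf ζ hS.le).trans ?_
  refine setIntegral_mono_set
    (integrableOn_closedBall (continuous_posLog_norm hf.continuous) _ _)
    (Eventually.of_forall fun _ => Real.posLog_nonneg) (LE.le.eventuallyLE ?_)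
  exact closedBall_subset_closedBall' (by linarith)

theorem circleAverage_discMajorant_le {f : ℂ → ℂ} (hf : Differentiable ℂ f) {A S r : ℝ}
    (hA : 0 ≤ A) (hS : 0 < S) (hr : 0 ≤ r) :
    circleAverage (discMajorant f A S) 0 r ≤ ((S + A) / S) ^ 2 * meanPosLog f (r + (S + A)) := by
  have hv := continuous_posLog_norm hf.continuous
  have h1 : circleAverage (discMajorant f A S) 0 r = (Real.pi * S ^ 2)⁻¹ *
      ∫ w in closedBall (r : ℂ) (S + A), meanPosLog f ‖w‖ := by
    have := circleAverage_setIntegral_closedBall hv r (S + A)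
    unfold meanPosLog
    rw [← this, ← smul_eq_mul, ← Real.circleAverage_fun_smul]
    rfl
  have h2 : ∫ w in closedBall (r : ℂ) (S + A), meanPosLog f ‖w‖
      ≤ Real.pi * (S + A) ^ 2 * meanPosLog f (r + (S + A)) := by
    rw [← setIntegral_closedBall_const (r : ℂ) (by positivity)]
    refine setIntegral_mono_on
      (integrableOn_closedBall ((continuous_meanPosLog hf.continuous).comp continuous_norm) _ _)
      (integrableOn_closedBall continuous_const _ _) measurableSet_closedBall fun w hw => ?_
    refine meanPosLog_mono hf (norm_nonneg w) ?_
    have := norm_le_norm_add_norm_sub (r : ℂ) w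
    rw [mem_closedBall, dist_eq_norm] at hw
    rw [Complex.norm_real, Real.norm_of_nonneg hr, norm_sub_rev] at this
    linarith
  rw [h1]
  calc _ ≤ (Real.pi * S ^ 2)⁻¹ * (Real.pi * (S + A) ^ 2 * meanPosLog f (r + (S + A))) := by gcongr
    _ = _ := by field_simp

theorem norm_le_exp_posLog (z : ℂ) : ‖z‖ ≤ Real.exp (posLog ‖z‖) := by
  rcases eq_or_ne z 0 with rfl | h
  · simp
  · rw [← Real.log_le_iff_le_exp (norm_pos_iff.2 h)]
    exact le_max_right _ _

/-- Cauchy's estimate in terms of `discMajorant`. -/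
theorem norm_iteratedDeriv_le_exp_discMajorant {f : ℂ → ℂ} (hf : Differentiable ℂ f) {A S : ℝ}
    (hS : 0 < S) {c : ℂ} (hA : ‖c‖ + 1 ≤ A) (j : ℕ) (z : ℂ) :
    ‖iteratedDeriv j f (z + c)‖ ≤ j.factorial * Real.exp (discMajorant f A S z) := by
  have := Complex.norm_iteratedDeriv_le_of_forall_mem_sphere_norm_le (c := z + c) (R := 1)
    (C := Real.exp (discMajorant f A S z)) (f := f) j one_pos hf.diffContOnCl fun ζ hζ => ?_
  · simpa using this
  refine (norm_le_exp_posLog _).trans (Real.exp_le_exp.2 (posLog_norm_le_discMajorant hf hS ?_))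
  rw [mem_sphere] at hζ
  have := dist_triangle ζ (z + c) z
  rw [hζ, dist_eq_norm (z + c), add_sub_cancel_left] at this
  linarith

theorem isBounded_range_of_meanPosLog_le {f : ℂ → ℂ} (hf : Differentiable ℂ f) {D r₀ : ℝ}
    (h : ∀ r, r₀ ≤ r → meanPosLog f r ≤ D) : Bornology.IsBounded (Set.range f) := by
  rw [isBounded_iff_forall_norm_le]
  refine ⟨Real.exp (2 ^ 2 * D), ?_⟩
  rintro _ ⟨z, rfl⟩
  set S := max (‖z‖ + 1) |r₀|
  have hS : 0 < S := lt_of_lt_of_le (by positivity) (le_max_left _ _)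
  have hzS : ‖z‖ ≤ S := by have := le_max_left (‖z‖ + 1) |r₀|; linarith
  have h1 := posLog_norm_le_discMajorant hf hS (z := 0) (ζ := z) (A := S) (by simpa using hzS)
  have h2 := circleAverage_discMajorant_le hf hS.le hS le_rfl
  rw [Real.circleAverage_zero] at h2
  have h3 : meanPosLog f (0 + (S + S)) ≤ D := h _ (by
    have := le_max_right (‖z‖ + 1) |r₀|
    have := le_abs_self r₀
    linarith)
  refine (norm_le_exp_posLog _).trans (Real.exp_le_exp.2 (h1.trans (h2.trans ?_)))
  have : (S + S) / S = 2 := by field_simp; ring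
  rw [this]
  gcongr

/-- One step of the bootstrap: it lowers the exponent of a power bound by `1 / 2`. -/
theorem exists_le_sqrt_pow_of_le {T : ℝ → ℝ} {A C : ℝ} (hT : ∀ r, 0 ≤ T r)
    (hmono : ∀ r s, 0 ≤ r → r ≤ s → T r ≤ T s) (hA : 0 ≤ A) (hC : 0 ≤ C)
    (hineq : ∀ r S, 1 ≤ r → A ≤ S → 1 ≤ S →
      T r ≤ C + 6 * (T (r + 2 * S) - T r) + 18 * A / S * T (r + 2 * S))
    {j : ℕ} (h : ∃ D r₀ : ℝ, ∀ r, r₀ ≤ r → T r ≤ D * √r ^ (j + 1)) :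
    ∃ D r₀ : ℝ, ∀ r, r₀ ≤ r → T r ≤ D * √r ^ j := by
  obtain ⟨D, r₀, h⟩ := h
  refine ⟨C + (6 + 18 * A) * (D * √5 ^ (j + 1)), max (max 1 (A ^ 2)) |r₀|, fun R hR => ?_⟩
  have hR1 : 1 ≤ R := (le_max_left _ _).trans ((le_max_left _ _).trans hR)
  have hRA : A ^ 2 ≤ R := (le_max_right _ _).trans ((le_max_left _ _).trans hR)
  have hRr : r₀ ≤ R := (le_abs_self r₀).trans ((le_max_right _ _).trans hR)
  set S := √R
  have hSS : S * S = R := Real.mul_self_sqrt (by linarith)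
  have hS1 : 1 ≤ S := Real.one_le_sqrt.2 hR1
  have hSA : A ≤ S := Real.le_sqrt_of_sq_le hRA
  set N := ⌈S⌉₊
  have hNS : S ≤ N := Nat.le_ceil S
  have hNS' : N < S + 1 := Nat.ceil_lt_add_one (by linarith)
  have hN0 : (0 : ℝ) < N := by linarith
  have hbound : ∀ i ∈ Finset.range N, T R ≤ C + 18 * A / S * T (5 * R)
      + 6 * (T (R + 2 * ((i + 1 : ℕ) : ℝ) * S) - T (R + 2 * (i : ℝ) * S)) := by
    intro i hi
    have hi' : ((i + 1 : ℕ) : ℝ) ≤ N := by exact_mod_cast Finset.mem_range.1 hi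
    have hiS : 0 ≤ 2 * (i : ℝ) * S := by positivity
    have h1 := hineq (R + 2 * i * S) S (by linarith) hSA hS1
    have h2 : T R ≤ T (R + 2 * i * S) := hmono _ _ (by linarith) (by linarith)
    have e : R + 2 * i * S + 2 * S = R + 2 * ((i + 1 : ℕ) : ℝ) * S := by push_cast; ring
    rw [e] at h1
    have h3 : T (R + 2 * ((i + 1 : ℕ) : ℝ) * S) ≤ T (5 * R) := by
      refine hmono _ _ (by positivity) ?_
      nlinarith
    have h4 : 18 * A / S * T (R + 2 * ((i + 1 : ℕ) : ℝ) * S) ≤ 18 * A / S * T (5 * R) := by gcongr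
    linarith
  have hsum := Finset.sum_le_sum hbound
  rw [Finset.sum_add_distrib, ← Finset.mul_sum,
    Finset.sum_range_sub (fun i : ℕ => T (R + 2 * (i : ℝ) * S))] at hsum
  simp only [Finset.sum_const, Finset.card_range, nsmul_eq_mul] at hsum
  have h5 : T (R + 2 * (N : ℝ) * S) ≤ T (5 * R) := hmono _ _ (by positivity) (by nlinarith)
  have h6 := hT (R + 2 * ((0 : ℕ) : ℝ) * S)
  have h7 : (N : ℝ) * T R ≤ N * (C + (6 + 18 * A) / S * T (5 * R)) := by
    have : 6 * T (5 * R) ≤ N * (6 / S * T (5 * R)) := by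
      have h8 : 6 * T (5 * R) = S * (6 / S * T (5 * R)) := by field_simp
      have : 0 ≤ 6 / S * T (5 * R) := by have := hT (5 * R); positivity
      rw [h8]; gcongr
    have e : (N : ℝ) * (C + (6 + 18 * A) / S * T (5 * R))
      = N * (C + 18 * A / S * T (5 * R)) + N * (6 / S * T (5 * R)) := by ring
    calc (N : ℝ) * T R ≤ N * (C + 18 * A / S * T (5 * R)) + 6 * T (5 * R) := by
          refine hsum.trans ?_
          gcongr
          exact (sub_le_self _ h6).trans h5
      _ ≤ N * (C + 18 * A / S * T (5 * R)) + N * (6 / S * T (5 * R)) := by gcongr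
      _ = _ := e.symm
  have h8 := le_of_mul_le_mul_left h7 hN0
  have h9 : T (5 * R) ≤ D * √5 ^ (j + 1) * S ^ (j + 1) := by
    have := h (5 * R) (by linarith)
    rw [Real.sqrt_mul (by norm_num), mul_pow] at this
    linarith
  calc T R ≤ C + (6 + 18 * A) / S * T (5 * R) := h8
    _ ≤ C * S ^ j + (6 + 18 * A) / S * (D * √5 ^ (j + 1) * S ^ (j + 1)) := by
        have : C ≤ C * S ^ j := le_mul_of_one_le_right hC (one_le_pow₀ hS1)
        gcongr
    _ = _ := by field_simp; ring

/-- A Clunie-type lemma: if both `f Q` and `Q` are controlled by the oscillation of `log⁺ ‖f‖`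
at unit scale and `f` has finite order, then `Q = 0` or `f` is constant. -/
theorem isBounded_range_of_clunie {f Q : ℂ → ℂ} (hf : Differentiable ℂ f)
    (hQ : Differentiable ℂ Q) {z₀ : ℂ} (hne : Q z₀ ≠ 0) {A C : ℝ} (hA : 0 ≤ A) (hC : 0 ≤ C)
    (hb : ∀ S, 0 < S → ∀ z, posLog ‖f z * Q z‖ ≤ C + 3 * (discMajorant f A S z - posLog ‖f z‖) ∧
      posLog ‖Q z‖ ≤ C + 3 * (discMajorant f A S z - posLog ‖f z‖))
    {D r₀ : ℝ} {j : ℕ} (hgrowth : ∀ r, r₀ ≤ r → meanPosLog f r ≤ D * √r ^ j) :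
    Bornology.IsBounded (Set.range f) := by
  obtain ⟨C₁, hC₁⟩ := exists_meanPosLog_le_mul_add hf hQ hne
  have hmean (g : ℂ → ℂ) (hg : Differentiable ℂ g) (S : ℝ) (hS : 0 < S) (r : ℝ) (hr : 0 ≤ r)
      (h : ∀ z, posLog ‖g z‖ ≤ C + 3 * (discMajorant f A S z - posLog ‖f z‖)) :
      meanPosLog g r
        ≤ C + 3 * (((S + A) / S) ^ 2 * meanPosLog f (r + (S + A)) - meanPosLog f r) := by
    have hcW : CircleIntegrable (discMajorant f A S) 0 r :=
      (continuous_discMajorant hf.continuous A S).continuousOn.circleIntegrable hr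
    have hcf : CircleIntegrable (fun z => posLog ‖f z‖) 0 r :=
      (continuous_posLog_norm hf.continuous).continuousOn.circleIntegrable hr
    have hcg : CircleIntegrable (fun z => posLog ‖g z‖) 0 r :=
      (continuous_posLog_norm hg.continuous).continuousOn.circleIntegrable hr
    have hcR : CircleIntegrable
        (fun z => C + 3 * (discMajorant f A S z - posLog ‖f z‖)) 0 r := by
      refine Continuous.continuousOn ?_ |>.circleIntegrable hr
      have := continuous_discMajorant hf.continuous A S
      have := continuous_posLog_norm hf.continuous
      fun_prop
    have h1 := Real.circleAverage_mono hcg hcR fun z _ => h z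
    have h2 : circleAverage (fun z => C + 3 * (discMajorant f A S z - posLog ‖f z‖)) 0 r
        = C + 3 * (circleAverage (discMajorant f A S) 0 r - meanPosLog f r) := by
      have hcd : CircleIntegrable (fun z => 3 * (discMajorant f A S z - posLog ‖f z‖)) 0 r := by
        refine Continuous.continuousOn ?_ |>.circleIntegrable hr
        have := continuous_discMajorant hf.continuous A S
        have := continuous_posLog_norm hf.continuous
        fun_prop
      rw [Real.circleAverage_fun_add (circleIntegrable_const _ _ _) hcd, Real.circleAverage_const]
      congr 1
      have := Real.circleAverage_fun_smul (a := (3 : ℝ))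
        (f := fun z => discMajorant f A S z - posLog ‖f z‖) (c := 0) (R := r)
      simp only [smul_eq_mul] at this
      rw [this, Real.circleAverage_fun_sub hcW hcf]
      rfl
    have h3 := circleAverage_discMajorant_le hf hA hS hr
    rw [h2] at h1
    unfold meanPosLog at h1 h3 ⊢
    linarith
  have hineq : ∀ r S, 1 ≤ r → A ≤ S → 1 ≤ S → meanPosLog f r ≤ (|C₁| + 2 * C)
      + 6 * (meanPosLog f (r + 2 * S) - meanPosLog f r)
      + 18 * A / S * meanPosLog f (r + 2 * S) := by
    intro r S hr hAS hS
    have hS0 : 0 < S := by linarith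
    have h1 := hC₁ r hr
    have h2 := hmean _ (hf.mul hQ) S hS0 r (by linarith) fun z => (hb S hS0 z).1
    have h3 := hmean _ hQ S hS0 r (by linarith) fun z => (hb S hS0 z).2
    have h4 : meanPosLog f (r + (S + A)) ≤ meanPosLog f (r + 2 * S) :=
      meanPosLog_mono hf (by positivity) (by linarith)
    have h5 : ((S + A) / S) ^ 2 ≤ 1 + 3 * A / S := by
      rw [div_pow, div_le_iff₀ (by positivity)]
      have : (1 + 3 * A / S) * S ^ 2 = S ^ 2 + 3 * A * S := by field_simp
      rw [this]; nlinarith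
    have h6 : ((S + A) / S) ^ 2 * meanPosLog f (r + (S + A))
        ≤ (1 + 3 * A / S) * meanPosLog f (r + 2 * S) :=
      mul_le_mul h5 h4 (meanPosLog_nonneg _ _) (by positivity)
    have e : (1 + 3 * A / S) * meanPosLog f (r + 2 * S) = meanPosLog f (r + 2 * S)
      + 3 * A / S * meanPosLog f (r + 2 * S) := by ring
    have e2 : 18 * A / S * meanPosLog f (r + 2 * S)
      = 6 * (3 * A / S * meanPosLog f (r + 2 * S)) := by ring
    have := le_abs_self C₁
    have h7 : meanPosLog (fun z => f z * Q z) r ≤ _ := h2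
    rw [e2]
    linarith
  have hfin : ∀ i : ℕ, (∃ D r₀ : ℝ, ∀ r, r₀ ≤ r → meanPosLog f r ≤ D * √r ^ i) →
      ∃ D r₀ : ℝ, ∀ r, r₀ ≤ r → meanPosLog f r ≤ D * √r ^ 0 := by
    intro i
    induction i with
    | zero => exact id
    | succ i ih =>
      exact fun h => ih (exists_le_sqrt_pow_of_le (meanPosLog_nonneg f)
        (fun _ _ => meanPosLog_mono hf) hA (by positivity) hineq h)
  obtain ⟨D', r₁, h⟩ := hfin j ⟨D, r₀, hgrowth⟩
  exact isBounded_range_of_meanPosLog_le hf (D := D') (r₀ := r₁) (by simpa using h)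

/-- Functions of exponential type. -/
def IsExpType (F : ℂ → ℂ) : Prop := ∃ C B : ℝ, ∀ z, ‖F z‖ ≤ C * Real.exp (B * ‖z‖)

theorem norm_exp_le_exp_norm_mul (a z : ℂ) : ‖Complex.exp (a * z)‖ ≤ Real.exp (‖a‖ * ‖z‖) := by
  rw [← norm_mul]
  exact Complex.norm_exp_le_exp_norm _

theorem hasDerivAt_exp_neg_mul_mul {F : ℂ → ℂ} {a F' z : ℂ} (hF : HasDerivAt F F' z) :
    HasDerivAt (fun z => Complex.exp (-a * z) * F z) (Complex.exp (-a * z) * (F' - a * F z)) z := by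
  have h := (((hasDerivAt_id z).const_mul (-a)).cexp).mul hF
  refine h.congr_deriv ?_
  simp only [id]
  ring

theorem IsExpType.of_deriv_sub {F : ℂ → ℂ} (hF : Differentiable ℂ F) (a : ℂ)
    (h : IsExpType fun z => deriv F z - a * F z) : IsExpType F := by
  obtain ⟨C, B, h⟩ := h
  refine ⟨‖F 0‖ + |C|, 2 * ‖a‖ + |B| + 1, fun z => ?_⟩
  have hder (ζ : ℂ) := hasDerivAt_exp_neg_mul_mul (a := a) (hF ζ).hasDerivAt
  have hbd : ∀ ζ ∈ closedBall (0 : ℂ) ‖z‖, ‖Complex.exp (-a * ζ) * (deriv F ζ - a * F ζ)‖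
      ≤ |C| * Real.exp ((‖a‖ + |B|) * ‖z‖) := by
    intro ζ hζ
    have hζ' : ‖ζ‖ ≤ ‖z‖ := by simpa using hζ
    have h1 := norm_exp_le_exp_norm_mul (-a) ζ
    rw [norm_neg] at h1
    calc _ ≤ Real.exp (‖a‖ * ‖ζ‖) * (C * Real.exp (B * ‖ζ‖)) := by
          rw [norm_mul]; gcongr; exact h ζ
      _ ≤ Real.exp (‖a‖ * ‖z‖) * (|C| * Real.exp (|B| * ‖z‖)) := by
          have hC : C * Real.exp (B * ‖ζ‖) ≤ |C| * Real.exp (|B| * ‖z‖) := by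
            refine (mul_le_mul_of_nonneg_right (le_abs_self C) (Real.exp_pos _).le).trans ?_
            gcongr
            exact le_abs_self B
          gcongr
          exact (norm_nonneg _).trans (h ζ)
      _ = _ := by rw [add_mul, Real.exp_add]; ring
  have hmv := (convex_closedBall (0 : ℂ) ‖z‖).norm_image_sub_le_of_norm_hasDerivWithin_le
    (fun ζ _ => (hder ζ).hasDerivWithinAt) hbd (mem_closedBall_self (norm_nonneg z))
    (show z ∈ closedBall (0 : ℂ) ‖z‖ by simp)
  simp only [mul_zero, Complex.exp_zero, one_mul, sub_zero] at hmv
  have hz : ‖z‖ ≤ Real.exp ‖z‖ := by linarith [Real.add_one_le_exp ‖z‖]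
  have hFz : F z = Complex.exp (a * z) * (Complex.exp (-a * z) * F z) := by
    rw [← mul_assoc, ← Complex.exp_add]; simp
  have h2 : ‖Complex.exp (-a * z) * F z‖ ≤ ‖F 0‖
      + |C| * Real.exp ((‖a‖ + |B|) * ‖z‖) * Real.exp ‖z‖ := by
    have h3 := norm_le_norm_add_norm_sub' (Complex.exp (-a * z) * F z) (F 0)
    have h4 : |C| * Real.exp ((‖a‖ + |B|) * ‖z‖) * ‖z‖
      ≤ |C| * Real.exp ((‖a‖ + |B|) * ‖z‖) * Real.exp ‖z‖ := by gcongr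
    linarith
  have h5 : |C| * Real.exp ((‖a‖ + |B|) * ‖z‖) * Real.exp ‖z‖
      = |C| * Real.exp ((‖a‖ + |B| + 1) * ‖z‖) := by
    rw [mul_assoc, ← Real.exp_add]; ring_nf
  rw [h5] at h2
  have h6 : 1 ≤ Real.exp ((‖a‖ + |B| + 1) * ‖z‖) := Real.one_le_exp (by positivity)
  calc ‖F z‖ ≤ Real.exp (‖a‖ * ‖z‖) * ((‖F 0‖ + |C|) * Real.exp ((‖a‖ + |B| + 1) * ‖z‖)) := by
        rw [hFz, norm_mul]
        gcongr
        · exact norm_exp_le_exp_norm_mul a z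
        · refine h2.trans ?_
          linarith [le_mul_of_one_le_right (norm_nonneg (F 0)) h6]
    _ = _ := by
        rw [mul_left_comm, ← Real.exp_add]; ring_nf

theorem IsExpType.of_iteratedDeriv (k : ℕ) {F : ℂ → ℂ} (hF : Differentiable ℂ F)
    (h : IsExpType (iteratedDeriv k F)) : IsExpType F := by
  induction k generalizing F with
  | zero => simpa using h
  | succ k ih =>
    rw [iteratedDeriv_succ'] at h
    exact .of_deriv_sub hF 0 (by simpa using ih hF.deriv h)

theorem eq_zero_of_hasDerivAt_mul {F : ℂ → ℂ} {a z₀ : ℂ} (hF : ∀ z, HasDerivAt F (a * F z) z)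
    (h0 : F z₀ = 0) (z : ℂ) : F z = 0 := by
  have hder (ζ : ℂ) : HasDerivAt (fun z => Complex.exp (-a * z) * F z) 0 ζ := by
    simpa using hasDerivAt_exp_neg_mul_mul (a := a) (hF ζ)
  have := is_const_of_deriv_eq_zero (fun ζ => (hder ζ).differentiableAt)
    (fun ζ => (hder ζ).deriv) z z₀
  simpa [h0, Complex.exp_ne_zero] using this

/-- A second order linear equation with constant coefficients has only the trivial solution with
vanishing initial values. -/
theorem eq_zero_of_second_order {P P' P'' : ℂ → ℂ} {α β z₀ : ℂ} (hP : ∀ z, HasDerivAt P (P' z) z)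
    (hP' : ∀ z, HasDerivAt P' (P'' z) z) (h : ∀ z, P'' z - (α + β) * P' z + α * β * P z = 0)
    (h0 : P z₀ = 0) (h1 : P' z₀ = 0) (z : ℂ) : P z = 0 := by
  have h2 (ζ : ℂ) : P' ζ - β * P ζ = 0 := by
    refine eq_zero_of_hasDerivAt_mul (a := α) (z₀ := z₀) (F := fun ζ => P' ζ - β * P ζ)
      (fun ζ => ?_) (by simp [h0, h1]) ζ
    refine ((hP' ζ).sub ((hP ζ).const_mul β)).congr_deriv ?_
    linear_combination h ζ
  refine eq_zero_of_hasDerivAt_mul (a := β) (z₀ := z₀) (fun ζ => ?_) h0 z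
  rw [← sub_eq_zero.1 (h2 ζ)]
  exact hP ζ

theorem IsExpType.of_second_order {P : ℂ → ℂ} {α β : ℂ} (hP : Differentiable ℂ P)
    (h : ∀ z, deriv (deriv P) z - (α + β) * deriv P z + α * β * P z = 0) : IsExpType P := by
  refine .of_deriv_sub hP β (.of_deriv_sub (hP.deriv.sub (hP.const_mul β)) α ⟨0, 0, fun z => ?_⟩)
  have : deriv (fun z => deriv P z - β * P z) z = deriv (deriv P) z - β * deriv P z :=
    ((hP.deriv z).hasDerivAt.sub ((hP z).hasDerivAt.const_mul β)).deriv
  simp only [this, zero_mul, norm_le_zero_iff]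
  linear_combination h z

/-- A zero-free entire function of exponential type is an exponential. -/
theorem IsExpType.exists_eq_const_mul_exp {f : ℂ → ℂ} (hf : Differentiable ℂ f) (h : IsExpType f)
    (h0 : ∀ z, f z ≠ 0) : ∃ a C : ℂ, C ≠ 0 ∧ ∀ z, f z = C * Complex.exp (a * z) := by
  obtain ⟨C, B, h⟩ := h
  obtain ⟨g, hg0, hg⟩ := (hf.deriv.div hf h0).isExactOn_univ.with_val_at 0 (Complex.log (f 0))
  replace hg (z : ℂ) : HasDerivAt g (deriv f z / f z) z := hg z trivial
  have hgd : Differentiable ℂ g := fun z => (hg z).differentiableAt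
  have hfg (z : ℂ) : f z = Complex.exp (g z) := by
    have hder (ζ : ℂ) : HasDerivAt (fun z => Complex.exp (-g z) * f z) 0 ζ := by
      refine ((hg ζ).neg.cexp.mul (hf ζ).hasDerivAt).congr_deriv ?_
      have := h0 ζ
      simp only [Pi.neg_apply]
      field_simp
      ring
    have := is_const_of_deriv_eq_zero (fun ζ => (hder ζ).differentiableAt)
      (fun ζ => (hder ζ).deriv) z 0
    rw [hg0, Complex.exp_neg, Complex.exp_neg, Complex.exp_log (h0 0), inv_mul_cancel₀ (h0 0)]
      at this
    have he := Complex.exp_ne_zero (g z)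
    field_simp at this
    exact this
  have hre (z : ℂ) : (g z).re ≤ |C| + |B| * ‖z‖ := by
    have h1 := h z
    rw [hfg, Complex.norm_exp] at h1
    rw [← Real.exp_le_exp, Real.exp_add]
    refine h1.trans ?_
    gcongr
    · linarith [Real.add_one_le_exp |C|, le_abs_self C]
    · exact le_abs_self B
  set E : ℝ := 2 * |C| + 2 + 4 * |B| + 3 * ‖g 0‖ with hE
  have hgE (r : ℝ) (hr : 1 ≤ r) (z : ℂ) (hz : ‖z‖ ≤ r) : ‖g z‖ ≤ E * r := by
    have hM : 0 < |C| + 1 + 2 * |B| * r := by positivity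
    have h1 := Complex.borelCaratheodory (R := 2 * r) hM hgd.differentiableOn (fun ζ hζ => ?_)
      (by linarith) (show z ∈ ball 0 (2 * r) by rw [mem_ball_zero_iff]; linarith)
    · have h2 : 2 * (|C| + 1 + 2 * |B| * r) * ‖z‖ / (2 * r - ‖z‖)
          ≤ 2 * (|C| + 1 + 2 * |B| * r) := by
        rw [div_le_iff₀ (by linarith)]
        gcongr
        linarith
      have h3 : ‖g 0‖ * (2 * r + ‖z‖) / (2 * r - ‖z‖) ≤ ‖g 0‖ * 3 := by
        rw [div_le_iff₀ (by linarith), mul_assoc]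
        gcongr
        linarith
      have h4 : 2 * |C| + 2 + 3 * ‖g 0‖ ≤ (2 * |C| + 2 + 3 * ‖g 0‖) * r :=
        le_mul_of_one_le_right (by positivity) hr
      rw [hE]
      linarith
    · have h2 := hre ζ
      have h3 : |B| * ‖ζ‖ ≤ |B| * (2 * r) := by
        gcongr
        exact (mem_ball_zero_iff.1 hζ).le
      change (g ζ).re ≤ _
      linarith
  have hbd : Bornology.IsBounded (Set.range (deriv g)) := by
    rw [isBounded_iff_forall_norm_le]
    refine ⟨2 * E, ?_⟩
    rintro _ ⟨z, rfl⟩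
    have hz : (0 : ℝ) < ‖z‖ + 1 := by positivity
    have h1 := Complex.norm_deriv_le_of_forall_mem_sphere_norm_le (c := z) (f := g)
      (C := E * (2 * (‖z‖ + 1))) hz hgd.diffContOnCl fun ζ hζ => hgE _ (by
        linarith [norm_nonneg z]) _ (by
        rw [mem_sphere_iff_norm] at hζ
        have := norm_le_norm_add_norm_sub' ζ z
        linarith)
    refine h1.trans (le_of_eq ?_)
    field_simp
  set a := deriv g 0
  have hconst (z : ℂ) : deriv g z = a := hgd.deriv.apply_eq_apply_of_bounded hbd z 0
  have hlin (z : ℂ) : g z = g 0 + a * z := by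
    have hder (ζ : ℂ) : HasDerivAt (fun z => g z - a * z) 0 ζ := by
      refine ((hgd ζ).hasDerivAt.sub ((hasDerivAt_id ζ).const_mul a)).congr_deriv ?_
      rw [hconst]; ring
    have := is_const_of_deriv_eq_zero (fun ζ => (hder ζ).differentiableAt)
      (fun ζ => (hder ζ).deriv) z 0
    simp only [mul_zero, sub_zero] at this
    linear_combination this
  exact ⟨a, Complex.exp (g 0), Complex.exp_ne_zero _, fun z => by
    rw [hfg, hlin, Complex.exp_add]⟩

theorem linearIndependent_exp_mul :
    LinearIndependent ℂ (fun a : ℂ => fun z : ℂ => Complex.exp (a * z)) := by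
  let φ : ℂ → (Multiplicative ℂ →* ℂ) := fun a =>
    { toFun := fun z => Complex.exp (a * z.toAdd)
      map_one' := by simp
      map_mul' := fun x y => by simp [mul_add, Complex.exp_add] }
  have hφ : Function.Injective φ := by
    intro a b hab
    have h (z : ℂ) : Complex.exp (a * z) = Complex.exp (b * z) :=
      DFunLike.congr_fun hab (Multiplicative.ofAdd z)
    have hd (a : ℂ) : HasDerivAt (fun z => Complex.exp (a * z)) a 0 := by
      simpa using ((hasDerivAt_id (0 : ℂ)).const_mul a).cexp
    exact (hd a).unique (by simpa only [h] using hd b)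
  exact (linearIndependent_monoidHom (Multiplicative ℂ) ℂ).comp φ hφ

theorem eq_or_eq_of_exp_add_exp_eq {X Y a b p₁ p₂ α₁ α₂ : ℂ} (hY : Y ≠ 0) (hab : a ≠ b)
    (hα : α₁ ≠ α₂) (hp₁ : p₁ ≠ 0) (hp₂ : p₂ ≠ 0)
    (h : ∀ z, X * Complex.exp (b * z) + Y * Complex.exp (a * z)
      = p₁ * Complex.exp (α₁ * z) + p₂ * Complex.exp (α₂ * z)) :
    (a = α₁ ∧ b = α₂ ∧ X = p₂) ∨ (a = α₂ ∧ b = α₁ ∧ X = p₁) := by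
  have hlin : Finsupp.single b X + Finsupp.single a Y
      = Finsupp.single α₁ p₁ + Finsupp.single α₂ p₂ := by
    refine linearIndependent_exp_mul ?_
    rw [map_add, map_add]
    simp only [Finsupp.linearCombination_single]
    ext z
    simpa using h z
  have hev (x : ℂ) := DFunLike.congr_fun hlin x
  simp only [Finsupp.add_apply, Finsupp.single_apply] at hev
  have h1 := hev a
  have h2 := hev α₁
  have h3 := hev α₂
  grind

theorem nevCharEntire_eq_meanPosLog (f : ℂ → ℂ) : nevCharEntire f = meanPosLog f := by
  ext r
  simp [nevCharEntire, meanPosLog, Real.circleAverage_def, circleMap, logPlus, Real.posLog_apply,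
    max_comm]

theorem exists_meanPosLog_le_of_growthOrderEntire_lt_top {f : ℂ → ℂ}
    (h : growthOrderEntire f < ⊤) :
    ∃ (r₀ : ℝ) (j : ℕ), ∀ r, r₀ ≤ r → meanPosLog f r ≤ √r ^ j := by
  obtain ⟨K, hK, -⟩ := EReal.lt_iff_exists_real_btwn.1 h
  have h1 := Filter.eventually_lt_of_limsup_lt hK
  obtain ⟨r₀, h2⟩ := Filter.eventually_atTop.1 (h1.and (Filter.eventually_gt_atTop 1))
  refine ⟨r₀, 2 * ⌈K⌉₊, fun r hr => ?_⟩
  obtain ⟨h3, h4⟩ := h2 r hr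
  rw [EReal.coe_lt_coe_iff, nevCharEntire_eq_meanPosLog, div_lt_iff₀ (Real.log_pos h4)] at h3
  rw [pow_mul, Real.sq_sqrt (by linarith)]
  rcases (meanPosLog_nonneg f r).eq_or_lt with h5 | h5
  · rw [← h5]; positivity
  · rw [← Real.log_le_log_iff h5 (by positivity), Real.log_pow]
    calc _ ≤ logPlus (meanPosLog f r) := le_max_left _ _
      _ ≤ K * Real.log r := h3.le
      _ ≤ _ := by
        have := Real.log_pos h4
        gcongr
        exact Nat.le_ceil K

/-- `h` grows at most like the `d`-th power of `exp (discMajorant f A S)`, uniformly in `S`. -/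
def IsDiscBounded (f : ℂ → ℂ) (A : ℝ) (d : ℕ) (h : ℂ → ℂ) : Prop :=
  ∃ C : ℝ, ∀ S, 0 < S → ∀ z, ‖h z‖ ≤ C * Real.exp (discMajorant f A S z) ^ d

namespace IsDiscBounded

variable {f h₁ h₂ : ℂ → ℂ} {A : ℝ} {d e : ℕ}

theorem add (H₁ : IsDiscBounded f A d h₁) (H₂ : IsDiscBounded f A d h₂) :
    IsDiscBounded f A d fun z => h₁ z + h₂ z := by
  obtain ⟨C₁, H₁⟩ := H₁
  obtain ⟨C₂, H₂⟩ := H₂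
  refine ⟨C₁ + C₂, fun S hS z => (norm_add_le _ _).trans ?_⟩
  rw [add_mul]
  exact add_le_add (H₁ S hS z) (H₂ S hS z)

theorem mul (H₁ : IsDiscBounded f A d h₁) (H₂ : IsDiscBounded f A e h₂) :
    IsDiscBounded f A (d + e) fun z => h₁ z * h₂ z := by
  obtain ⟨C₁, H₁⟩ := H₁
  obtain ⟨C₂, H₂⟩ := H₂
  refine ⟨C₁ * C₂, fun S hS z => ?_⟩
  rw [norm_mul, pow_add, mul_mul_mul_comm]
  exact mul_le_mul (H₁ S hS z) (H₂ S hS z) (norm_nonneg _) ((norm_nonneg _).trans (H₁ S hS z))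

theorem const_mul (c : ℂ) (H : IsDiscBounded f A d h₁) :
    IsDiscBounded f A d fun z => c * h₁ z := by
  obtain ⟨C, H⟩ := H
  refine ⟨‖c‖ * C, fun S hS z => ?_⟩
  rw [norm_mul, mul_assoc]
  exact mul_le_mul_of_nonneg_left (H S hS z) (norm_nonneg c)

theorem sub (H₁ : IsDiscBounded f A d h₁) (H₂ : IsDiscBounded f A d h₂) :
    IsDiscBounded f A d fun z => h₁ z - h₂ z := by
  simpa [sub_eq_add_neg] using H₁.add (H₂.const_mul (-1))

end IsDiscBounded

theorem isDiscBounded_iteratedDeriv {f : ℂ → ℂ} (hf : Differentiable ℂ f) {A : ℝ} {c : ℂ}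
    (hA : ‖c‖ + 1 ≤ A) (j : ℕ) : IsDiscBounded f A 1 fun z => iteratedDeriv j f (z + c) :=
  ⟨j.factorial, fun _ hS z => by
    simpa using norm_iteratedDeriv_le_exp_discMajorant hf hS hA j z⟩

theorem posLog_le_of_le_mul_exp {x C t : ℝ} (hx : 0 ≤ x) (hC : 1 ≤ C) (ht : 0 ≤ t)
    (h : x ≤ C * Real.exp t) : posLog x ≤ Real.log C + t := by
  refine (Real.posLog_le_posLog hx h).trans (le_of_eq ?_)
  have : 1 ≤ C * Real.exp t := one_le_mul_of_one_le_of_one_le hC (Real.one_le_exp ht)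
  rw [Real.posLog_eq_log (this.trans (le_abs_self _)), Real.log_mul (by positivity) (by positivity),
    Real.log_exp]

/-- A Clunie-type lemma: if `f ^ (m + 2) * Q = R`, where `R` and `Q` are of degree one and three in
`f` and its shifts and derivatives, then `Q = 0`. -/
theorem eq_zero_of_pow_mul_eq {f Q R : ℂ → ℂ} (hf : Differentiable ℂ f)
    (hQ : Differentiable ℂ Q) (hbdd : ¬ Bornology.IsBounded (Set.range f))
    {r₀ : ℝ} {j : ℕ} (hgrowth : ∀ r, r₀ ≤ r → meanPosLog f r ≤ √r ^ j) {A : ℝ} (hA : 0 ≤ A)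
    (hRb : IsDiscBounded f A 1 R) (hQb : IsDiscBounded f A 3 Q) (m : ℕ)
    (h : ∀ z, f z ^ (m + 2) * Q z = R z) (z : ℂ) : Q z = 0 := by
  by_contra hne
  obtain ⟨C₁, hC₁⟩ := hRb
  obtain ⟨C₂, hC₂⟩ := hQb
  set C := max 1 (max C₁ C₂)
  have hC : 1 ≤ C := le_max_left _ _
  refine hbdd (isBounded_range_of_clunie (A := A) (C := Real.log C) (D := 1) hf hQ hne hA
    (Real.log_nonneg hC) (fun S hS ζ => ?_) (by simpa using hgrowth))
  set W := discMajorant f A S ζ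
  have hvW : posLog ‖f ζ‖ ≤ W := posLog_norm_le_discMajorant hf hS (by simpa using hA)
  have ht : 0 ≤ 3 * (W - posLog ‖f ζ‖) := by linarith
  suffices H : ‖f ζ * Q ζ‖ ≤ C * Real.exp (3 * (W - posLog ‖f ζ‖)) ∧
      ‖Q ζ‖ ≤ C * Real.exp (3 * (W - posLog ‖f ζ‖)) from
    ⟨posLog_le_of_le_mul_exp (norm_nonneg _) hC ht H.1,
      posLog_le_of_le_mul_exp (norm_nonneg _) hC ht H.2⟩
  rcases le_or_gt 1 ‖f ζ‖ with h1 | h1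
  · have hf0 : 0 < ‖f ζ‖ := by linarith
    have hexp : Real.exp (posLog ‖f ζ‖) = ‖f ζ‖ := by
      rw [Real.posLog_eq_log (by simpa using h1), Real.exp_log hf0]
    have hR : ‖f ζ‖ ^ (m + 1) * ‖f ζ * Q ζ‖ ≤ C * Real.exp W := by
      rw [← norm_pow, ← norm_mul, ← mul_assoc, ← pow_succ, h ζ]
      refine (hC₁ S hS ζ).trans ?_
      rw [pow_one]
      gcongr
      exact (le_max_left _ _).trans (le_max_right _ _)
    have hfQ : ‖f ζ * Q ζ‖ ≤ C * Real.exp (3 * (W - posLog ‖f ζ‖)) := by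
      calc ‖f ζ * Q ζ‖ ≤ C * Real.exp (W - posLog ‖f ζ‖) := by
            rw [Real.exp_sub, hexp, ← mul_div_assoc, le_div_iff₀ hf0, mul_comm]
            refine le_trans ?_ hR
            gcongr
            exact le_self_pow₀ h1 (by simp)
        _ ≤ _ := by gcongr; linarith
    refine ⟨hfQ, le_trans ?_ hfQ⟩
    rw [norm_mul]
    exact le_mul_of_one_le_left (norm_nonneg _) h1
  · have hv : posLog ‖f ζ‖ = 0 := by
      rw [Real.posLog_eq_zero_iff, abs_norm]; exact h1.le
    have hQ' : ‖Q ζ‖ ≤ C * Real.exp (3 * (W - posLog ‖f ζ‖)) := by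
      refine (hC₂ S hS ζ).trans ?_
      rw [← Real.exp_nat_mul, hv, sub_zero, Nat.cast_ofNat]
      gcongr
      exact (le_max_right _ _).trans (le_max_right _ _)
    refine ⟨le_trans ?_ hQ', hQ'⟩
    rw [norm_mul]
    exact mul_le_of_le_one_left (norm_nonneg _) h1.le

theorem hasDerivAt_iteratedDeriv {f : ℂ → ℂ} (hf : Differentiable ℂ f) (j : ℕ) (z : ℂ) :
    HasDerivAt (iteratedDeriv j f) (iteratedDeriv (j + 1) f z) z := by
  rw [iteratedDeriv_succ]
  exact ((hf.contDiff (n := (j + 1 : ℕ))).differentiable_iteratedDeriv j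
    (by exact_mod_cast Nat.lt_succ_self j) z).hasDerivAt

theorem exists_eq_const_mul_exp_of_eq {f : ℂ → ℂ} (hf : Differentiable ℂ f)
    (hbdd : ¬ Bornology.IsBounded (Set.range f)) {r₀ : ℝ} {j : ℕ}
    (hgrowth : ∀ r, r₀ ≤ r → meanPosLog f r ≤ √r ^ j) {m k : ℕ} {c w p₁ p₂ α β : ℂ} (hw : w ≠ 0)
    (heq : ∀ z, f z ^ (m + 4) * (f z + w * iteratedDeriv 1 f z) + iteratedDeriv k f (z + c)
      = p₁ * Complex.exp (α * z) + p₂ * Complex.exp (β * z)) :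
    ∃ a C : ℂ, C ≠ 0 ∧ ∀ z, f z = C * Complex.exp (a * z) := by
  have hd (j : ℕ) (z : ℂ) := hasDerivAt_iteratedDeriv hf j z
  have hf1 (z : ℂ) : HasDerivAt f (iteratedDeriv 1 f z) z := by simpa using hd 0 z
  set g : ℂ → ℂ := fun z => f z + w * iteratedDeriv 1 f z with hg
  set g' : ℂ → ℂ := fun z => iteratedDeriv 1 f z + w * iteratedDeriv 2 f z with hg'
  set g'' : ℂ → ℂ := fun z => iteratedDeriv 2 f z + w * iteratedDeriv 3 f z with hg''
  have dg (z : ℂ) : HasDerivAt g (g' z) z := (hf1 z).add ((hd 1 z).const_mul w)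
  have dg' (z : ℂ) : HasDerivAt g' (g'' z) z := (hd 1 z).add ((hd 2 z).const_mul w)
  set h : ℂ → ℂ := fun z => ((m + 4 : ℕ) : ℂ) * (iteratedDeriv 1 f z * g z) + f z * g' z with hh
  set h' : ℂ → ℂ := fun z => ((m + 4 : ℕ) : ℂ) *
      (iteratedDeriv 2 f z * g z + iteratedDeriv 1 f z * g' z) +
      (iteratedDeriv 1 f z * g' z + f z * g'' z) with hh'
  have dh (z : ℂ) : HasDerivAt h (h' z) z :=
    (((hd 1 z).mul (dg z)).const_mul _).add ((hf1 z).mul (dg' z))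
  set P : ℂ → ℂ := fun z => f z ^ (m + 4) * g z with hP
  set P' : ℂ → ℂ := fun z => f z ^ (m + 3) * h z with hP'
  set P'' : ℂ → ℂ := fun z => f z ^ (m + 2) *
      (((m + 3 : ℕ) : ℂ) * (iteratedDeriv 1 f z * h z) + f z * h' z) with hP''
  have dP (z : ℂ) : HasDerivAt P (P' z) z := by
    refine (((hf1 z).pow (m + 4)).mul (dg z)).congr_deriv ?_
    simp only [hP', hh, show m + 4 - 1 = m + 3 from rfl, Pi.pow_apply]
    ring
  have dP' (z : ℂ) : HasDerivAt P' (P'' z) z := by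
    refine (((hf1 z).pow (m + 3)).mul (dh z)).congr_deriv ?_
    simp only [hP'', show m + 3 - 1 = m + 2 from rfl, Pi.pow_apply]
    ring
  set R : ℂ → ℂ := fun z => (α + β) * iteratedDeriv (k + 1) f (z + c)
      - iteratedDeriv (k + 2) f (z + c) - α * β * iteratedDeriv k f (z + c) with hR
  set Q : ℂ → ℂ := fun z => ((m + 3 : ℕ) : ℂ) * (iteratedDeriv 1 f z * h z) + f z * h' z
      - (α + β) * (f z * h z) + α * β * (f z * f z * g z) with hQ
  have hLP (z : ℂ) : P'' z - (α + β) * P' z + α * β * P z = R z := by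
    have hE (p a z : ℂ) : HasDerivAt (fun z => p * Complex.exp (a * z))
        (p * a * Complex.exp (a * z)) z := by
      refine ((((hasDerivAt_id z).const_mul a).cexp).const_mul p).congr_deriv ?_
      simp only [id]
      ring
    have e0 (z : ℂ) : P z = p₁ * Complex.exp (α * z) + p₂ * Complex.exp (β * z)
        - iteratedDeriv k f (z + c) := eq_sub_of_add_eq (heq z)
    have e1 (z : ℂ) : P' z = p₁ * α * Complex.exp (α * z) + p₂ * β * Complex.exp (β * z)
        - iteratedDeriv (k + 1) f (z + c) := by
      refine (dP z).unique ?_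
      rw [funext e0]
      exact ((hE _ _ z).add (hE _ _ z)).sub ((hd k (z + c)).comp_add_const z c)
    have e2 : P'' z = p₁ * α * α * Complex.exp (α * z) + p₂ * β * β * Complex.exp (β * z)
        - iteratedDeriv (k + 2) f (z + c) := by
      refine (dP' z).unique ?_
      rw [funext e1]
      exact ((hE _ _ z).add (hE _ _ z)).sub ((hd (k + 1) (z + c)).comp_add_const z c)
    rw [e0, e1, e2, hR]
    ring
  have hfQ (z : ℂ) : f z ^ (m + 2) * Q z = P'' z - (α + β) * P' z + α * β * P z := by
    simp only [hQ, hP'', hP', hP]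
    ring
  have hQd : Differentiable ℂ Q := by
    have i1 : Differentiable ℂ (iteratedDeriv 1 f) := fun z => (hd 1 z).differentiableAt
    have i2 : Differentiable ℂ (iteratedDeriv 2 f) := fun z => (hd 2 z).differentiableAt
    have i3 : Differentiable ℂ (iteratedDeriv 3 f) := fun z => (hd 3 z).differentiableAt
    simp only [hQ, hh, hh', hg, hg', hg'']
    fun_prop
  have hA0 : 0 ≤ ‖c‖ + 1 := by positivity
  have hRb : IsDiscBounded f (‖c‖ + 1) 1 R := by
    have b (i : ℕ) := isDiscBounded_iteratedDeriv hf (c := c) le_rfl i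
    exact (((b _).const_mul _).sub (b _)).sub ((b _).const_mul _)
  have hQb : IsDiscBounded f (‖c‖ + 1) 3 Q := by
    have b (i : ℕ) : IsDiscBounded f (‖c‖ + 1) 1 (iteratedDeriv i f) := by
      simpa using isDiscBounded_iteratedDeriv hf (c := 0) (A := ‖c‖ + 1) (by simp) i
    have b0 : IsDiscBounded f (‖c‖ + 1) 1 f := by simpa using b 0
    have bg : IsDiscBounded f (‖c‖ + 1) 1 g := b0.add ((b 1).const_mul w)
    have bg' : IsDiscBounded f (‖c‖ + 1) 1 g' := (b 1).add ((b 2).const_mul w)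
    have bg'' : IsDiscBounded f (‖c‖ + 1) 1 g'' := (b 2).add ((b 3).const_mul w)
    have bh : IsDiscBounded f (‖c‖ + 1) 2 h := (((b 1).mul bg).const_mul _).add (b0.mul bg')
    have bh' : IsDiscBounded f (‖c‖ + 1) 2 h' :=
      ((((b 2).mul bg).add ((b 1).mul bg')).const_mul _).add (((b 1).mul bg').add (b0.mul bg''))
    exact (((((b 1).mul bh).const_mul _).add (b0.mul bh')).sub ((b0.mul bh).const_mul _)).add
      (((b0.mul b0).mul bg).const_mul _)
  have hQ0 := eq_zero_of_pow_mul_eq hf hQd hbdd hgrowth hA0 hRb hQb m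
    fun z => (hfQ z).trans (hLP z)
  have hLP0 (z : ℂ) : P'' z - (α + β) * P' z + α * β * P z = 0 := by
    rw [← hfQ, hQ0, mul_zero]
  have hexp : IsExpType f := by
    have hdk : Differentiable ℂ (iteratedDeriv k f) := fun z => (hd k z).differentiableAt
    refine .of_iteratedDeriv k hf (.of_second_order (α := α) (β := β) hdk fun z => ?_)
    rw [← iteratedDeriv_succ, ← iteratedDeriv_succ]
    have h1 := hLP (z - c)
    rw [hLP0] at h1
    simp only [hR, sub_add_cancel] at h1
    linear_combination h1
  refine hexp.exists_eq_const_mul_exp hf fun z₀ hz₀ => hbdd ?_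
  have hP0 := eq_zero_of_second_order dP dP' hLP0 (z₀ := z₀) (by simp [hP, hz₀])
    (by simp [hP', hz₀])
  have hf0 (z : ℂ) : f z ^ (m + 5) = 0 := by
    refine eq_zero_of_hasDerivAt_mul (F := fun z => f z ^ (m + 5)) (a := -((m + 5 : ℕ) : ℂ) / w)
      (z₀ := z₀) (fun ζ => ?_) (by simp [hz₀]) z
    refine ((hf1 ζ).pow (m + 5)).congr_deriv ?_
    have h1 := hP0 ζ
    simp only [hP, hg] at h1
    rw [show m + 5 - 1 = m + 4 from rfl]
    field_simp
    linear_combination ((m + 5 : ℕ) : ℂ) * h1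
  have : f = fun _ => 0 := funext fun z => pow_eq_zero_iff (by simp) |>.1 (hf0 z)
  rw [this]
  exact (Set.finite_range_const).isBounded

theorem statement0 (n k : ℕ) (hn : 5 ≤ n) (c w p₁ p₂ α₁ α₂ : ℂ)
    (hw : w ≠ 0) (hp₁ : p₁ ≠ 0) (hp₂ : p₂ ≠ 0) (hα₁ : α₁ ≠ 0) (hα₂ : α₂ ≠ 0)
    (hα : α₁ ≠ α₂) (f : ℂ → ℂ) (hf : Differentiable ℂ f)
    (htrans : TranscendentalEntire f) (hord : growthOrderEntire f < ⊤)
    (heq : ∀ z : ℂ, f z ^ n + w * f z ^ (n - 1) * deriv f z + iteratedDeriv k f (z + c)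
      = p₁ * Complex.exp (α₁ * z) + p₂ * Complex.exp (α₂ * z)) :
    ∃ a C : ℂ, a ≠ 0 ∧ C ≠ 0 ∧ (∀ z : ℂ, f z = C * Complex.exp (a * z)) ∧
      1 + a * w ≠ 0 ∧
      ((a = α₁ ∧ (n : ℂ) * a = α₂ ∧ C ^ n * (1 + a * w) = p₂) ∨
       (a = α₂ ∧ (n : ℂ) * a = α₁ ∧ C ^ n * (1 + a * w) = p₁)) := by
  obtain ⟨m, rfl⟩ := Nat.exists_eq_add_of_le' hn
  obtain ⟨r₀, j, hgrowth⟩ := exists_meanPosLog_le_of_growthOrderEntire_lt_top hord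
  have hbdd : ¬ Bornology.IsBounded (Set.range f) := fun hb =>
    htrans ⟨.C (f 0), fun z => by simpa using hf.apply_eq_apply_of_bounded hb z 0⟩
  obtain ⟨a, C, hC, hfa⟩ := exists_eq_const_mul_exp_of_eq (m := m) (k := k) (c := c)
    hf hbdd hgrowth hw
    (fun z => by
      rw [← heq z, iteratedDeriv_one, show m + 5 - 1 = m + 4 from rfl]
      ring)
  have ha : a ≠ 0 := by
    rintro rfl
    exact htrans ⟨.C C, fun z => by simpa using hfa z⟩
  have hiter (k : ℕ) (z : ℂ) : iteratedDeriv k f z = C * a ^ k * Complex.exp (a * z) := by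
    rw [funext hfa, iteratedDeriv_const_mul C (by fun_prop), iteratedDeriv_cexp_const_mul,
      mul_assoc]
  have hder (z : ℂ) : deriv f z = C * a * Complex.exp (a * z) := by
    simpa using hiter 1 z
  have hab : a ≠ ((m + 5 : ℕ) : ℂ) * a := by
    intro h
    have h1 : ((m + 4 : ℕ) : ℂ) * a = 0 := by
      push_cast at h ⊢
      linear_combination -h
    rcases mul_eq_zero.1 h1 with h2 | h2
    · norm_cast at h2
    · exact ha h2
  have key := eq_or_eq_of_exp_add_exp_eq (X := C ^ (m + 5) * (1 + a * w))
    (Y := C * a ^ k * Complex.exp (a * c)) (a := a) (b := ((m + 5 : ℕ) : ℂ) * a)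
    (by simp [hC, ha, Complex.exp_ne_zero]) hab hα hp₁ hp₂ fun z => by
      rw [← heq z, hder, hiter, hfa, mul_add a z c, Complex.exp_add, mul_assoc _ a z,
        Complex.exp_nat_mul, show m + 5 - 1 = m + 4 from rfl]
      ring
  refine ⟨a, C, ha, hC, hfa, fun h0 => ?_, ?_⟩
  · rw [h0, mul_zero] at key
    rcases key with ⟨-, -, h⟩ | ⟨-, -, h⟩
    · exact hp₂ h.symm
    · exact hp₁ h.symm
  · exact key
end
end

section
/- Let n = 4 and suppose f is a transcendental entire function of finite order on ℂ solving the differential-difference equation f(z)^n + w·f(z)^{n-1}·f'(z) + f^{(k)}(z+c) = p₁e^{α₁z} + p₂e^{α₂z}, and additionally N(r,1/f) = S(r,f). Then f has the form f(z) = C·e^{az}, where a and C are nonzero complex constants satisfying a = α_i and n·a = α_j for some indices {i,j} = {1,2}, with 1 + a·w ≠ 0 and C^n·(1 + a·w) = p_j. -/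
open MeasureTheory Filter Metric

noncomputable section

/-- The multiplicity of `z` as a zero of an entire function `f`: the smallest `k` such that
the `k`-th derivative of `f` does not vanish at `z` (`0` if `f z ≠ 0`). -/
def zeroMult (f : ℂ → ℂ) (z : ℂ) : ℕ := sInf {k : ℕ | iteratedDeriv k f z ≠ 0}

/-- The unintegrated counting function `n(r, 1/f)`: the number of zeros of `f`, counted with
multiplicity, in the closed disc `|z| ≤ r`. -/
def zeroCount (f : ℂ → ℂ) (r : ℝ) : ℕ := ∑ᶠ z ∈ Metric.closedBall (0:ℂ) r, zeroMult f z

/-- The integrated counting function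
`N(r,1/f) = ∫₀^r (n(t,1/f) − n(0,1/f))/t dt + n(0,1/f) log r` of the zeros of `f`. -/
def integZeroCount (f : ℂ → ℂ) (r : ℝ) : ℝ :=
  (zeroCount f 0 : ℝ) * Real.log r +
    ∫ t in (0:ℝ)..r, ((zeroCount f t : ℝ) - (zeroCount f 0 : ℝ)) / t

/-- `SmallFn g T` says that `g(r) = o(T(r))` as `r → ∞` outside a possible exceptional set of
finite linear (Lebesgue) measure; i.e. `g(r) = S(r,f)` when `T = T(·,f)`. -/
def SmallFn (g T : ℝ → ℝ) : Prop :=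
  ∃ E : Set ℝ, volume E < ⊤ ∧
    ∀ ε : ℝ, 0 < ε → ∃ R : ℝ, ∀ r : ℝ, R ≤ r → r ∉ E → |g r| ≤ ε * T r

/-- Entire functions of exponential type (order at most one, finite type). -/
def ExpType (F : ℂ → ℂ) : Prop :=
  Differentiable ℂ F ∧ ∃ B : ℝ, 0 ≤ B ∧ ∀ z, ‖F z‖ ≤ Real.exp (B * (‖z‖ + 1))

lemma exists_eq_sub_mul_of_eq_zero {F : ℂ → ℂ} (hF : Differentiable ℂ F) {a : ℂ} (ha : F a = 0) :
    ∃ G, Differentiable ℂ G ∧ ∀ z, F z = (z - a) * G z := by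
  refine ⟨dslope F a, ?_, fun z => ?_⟩
  · rw [← differentiableOn_univ, Complex.differentiableOn_dslope Filter.univ_mem]
    exact hF.differentiableOn
  · have := sub_smul_dslope F a z
    rw [ha, sub_zero, smul_eq_mul] at this
    exact this.symm

lemma pow_card_le_norm_prod (s : Multiset ℂ) {c : ℝ} (hc : 0 ≤ c) (z : ℂ)
    (h : ∀ a ∈ s, c ≤ ‖z - a‖) : c ^ s.card ≤ ‖(s.map (fun a => z - a)).prod‖ := by
  induction s using Multiset.induction with
  | empty => simp
  | cons a s ih =>
    simp only [Multiset.card_cons, Multiset.map_cons, Multiset.prod_cons, norm_mul]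
    rw [pow_succ, mul_comm]
    have h1 := h a (Multiset.mem_cons_self a s)
    have h2 := ih (fun b hb => h b (Multiset.mem_cons_of_mem hb))
    gcongr

lemma norm_prod_le_pow_card (s : Multiset ℂ) {c : ℝ} (hc : 0 ≤ c) (z : ℂ)
    (h : ∀ a ∈ s, ‖z - a‖ ≤ c) : ‖(s.map (fun a => z - a)).prod‖ ≤ c ^ s.card := by
  induction s using Multiset.induction with
  | empty => simp
  | cons a s ih =>
    simp only [Multiset.card_cons, Multiset.map_cons, Multiset.prod_cons, norm_mul]
    rw [pow_succ, mul_comm (c ^ _)]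
    have h1 := h a (Multiset.mem_cons_self a s)
    have h2 := ih (fun b hb => h b (Multiset.mem_cons_of_mem hb))
    gcongr

section Factor

variable {F G : ℂ → ℂ} {B R : ℝ} {s : Multiset ℂ}

lemma norm_cofactor_mul_le (hF : ∀ z, ‖F z‖ ≤ Real.exp (B * (‖z‖ + 1)))
    (hR : 0 < R) (hs : ∀ a ∈ s, ‖a‖ ≤ 2 * R) (hG : Differentiable ℂ G)
    (hFG : ∀ z, F z = (s.map (fun a => z - a)).prod * G z) {z : ℂ} (hz : ‖z‖ ≤ 8 * R) :
    ‖G z‖ ≤ Real.exp (B * (8 * R + 1)) / (6 * R) ^ s.card := by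
  refine Complex.norm_le_of_forall_mem_frontier_norm_le (U := ball 0 (8 * R)) isBounded_ball
    hG.diffContOnCl (fun w hw => ?_) ?_
  · rw [frontier_ball _ (by positivity), mem_sphere_zero_iff_norm] at hw
    rw [le_div_iff₀ (by positivity)]
    have h1 : (6 * R) ^ s.card ≤ ‖(s.map (fun a => w - a)).prod‖ := by
      refine pow_card_le_norm_prod s (by positivity) w fun a ha => ?_
      have := norm_sub_norm_le w a
      have := hs a ha
      linarith
    have h2 := hF w
    rw [hFG, norm_mul, hw] at h2
    refine le_trans ?_ h2
    rw [mul_comm]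
    gcongr
  · rw [closure_ball _ (by positivity)]
    simpa using hz

lemma norm_zero_le_cofactor (hR : 0 < R) (hs : ∀ a ∈ s, ‖a‖ ≤ 2 * R)
    (hFG : ∀ z, F z = (s.map (fun a => z - a)).prod * G z) :
    ‖F 0‖ ≤ (2 * R) ^ s.card * ‖G 0‖ := by
  rw [hFG, norm_mul]
  gcongr
  exact norm_prod_le_pow_card s (by positivity) 0 fun a ha => by simpa using hs a ha

lemma cofactor_growth (hB : 0 ≤ B) (hF : ∀ z, ‖F z‖ ≤ Real.exp (B * (‖z‖ + 1)))
    (hF0 : F 0 ≠ 0) (hR : 1 ≤ R) (hs : ∀ a ∈ s, ‖a‖ ≤ 2 * R) (hG : Differentiable ℂ G)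
    (hFG : ∀ z, F z = (s.map (fun a => z - a)).prod * G z) {z : ℂ} (hz : ‖z‖ ≤ 8 * R) :
    3 ^ s.card * ‖G z‖ ≤ Real.exp ((9 * B + |Real.log ‖F 0‖| + 1) * R) * ‖G 0‖ := by
  have hR0 : 0 < R := by linarith
  have h1 := norm_cofactor_mul_le hF hR0 hs hG hFG hz
  have h2 := norm_zero_le_cofactor hR0 hs hFG
  rw [le_div_iff₀ (by positivity)] at h1
  have hF0' : 0 < ‖F 0‖ := norm_pos_iff.2 hF0
  have h3 : 3 ^ s.card * ‖G z‖ * ‖F 0‖ ≤ Real.exp (B * (8 * R + 1)) * ‖G 0‖ := by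
    calc 3 ^ s.card * ‖G z‖ * ‖F 0‖ ≤ 3 ^ s.card * ‖G z‖ * ((2 * R) ^ s.card * ‖G 0‖) := by gcongr
      _ = (‖G z‖ * (6 * R) ^ s.card) * ‖G 0‖ := by
        rw [show 6 * R = 3 * (2 * R) by ring, mul_pow 3 (2 * R)]; ring
      _ ≤ _ := by gcongr
  have h4 : Real.exp (B * (8 * R + 1)) ≤ Real.exp ((9 * B + |Real.log ‖F 0‖| + 1) * R) * ‖F 0‖ := by
    nth_rw 2 [← Real.exp_log hF0']
    rw [← Real.exp_add, Real.exp_le_exp]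
    have := neg_abs_le (Real.log ‖F 0‖)
    nlinarith [abs_nonneg (Real.log ‖F 0‖)]
  have h5 : 3 ^ s.card * ‖G z‖ * ‖F 0‖ ≤
      (Real.exp ((9 * B + |Real.log ‖F 0‖| + 1) * R) * ‖G 0‖) * ‖F 0‖ := by
    refine h3.trans ?_
    calc _ ≤ (Real.exp ((9 * B + |Real.log ‖F 0‖| + 1) * R) * ‖F 0‖) * ‖G 0‖ := by gcongr
      _ = _ := by ring
  exact le_of_mul_le_mul_right h5 hF0'

lemma card_le_of_factor (hB : 0 ≤ B) (hF : ∀ z, ‖F z‖ ≤ Real.exp (B * (‖z‖ + 1)))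
    (hF0 : F 0 ≠ 0) (hR : 1 ≤ R) (hs : ∀ a ∈ s, ‖a‖ ≤ 2 * R) (hG : Differentiable ℂ G)
    (hFG : ∀ z, F z = (s.map (fun a => z - a)).prod * G z) :
    (s.card : ℝ) ≤ (9 * B + |Real.log ‖F 0‖| + 1) * R := by
  have hG0 : 0 < ‖G 0‖ := by
    rw [norm_pos_iff]; intro h; apply hF0; rw [hFG, h, mul_zero]
  have h1 := cofactor_growth hB hF hF0 hR hs hG hFG (z := 0) (by simp; linarith)
  have h2 := le_of_mul_le_mul_right h1 hG0
  rw [← Real.log_le_log_iff (by positivity) (by positivity), Real.log_exp, Real.log_pow] at h2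
  have h3 : (1 : ℝ) ≤ Real.log 3 := by
    rw [Real.le_log_iff_exp_le (by norm_num)]
    linarith [Real.exp_one_lt_d9]
  nlinarith [Nat.cast_nonneg (α := ℝ) s.card]

end Factor

lemma norm_deriv_le_of_ne_zero {G : ℂ → ℂ} {M R : ℝ} (hG : Differentiable ℂ G) (hR : 0 < R)
    (hM : 0 < M) (h0 : ∀ z ∈ ball (0 : ℂ) (2 * R), G z ≠ 0)
    (hb : ∀ z ∈ ball (0 : ℂ) (2 * R), ‖G z‖ ≤ Real.exp M * ‖G 0‖) {z : ℂ}
    (hz : z ∈ closedBall (0 : ℂ) R) : ‖deriv G z‖ ≤ 12 * M / R * ‖G z‖ := by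
  have hG' : Differentiable ℂ (deriv G) := by
    intro z
    exact (hG.analyticAt z).deriv.differentiableAt
  have hq : DifferentiableOn ℂ (fun z => deriv G z / G z) (ball 0 (2 * R)) :=
    hG'.differentiableOn.div hG.differentiableOn h0
  obtain ⟨h, hh0, hh⟩ := hq.isExactOn_ball.with_val_at 0 0
  have hd : DifferentiableOn ℂ h (ball 0 (2 * R)) := fun z hz =>
    (hh z hz).differentiableAt.differentiableWithinAt
  have h0mem : (0 : ℂ) ∈ ball (0 : ℂ) (2 * R) := mem_ball_self (by positivity)
  have hconst : ∀ z ∈ ball (0 : ℂ) (2 * R), G z = G 0 * Complex.exp (h z) := by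
    intro z hz
    have key : ∀ w ∈ ball (0 : ℂ) (2 * R),
        HasDerivAt (fun z => G z * Complex.exp (-h z)) 0 w := by
      intro w hw
      have := (hG w).hasDerivAt.mul ((hh w hw).neg.cexp)
      have hw0 := h0 w hw
      refine this.congr_deriv ?_
      rw [mul_neg, mul_neg, mul_left_comm, mul_div_cancel₀ _ hw0, mul_comm, add_neg_cancel]
    have := isOpen_ball.is_const_of_deriv_eq_zero
      (convex_ball (0 : ℂ) (2 * R)).isPreconnected
      (fun w hw => (key w hw).differentiableAt.differentiableWithinAt)
      (fun w hw => (key w hw).deriv) hz h0mem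
    simp only [hh0, neg_zero, Complex.exp_zero, mul_one] at this
    rw [← this, mul_assoc, ← Complex.exp_add]
    simp
  have hG0 : 0 < ‖G 0‖ := norm_pos_iff.2 (h0 0 h0mem)
  have hre : Set.MapsTo h (ball 0 (2 * R)) {z | z.re ≤ M} := by
    intro w hw
    have := hb w hw
    rw [hconst w hw, norm_mul, Complex.norm_exp, mul_comm] at this
    exact Real.exp_le_exp.1 (le_of_mul_le_mul_right this hG0)
  have hbc : ∀ w, ‖w‖ ≤ 3 / 2 * R → ‖h w‖ ≤ 6 * M := by
    intro w hw
    have hw' : w ∈ ball (0 : ℂ) (2 * R) := by simp; linarith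
    have := Complex.borelCaratheodory_zero hM hd hre (by positivity) hw' hh0
    refine this.trans ?_
    rw [div_le_iff₀ (by linarith)]
    nlinarith
  simp only [mem_closedBall, dist_zero_right] at hz
  have hz' : z ∈ ball (0 : ℂ) (2 * R) := by simp; linarith
  have hder : ‖deriv h z‖ ≤ 6 * M / (R / 2) := by
    refine Complex.norm_deriv_le_of_forall_mem_sphere_norm_le (by positivity) ?_ ?_
    · refine DifferentiableOn.diffContOnCl_ball (U := ball 0 (2 * R)) hd ?_
      intro w hw
      simp only [mem_closedBall, dist_eq_norm, mem_ball, sub_zero] at hw ⊢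
      have := norm_le_norm_add_norm_sub z w
      rw [norm_sub_rev] at this
      linarith
    · intro w hw
      simp only [mem_sphere, dist_eq_norm] at hw
      apply hbc
      have := norm_le_norm_add_norm_sub z w
      rw [norm_sub_rev] at this
      linarith
  rw [(hh z hz').deriv, norm_div, div_le_iff₀ (norm_pos_iff.2 (h0 z hz'))] at hder
  refine hder.trans (le_of_eq ?_)
  field_simp
  ring

/-- The data of a factorization of `F` by its zeros in a large disc. -/
structure FactorsOn (F : ℂ → ℂ) (C R : ℝ) (s : Multiset ℂ) (G : ℂ → ℂ) : Prop where
  card_le : (s.card : ℝ) ≤ C * R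
  diff : Differentiable ℂ G
  eq : ∀ z, F z = (s.map (fun a => z - a)).prod * G z
  ne_zero : ∀ z ∈ closedBall (0 : ℂ) (2 * R), G z ≠ 0
  deriv_le : ∀ z ∈ closedBall (0 : ℂ) R, ‖deriv G z‖ ≤ C * ‖G z‖

lemma exists_factorsOn_of_ne_zero {F : ℂ → ℂ} (hF : ExpType F) (hF0 : F 0 ≠ 0) :
    ∃ C : ℝ, 0 ≤ C ∧ ∀ R : ℝ, 1 ≤ R → ∃ s G, FactorsOn F C R s G := by
  obtain ⟨hd, B, hB, hb⟩ := hF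
  set C := 9 * B + |Real.log ‖F 0‖| + 1 with hC
  have hCpos : 0 < C := by positivity
  refine ⟨12 * C, by positivity, fun R hR => ?_⟩
  have hR0 : 0 < R := by linarith
  let P : ℕ → Prop := fun n => ∃ (s : Multiset ℂ) (G : ℂ → ℂ), s.card = n ∧
    (∀ a ∈ s, ‖a‖ ≤ 2 * R) ∧ Differentiable ℂ G ∧
    ∀ z, F z = (s.map (fun a => z - a)).prod * G z
  have hP0 : P 0 := ⟨0, F, rfl, by simp, hd, by simp⟩
  have hPb : ∀ n, P n → n ≤ ⌊C * R⌋₊ := by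
    rintro n ⟨s, G, rfl, h1, h2, h3⟩
    exact Nat.le_floor (card_le_of_factor hB hb hF0 hR h1 h2 h3)
  classical
  have hmax := Nat.findGreatest_spec (P := P) (Nat.zero_le ⌊C * R⌋₊) hP0
  obtain ⟨s, G, hsc, hs, hG, hFG⟩ := hmax
  have hne : ∀ z ∈ closedBall (0 : ℂ) (2 * R), G z ≠ 0 := by
    intro z hz hGz
    obtain ⟨H, hH, hGH⟩ := exists_eq_sub_mul_of_eq_zero hG hGz
    have hP : P (s.card + 1) := by
      refine ⟨z ::ₘ s, H, by simp, ?_, hH, fun w => ?_⟩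
      · intro a ha
        rcases Multiset.mem_cons.1 ha with rfl | ha
        · simpa using hz
        · exact hs a ha
      · rw [hFG, hGH]; simp; ring
    have := Nat.le_findGreatest (hPb _ hP) hP
    omega
  refine ⟨s, G, ?_, hG, hFG, hne, ?_⟩
  · have := card_le_of_factor hB hb hF0 hR hs hG hFG
    rw [← hC] at this
    nlinarith
  · intro z hz
    have := norm_deriv_le_of_ne_zero hG hR0 (M := C * R) (by positivity)
      (fun z hz => hne z (ball_subset_closedBall hz)) (fun w hw => ?_) hz
    · rwa [show 12 * (C * R) / R = 12 * C by field_simp] at this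
    · have hw' : ‖w‖ ≤ 8 * R := by simp at hw; linarith
      refine le_trans ?_ (cofactor_growth hB hb hF0 hR hs hG hFG hw')
      have : (1 : ℝ) ≤ 3 ^ s.card := one_le_pow₀ (by norm_num)
      nlinarith [norm_nonneg (G w)]

lemma ExpType.comp_add {F : ℂ → ℂ} (hF : ExpType F) (c : ℂ) : ExpType (fun z => F (z + c)) := by
  obtain ⟨hd, B, hB, hb⟩ := hF
  refine ⟨hd.comp (differentiable_id.add_const c), B * (1 + ‖c‖), by positivity, fun z => ?_⟩
  refine (hb _).trans (Real.exp_le_exp.2 ?_)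
  have := norm_add_le z c
  rw [mul_assoc]
  gcongr
  nlinarith [norm_nonneg z, norm_nonneg c]

/-- An entire function of exponential type factors, on each disc of radius `R`, as a product of
`O(R)` linear factors and a zero-free factor with bounded logarithmic derivative. -/
theorem ExpType.exists_factorsOn {F : ℂ → ℂ} (hF : ExpType F) (hne : ∃ b, F b ≠ 0) :
    ∃ C : ℝ, 0 ≤ C ∧ ∀ R : ℝ, 1 ≤ R → ∃ s G, FactorsOn F C R s G := by
  obtain ⟨b, hb⟩ := hne
  obtain ⟨C, hC, h⟩ := exists_factorsOn_of_ne_zero (hF.comp_add b) (by simpa using hb)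
  refine ⟨C * (1 + ‖b‖), by positivity, fun R hR => ?_⟩
  obtain ⟨s, G, h1, h2, h3, h4, h5⟩ := h (R + ‖b‖) (by linarith [norm_nonneg b])
  have hle : ∀ z : ℂ, ‖z - b‖ ≤ ‖z‖ + ‖b‖ := fun z => norm_sub_le z b
  refine ⟨s.map (fun a => a + b), fun z => G (z - b), ?_, h2.comp (differentiable_id.sub_const b),
    fun z => ?_, fun z hz => ?_, fun z hz => ?_⟩
  · rw [Multiset.card_map, mul_assoc]
    refine h1.trans ?_
    gcongr
    nlinarith [norm_nonneg b]
  · have := h3 (z - b)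
    simp only [sub_add_cancel] at this
    rw [this, Multiset.map_map]
    congr 3
    ext a
    simp; ring
  · apply h4
    simp at hz ⊢
    linarith [hle z, norm_nonneg b]
  · rw [deriv_comp_sub_const]
    refine (h5 _ ?_).trans ?_
    · simp at hz ⊢
      linarith [hle z]
    · gcongr
      nlinarith [norm_nonneg b]

open Real in
lemma circleAverage_mono_of_ne_zero {H : ℂ → ℂ} (hH : Differentiable ℂ H) (hne : ∃ b, H b ≠ 0)
    {c : ℂ} {R : ℝ} (hR : 0 < R) {f₁ f₂ : ℂ → ℝ} (hf₁ : CircleIntegrable f₁ c R)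
    (hf₂ : CircleIntegrable f₂ c R) (h : ∀ z ∈ sphere c R, H z ≠ 0 → f₁ z ≤ f₂ z) :
    circleAverage f₁ c R ≤ circleAverage f₂ c R := by
  classical
  obtain ⟨b, hb⟩ := hne
  have hcod : H ⁻¹' {0}ᶜ ∈ codiscrete ℂ :=
    AnalyticOnNhd.preimage_zero_mem_codiscrete (x := b) (fun z _ => hH.analyticAt z) hb
  have heq : f₁ =ᶠ[codiscreteWithin (sphere c |R|)] fun z => if H z = 0 then f₂ z else f₁ z := by
    have := codiscreteWithin_mono (Set.subset_univ (sphere c |R|)) hcod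
    filter_upwards [this] with z hz
    have hz' : H z ≠ 0 := hz
    simp [hz']
  rw [circleAverage_congr_codiscreteWithin heq hR.ne']
  refine circleAverage_mono (hf₁.congr_codiscreteWithin heq) hf₂ fun z hz => ?_
  rw [abs_of_pos hR] at hz
  by_cases hz0 : H z = 0
  · simp [hz0]
  · simpa [hz0] using h z hz hz0

lemma Differentiable.circleIntegrable_log_norm {F : ℂ → ℂ} (hF : Differentiable ℂ F) (c : ℂ)
    (R : ℝ) : CircleIntegrable (fun z => Real.log ‖F z‖) c R :=
  MeromorphicOn.circleIntegrable_log_norm fun z _ => (hF.analyticAt z).meromorphicAt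

lemma Meromorphic.circleIntegrable_posLog_norm {q : ℂ → ℂ} (hq : Meromorphic q) (c : ℂ)
    (R : ℝ) : CircleIntegrable (fun z => Real.posLog ‖q z‖) c R :=
  MeromorphicOn.circleIntegrable_posLog_norm fun z _ => hq z

/-- `q` is meromorphic and its proximity function is `o(r)`. -/
def SmallProximity (q : ℂ → ℂ) : Prop :=
  Meromorphic q ∧ ∀ ε : ℝ, 0 < ε → ∀ᶠ r in atTop,
    Real.circleAverage (fun z => Real.posLog ‖q z‖) 0 r ≤ ε * r

/-- The mean of `log ‖F‖` over the circle of radius `r` is at most `o(r)`. -/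
def SmallLogMean (F : ℂ → ℂ) : Prop :=
  ∀ ε : ℝ, 0 < ε → ∀ᶠ r in atTop, Real.circleAverage (fun z => Real.log ‖F z‖) 0 r ≤ ε * r

namespace SmallProximity

variable {q q₁ q₂ : ℂ → ℂ}

lemma const (a : ℂ) : SmallProximity fun _ => a := by
  refine ⟨Meromorphic.const a, fun ε hε => ?_⟩
  filter_upwards [eventually_ge_atTop (Real.posLog ‖a‖ / ε)] with r hr
  rw [Real.circleAverage_const]
  rwa [div_le_iff₀ hε, mul_comm] at hr

lemma mul (h₁ : SmallProximity q₁) (h₂ : SmallProximity q₂) :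
    SmallProximity fun z => q₁ z * q₂ z := by
  refine ⟨h₁.1.mul h₂.1, fun ε hε => ?_⟩
  filter_upwards [h₁.2 (ε / 2) (by positivity), h₂.2 (ε / 2) (by positivity)] with r hr₁ hr₂
  have i₁ := h₁.1.circleIntegrable_posLog_norm 0 r
  have i₂ := h₂.1.circleIntegrable_posLog_norm 0 r
  have h := Real.circleAverage_mono ((h₁.1.mul h₂.1).circleIntegrable_posLog_norm 0 r)
    (i₁.add i₂) (fun z _ => by
      simp only [Pi.mul_apply, norm_mul, Pi.add_apply]
      exact Real.posLog_mul)
  rw [Real.circleAverage_add i₁ i₂] at h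
  refine h.trans ?_
  linarith

lemma add (h₁ : SmallProximity q₁) (h₂ : SmallProximity q₂) :
    SmallProximity fun z => q₁ z + q₂ z := by
  refine ⟨h₁.1.add h₂.1, fun ε hε => ?_⟩
  filter_upwards [h₁.2 (ε / 3) (by positivity), h₂.2 (ε / 3) (by positivity),
    eventually_ge_atTop (Real.log 2 / (ε / 3))] with r hr₁ hr₂ hr₃
  rw [div_le_iff₀ (by positivity)] at hr₃
  have i₁ := h₁.1.circleIntegrable_posLog_norm 0 r
  have i₂ := h₂.1.circleIntegrable_posLog_norm 0 r
  have i₀ := circleIntegrable_const (Real.log 2) 0 r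
  have h := Real.circleAverage_mono ((h₁.1.add h₂.1).circleIntegrable_posLog_norm 0 r)
    (i₀.add (i₁.add i₂)) (fun z _ => by
      simp only [Pi.add_apply]
      have := Real.posLog_norm_add_le (q₁ z) (q₂ z)
      linarith)
  rw [Real.circleAverage_add i₀ (i₁.add i₂), Real.circleAverage_add i₁ i₂,
    Real.circleAverage_const] at h
  refine h.trans ?_
  linarith

lemma of_norm_le (h : SmallProximity q₁) (hq : Meromorphic q) {H : ℂ → ℂ}
    (hH : Differentiable ℂ H) (hne : ∃ b, H b ≠ 0) (hle : ∀ z, H z ≠ 0 → ‖q z‖ ≤ ‖q₁ z‖) :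
    SmallProximity q := by
  refine ⟨hq, fun ε hε => ?_⟩
  filter_upwards [h.2 ε hε, eventually_gt_atTop 0] with r hr hr0
  refine le_trans ?_ hr
  exact circleAverage_mono_of_ne_zero hH hne hr0 (hq.circleIntegrable_posLog_norm 0 r)
    (h.1.circleIntegrable_posLog_norm 0 r)
    fun z _ hz => Real.posLog_le_posLog (norm_nonneg _) (hle z hz)

end SmallProximity

lemma SmallLogMean.mul {F G : ℂ → ℂ} (hF : SmallLogMean F) (hG : SmallLogMean G)
    (dF : Differentiable ℂ F) (dG : Differentiable ℂ G) (hne : ∃ b, F b * G b ≠ 0) :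
    SmallLogMean fun z => F z * G z := by
  intro ε hε
  filter_upwards [hF (ε / 2) (by positivity), hG (ε / 2) (by positivity),
    eventually_gt_atTop 0] with r h₁ h₂ hr
  have i₁ := dF.circleIntegrable_log_norm 0 r
  have i₂ := dG.circleIntegrable_log_norm 0 r
  have h := circleAverage_mono_of_ne_zero (dF.mul dG) hne hr
    ((dF.mul dG).circleIntegrable_log_norm 0 r) (i₁.add i₂) (fun z _ hz => by
      simp only [Pi.mul_apply, norm_mul, Pi.add_apply] at hz ⊢
      rw [Real.log_mul (by simpa using left_ne_zero_of_mul hz)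
        (by simpa using right_ne_zero_of_mul hz)])
  rw [Real.circleAverage_add i₁ i₂] at h
  refine h.trans ?_
  linarith

lemma SmallLogMean.of_norm_le {f F q : ℂ → ℂ} (hf : SmallLogMean f) (hq : SmallProximity q)
    (df : Differentiable ℂ f) (dF : Differentiable ℂ F) (hne : ∃ b, F b ≠ 0)
    (hne' : ∃ b, f b ≠ 0) (hle : ∀ z, f z ≠ 0 → ‖F z‖ ≤ ‖q z‖ * ‖f z‖) : SmallLogMean F := by
  intro ε hε
  obtain ⟨b, hb⟩ : ∃ b, F b * f b ≠ 0 := by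
    by_contra! h
    have := AnalyticOnNhd.eq_zero_or_eq_zero_of_mul_eq_zero (U := Set.univ)
      (fun z _ => dF.analyticAt z) (fun z _ => df.analyticAt z) (fun z _ => h z)
      isPreconnected_univ
    obtain ⟨b, hb⟩ := hne
    obtain ⟨b', hb'⟩ := hne'
    rcases this with h | h
    · exact hb (h b trivial)
    · exact hb' (h b' trivial)
  filter_upwards [hf (ε / 2) (by positivity), hq.2 (ε / 2) (by positivity),
    eventually_gt_atTop 0] with r h₁ h₂ hr
  have i₁ := df.circleIntegrable_log_norm 0 r
  have i₂ := hq.1.circleIntegrable_posLog_norm 0 r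
  have h := circleAverage_mono_of_ne_zero (dF.mul df) ⟨b, hb⟩ hr
    (dF.circleIntegrable_log_norm 0 r) (i₂.add i₁) (fun z _ hz => by
      simp only [Pi.mul_apply, Pi.add_apply] at hz ⊢
      have hf0 := norm_pos_iff.2 (right_ne_zero_of_mul hz)
      have hF0 := norm_pos_iff.2 (left_ne_zero_of_mul hz)
      have hle' := hle z (right_ne_zero_of_mul hz)
      have hq0 : 0 < ‖q z‖ := by
        rcases (norm_nonneg (q z)).eq_or_lt with h | h
        · rw [← h] at hle'; linarith
        · exact h
      have := Real.log_le_log hF0 hle'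
      rw [Real.log_mul hq0.ne' hf0.ne'] at this
      have h3 : Real.log ‖q z‖ ≤ Real.posLog ‖q z‖ := le_max_right _ _
      linarith)
  rw [Real.circleAverage_add i₂ i₁] at h
  refine h.trans ?_
  linarith

lemma exists_le_circleAverage_log_norm {F : ℂ → ℂ} (hF : Differentiable ℂ F) :
    ∃ K : ℝ, ∀ r, 1 ≤ r → K ≤ Real.circleAverage (fun z => Real.log ‖F z‖) 0 r := by
  refine ⟨Real.log ‖meromorphicTrailingCoeffAt F 0‖, fun r hr => ?_⟩
  have han : AnalyticOnNhd ℂ F (closedBall 0 |r|) := fun z _ => hF.analyticAt z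
  have hr0 : 0 < r := by linarith
  rw [MeromorphicOn.circleAverage_log_norm hr0.ne' han.meromorphicOn]
  have hD := MeromorphicOn.AnalyticOnNhd.divisor_nonneg han
  have h1 : 0 ≤ ∑ᶠ u, (MeromorphicOn.divisor F (closedBall 0 |r|) u : ℝ) *
      Real.log (r * ‖(0 : ℂ) - u‖⁻¹) := by
    refine finsum_nonneg fun u => ?_
    by_cases hu : u ∈ closedBall (0 : ℂ) |r|
    · refine mul_nonneg (by exact_mod_cast hD u) ?_
      by_cases hu0 : u = 0
      · simp [hu0]
      · have : 0 < ‖u‖ := norm_pos_iff.2 hu0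
        refine Real.log_nonneg ?_
        simp only [zero_sub, norm_neg]
        rw [← div_eq_mul_inv, one_le_div this]
        simpa [abs_of_pos hr0] using hu
    · simp [Function.locallyFinsuppWithin.apply_eq_zero_of_notMem _ hu]
  have h2 : 0 ≤ (MeromorphicOn.divisor F (closedBall 0 |r|) 0 : ℝ) * Real.log r :=
    mul_nonneg (by exact_mod_cast hD 0) (Real.log_nonneg hr)
  linarith

lemma circleAverage_re_eq {P : ℂ → ℂ} (hP : Differentiable ℂ P) (r : ℝ) :
    Real.circleAverage (fun z => (P z).re) 0 r = (P 0).re :=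
  InnerProductSpace.HarmonicOnNhd.circleAverage_eq
    (fun z _ => (hP.analyticAt z).harmonicAt_re)

lemma linear_bound_le_max (β₁ β₂ : ℂ) (hβ : β₁ ≠ β₂) {r : ℝ} (hr : 0 < r) {z : ℂ}
    (hz : ‖z‖ = r) :
    ((β₁ + β₂) * z / 2 + (‖β₁ - β₂‖ * r / 4 : ℝ) +
      ((β₁ - β₂) * z) ^ 2 / (4 * ‖β₁ - β₂‖ * r : ℝ)).re ≤ max (β₁ * z).re (β₂ * z).re := by
  have hn : 0 < ‖β₁ - β₂‖ := norm_pos_iff.2 (sub_ne_zero.2 hβ)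
  set x := ((β₁ - β₂) * z).re with hx
  have hxn : |x| ≤ ‖β₁ - β₂‖ * r := by
    have := Complex.abs_re_le_norm ((β₁ - β₂) * z)
    rwa [norm_mul, hz] at this
  have hsq : (((β₁ - β₂) * z) ^ 2).re = 2 * x ^ 2 - (‖β₁ - β₂‖ * r) ^ 2 := by
    have h1 := Complex.sq_norm ((β₁ - β₂) * z)
    rw [norm_mul, hz, Complex.normSq_apply] at h1
    rw [h1, hx, pow_two ((β₁ - β₂) * z), Complex.mul_re]
    ring
  have hxe : x = (β₁ * z).re - (β₂ * z).re := by rw [hx, sub_mul, Complex.sub_re]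
  have hs : (β₁ * z).re + (β₂ * z).re = ((β₁ + β₂) * z).re := by rw [add_mul, Complex.add_re]
  have hmax : max (β₁ * z).re (β₂ * z).re = (((β₁ + β₂) * z).re + |x|) / 2 := by
    rw [← hs, hxe]
    rcases le_total (β₁ * z).re (β₂ * z).re with h | h
    · rw [max_eq_right h, abs_of_nonpos (by linarith)]; ring
    · rw [max_eq_left h, abs_of_nonneg (by linarith)]; ring
  rw [hmax, Complex.add_re, Complex.add_re, Complex.div_ofReal_re, hsq, Complex.ofReal_re,
    show ((β₁ + β₂) * z / 2).re = ((β₁ + β₂) * z).re / 2 by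
      rw [show (2 : ℂ) = ((2 : ℝ) : ℂ) by simp, Complex.div_ofReal_re]]
  have key : ‖β₁ - β₂‖ * r / 4 + (2 * x ^ 2 - (‖β₁ - β₂‖ * r) ^ 2) / (4 * ‖β₁ - β₂‖ * r)
      = x ^ 2 / (2 * (‖β₁ - β₂‖ * r)) := by
    field_simp
    ring
  have h2 : x ^ 2 / (2 * (‖β₁ - β₂‖ * r)) ≤ |x| / 2 := by
    rw [div_le_div_iff₀ (by positivity) (by norm_num), ← sq_abs]
    nlinarith [abs_nonneg x]
  linarith

/-- If two exponentials with distinct exponents are, up to a fixed entire factor, multiples of `Φ`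
by functions of small proximity, then the logarithmic means of `Φ` grow at least linearly. -/
theorem not_smallLogMean {β₁ β₂ : ℂ} (hβ : β₁ ≠ β₂) {Φ Ψ Q₁ Q₂ : ℂ → ℂ}
    (dΦ : Differentiable ℂ Φ) (dΨ : Differentiable ℂ Ψ) (hne : ∃ b, Ψ b ≠ 0)
    (hne' : ∃ b, Φ b ≠ 0)
    (hQ₁ : SmallProximity Q₁) (hQ₂ : SmallProximity Q₂)
    (h₁ : ∀ z, Φ z ≠ 0 → Complex.exp (β₁ * z) * Ψ z = Q₁ z * Φ z)
    (h₂ : ∀ z, Φ z ≠ 0 → Complex.exp (β₂ * z) * Ψ z = Q₂ z * Φ z) : ¬ SmallLogMean Φ := by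
  intro hΦ
  obtain ⟨b, hb⟩ : ∃ b, Φ b * Ψ b ≠ 0 := by
    by_contra! h
    have := AnalyticOnNhd.eq_zero_or_eq_zero_of_mul_eq_zero (U := Set.univ)
      (fun z _ => dΦ.analyticAt z) (fun z _ => dΨ.analyticAt z) (fun z _ => h z)
      isPreconnected_univ
    obtain ⟨b, hb⟩ := hne
    obtain ⟨b', hb'⟩ := hne'
    rcases this with h | h
    · exact hb' (h b' trivial)
    · exact hb (h b trivial)
  obtain ⟨K, hK⟩ := exists_le_circleAverage_log_norm dΨ
  have hn : 0 < ‖β₁ - β₂‖ := norm_pos_iff.2 (sub_ne_zero.2 hβ)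
  set ε := ‖β₁ - β₂‖ / 16 with hε
  have hεpos : 0 < ε := by positivity
  obtain ⟨r, hr1, hr2, hr3, hr4, hr5⟩ := ((hΦ ε hεpos).and ((hQ₁.2 ε hεpos).and
    ((hQ₂.2 ε hεpos).and ((eventually_ge_atTop (1 : ℝ)).and
      (eventually_gt_atTop (-K / ε)))))).exists
  have hr : 0 < r := by linarith
  set P : ℂ → ℂ := fun z => (β₁ + β₂) * z / 2 + (‖β₁ - β₂‖ * r / 4 : ℝ) +
      ((β₁ - β₂) * z) ^ 2 / (4 * ‖β₁ - β₂‖ * r : ℝ) with hP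
  have dP : Differentiable ℂ P := by
    rw [hP]
    simp only [div_eq_mul_inv]
    fun_prop
  have iP : CircleIntegrable (fun z => (P z).re) 0 r :=
    (Complex.continuous_re.comp dP.continuous).continuousOn.circleIntegrable hr.le
  have i₁ := dΨ.circleIntegrable_log_norm 0 r
  have i₂ := dΦ.circleIntegrable_log_norm 0 r
  have i₃ := hQ₁.1.circleIntegrable_posLog_norm 0 r
  have i₄ := hQ₂.1.circleIntegrable_posLog_norm 0 r
  have key := circleAverage_mono_of_ne_zero (dΦ.mul dΨ) ⟨b, hb⟩ hr (iP.add i₁)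
    (i₂.add (i₃.add i₄)) (fun z hz hz0 => by
      simp only [Pi.mul_apply, Pi.add_apply] at hz0 ⊢
      have hz' : ‖z‖ = r := by simpa using hz
      have hΦ0 := left_ne_zero_of_mul hz0
      have hΨ0 := right_ne_zero_of_mul hz0
      have hmax := linear_bound_le_max β₁ β₂ hβ hr hz'
      have main : ∀ (β : ℂ) (Q : ℂ → ℂ), Complex.exp (β * z) * Ψ z = Q z * Φ z →
          (β * z).re + Real.log ‖Ψ z‖ ≤ Real.posLog ‖Q z‖ + Real.log ‖Φ z‖ := by
        intro β Q h
        have hQ0 : Q z ≠ 0 := by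
          intro hq
          rw [hq, zero_mul] at h
          exact mul_ne_zero (Complex.exp_ne_zero _) hΨ0 h
        have h' := congrArg (fun w => Real.log ‖w‖) h
        simp only [norm_mul] at h'
        rw [Real.log_mul (by simp) (by simpa using hΨ0),
          Real.log_mul (by simpa using hQ0) (by simpa using hΦ0), Complex.norm_exp,
          Real.log_exp] at h'
        rw [h']
        gcongr
        exact le_max_right _ _
      have m₁ := main β₁ Q₁ (h₁ z hΦ0)
      have m₂ := main β₂ Q₂ (h₂ z hΦ0)
      have p₁ := Real.posLog_nonneg (x := ‖Q₁ z‖)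
      have p₂ := Real.posLog_nonneg (x := ‖Q₂ z‖)
      rcases le_max_iff.1 hmax with h | h <;> linarith)
  rw [Real.circleAverage_add iP i₁, Real.circleAverage_add i₂ (i₃.add i₄),
    Real.circleAverage_add i₃ i₄, circleAverage_re_eq dP] at key
  have hP0 : (P 0).re = ‖β₁ - β₂‖ * r / 4 := by simp [hP]
  rw [hP0] at key
  have := hK r hr4
  rw [div_lt_iff₀ hεpos] at hr5
  have : ‖β₁ - β₂‖ = 16 * ε := by rw [hε]; ring
  rw [this] at key
  linarith

lemma posLog_inv_le {x : ℝ} (hx : 0 ≤ x) :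
    Real.posLog x⁻¹ ≤ Real.log (1 + x ^ 2) / 2 - Real.log x := by
  rcases hx.eq_or_lt with rfl | hx
  · simp
  have h1 : 0 ≤ Real.log (1 + x ^ 2) := Real.log_nonneg (by nlinarith)
  have h2 : 2 * Real.log x ≤ Real.log (1 + x ^ 2) := by
    have := Real.log_le_log (by positivity : 0 < x ^ 2) (by linarith : x ^ 2 ≤ 1 + x ^ 2)
    rw [Real.log_pow] at this
    exact_mod_cast this
  rw [Real.posLog, Real.log_inv]
  exact max_le (by linarith) (by linarith)

lemma posLog_inv_norm_sub_le {s : ℝ} (hs : 0 < s) {a z : ℂ}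
    (h : 1 + ‖z - a‖ ^ 2 ≤ ‖z - s * a‖ ^ 2 / s) :
    Real.posLog ‖z - a‖⁻¹ ≤
      Real.log ‖z - s * a‖ - Real.log ‖z - a‖ - Real.log s / 2 := by
  have h0 : 0 < 1 + ‖z - a‖ ^ 2 := by positivity
  have h1 := Real.log_le_log h0 h
  have h2 : 0 < ‖z - s * a‖ ^ 2 := by
    by_contra! h'
    have := div_nonpos_of_nonpos_of_nonneg h' hs.le
    linarith
  rw [Real.log_div h2.ne' hs.ne', Real.log_pow] at h1
  have := posLog_inv_le (norm_nonneg (z - a))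
  push_cast at h1
  linarith

lemma norm_sub_ofReal_mul_sq_div {s r : ℝ} (hs : 0 < s) {a z : ℂ} (hz : ‖z‖ = r) :
    ‖z - s * a‖ ^ 2 / s = ‖z - a‖ ^ 2 + (s - 1) * (‖a‖ ^ 2 - r ^ 2 / s) := by
  rw [← hz]
  simp only [Complex.sq_norm, Complex.normSq_apply, Complex.sub_re, Complex.sub_im,
    Complex.mul_re, Complex.mul_im, Complex.ofReal_re, Complex.ofReal_im]
  field_simp
  ring

lemma exists_scale {r : ℝ} (hr : 1 ≤ r) (a : ℂ) : ∃ s : ℝ, 0 < s ∧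
    (∀ z : ℂ, ‖z‖ = r → 1 + ‖z - a‖ ^ 2 ≤ ‖z - s * a‖ ^ 2 / s) ∧
    Real.posLog (r⁻¹ * (s * ‖a‖)) - Real.posLog (r⁻¹ * ‖a‖) - Real.log s / 2 ≤ 1 / r := by
  have hr0 : 0 < r := by linarith
  rcases le_or_gt r ‖a‖ with ha | ha
  · have ha0 : 0 < ‖a‖ := by linarith
    have hs : 0 < 1 + 2 / ‖a‖ := by positivity
    refine ⟨1 + 2 / ‖a‖, hs, fun z hz => ?_, ?_⟩
    · rw [norm_sub_ofReal_mul_sq_div hs hz]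
      have : 1 ≤ (1 + 2 / ‖a‖ - 1) * (‖a‖ ^ 2 - ‖a‖ ^ 2 / (1 + 2 / ‖a‖)) := by
        have h3 : (1 + 2 / ‖a‖ - 1) * (‖a‖ ^ 2 - ‖a‖ ^ 2 / (1 + 2 / ‖a‖))
            = 4 / (1 + 2 / ‖a‖) := by
          field_simp
          ring
        rw [h3, one_le_div hs]
        have : 2 / ‖a‖ ≤ 2 := by rw [div_le_iff₀ ha0]; linarith
        linarith
      have h4 : (1 + 2 / ‖a‖ - 1) * (‖a‖ ^ 2 - ‖a‖ ^ 2 / (1 + 2 / ‖a‖)) ≤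
          (1 + 2 / ‖a‖ - 1) * (‖a‖ ^ 2 - r ^ 2 / (1 + 2 / ‖a‖)) := by
        have : (0 : ℝ) ≤ 1 + 2 / ‖a‖ - 1 := by
          have : 0 < 2 / ‖a‖ := by positivity
          linarith
        gcongr
      linarith
    · have h1 : 1 ≤ r⁻¹ * ‖a‖ := by
        rw [← div_eq_inv_mul, one_le_div hr0]; exact ha
      have h2 : 1 ≤ 1 + 2 / ‖a‖ := by
        have : 0 < 2 / ‖a‖ := by positivity
        linarith
      have h3 : r⁻¹ * ((1 + 2 / ‖a‖) * ‖a‖) = (1 + 2 / ‖a‖) * (r⁻¹ * ‖a‖) := by ring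
      rw [h3, Real.posLog_eq_log (by rw [abs_of_pos (by positivity)]; nlinarith),
        Real.posLog_eq_log (by rwa [abs_of_pos (by positivity)]),
        Real.log_mul hs.ne' (by positivity)]
      have h4 := Real.log_le_sub_one_of_pos hs
      have h5 : 2 / ‖a‖ ≤ 2 * (1 / r) := by
        rw [div_eq_mul_one_div]; gcongr
      linarith
  · have ht : 0 < 1 + 2 / r := by positivity
    refine ⟨(1 + 2 / r)⁻¹, by positivity, fun z hz => ?_, ?_⟩
    · rw [norm_sub_ofReal_mul_sq_div (by positivity) hz]
      have hc : (1 + 2 / r)⁻¹ - 1 ≤ 0 := by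
        rw [sub_nonpos]
        exact inv_le_one_of_one_le₀ (by have : 0 < 2 / r := by positivity
                                        linarith)
      have h4 : ((1 + 2 / r)⁻¹ - 1) * (r ^ 2 - r ^ 2 / (1 + 2 / r)⁻¹) ≤
          ((1 + 2 / r)⁻¹ - 1) * (‖a‖ ^ 2 - r ^ 2 / (1 + 2 / r)⁻¹) := by
        refine mul_le_mul_of_nonpos_left ?_ hc
        gcongr
      have h3 : ((1 + 2 / r)⁻¹ - 1) * (r ^ 2 - r ^ 2 / (1 + 2 / r)⁻¹) = 4 / (1 + 2 / r) := by
        field_simp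
        ring
      have : 1 ≤ 4 / (1 + 2 / r) := by
        rw [one_le_div ht]
        have : 2 / r ≤ 2 := by rw [div_le_iff₀ hr0]; linarith
        linarith
      linarith
    · have h1 : r⁻¹ * ‖a‖ ≤ 1 := by
        rw [← div_eq_inv_mul, div_le_one hr0]; exact ha.le
      have h2 : (1 + 2 / r)⁻¹ ≤ 1 :=
        inv_le_one_of_one_le₀ (by have : 0 < 2 / r := by positivity
                                  linarith)
      have h3 : r⁻¹ * ((1 + 2 / r)⁻¹ * ‖a‖) ≤ 1 := by
        calc r⁻¹ * ((1 + 2 / r)⁻¹ * ‖a‖) = (1 + 2 / r)⁻¹ * (r⁻¹ * ‖a‖) := by ring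
          _ ≤ 1 * 1 := by gcongr
          _ = 1 := one_mul 1
      rw [(Real.posLog_eq_zero_iff _).2 (by rwa [abs_of_nonneg (by positivity)]),
        (Real.posLog_eq_zero_iff _).2 (by rwa [abs_of_nonneg (by positivity)]), Real.log_inv]
      have h4 := Real.log_le_sub_one_of_pos ht
      have h5 : 2 / r = 2 * (1 / r) := by ring
      linarith

lemma circleAverage_posLog_inv_norm_sub_le {r : ℝ} (hr : 1 ≤ r) (a : ℂ) :
    CircleIntegrable (fun z => Real.posLog ‖z - a‖⁻¹) 0 r ∧
      Real.circleAverage (fun z => Real.posLog ‖z - a‖⁻¹) 0 r ≤ 1 / r := by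
  have hr0 : 0 < r := by linarith
  have hm : Meromorphic fun z : ℂ => (z - a)⁻¹ := by
    intro z; fun_prop
  have i₀ : CircleIntegrable (fun z => Real.posLog ‖z - a‖⁻¹) 0 r := by
    simpa only [norm_inv] using hm.circleIntegrable_posLog_norm 0 r
  refine ⟨i₀, ?_⟩
  obtain ⟨s, hs, h₁, h₂⟩ := exists_scale hr a
  have i₁ : CircleIntegrable (fun z : ℂ => Real.log ‖z - s * a‖) 0 r :=
    circleIntegrable_log_norm_sub_const r
  have i₂ : CircleIntegrable (fun z : ℂ => Real.log ‖z - a‖) 0 r :=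
    circleIntegrable_log_norm_sub_const r
  have i₃ := circleIntegrable_const (Real.log s / 2) (0 : ℂ) r
  have h := Real.circleAverage_mono i₀ ((i₁.sub i₂).sub i₃) (fun z hz => by
    rw [abs_of_pos hr0, mem_sphere_zero_iff_norm] at hz
    exact posLog_inv_norm_sub_le hs (h₁ z hz))
  rw [Real.circleAverage_sub (i₁.sub i₂) i₃, Real.circleAverage_sub i₁ i₂,
    Real.circleAverage_const] at h
  have e₁ := circleAverage_log_norm_sub_const_eq_log_radius_add_posLog (c := 0) (a := s * a)
    hr0.ne'
  have e₂ := circleAverage_log_norm_sub_const_eq_log_radius_add_posLog (c := 0) (a := a) hr0.ne'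
  rw [e₁, e₂] at h
  simp only [zero_sub, norm_neg, norm_mul, Complex.norm_real, Real.norm_eq_abs, abs_of_pos hs] at h
  linarith

lemma circleAverage_sum_posLog_inv_norm_sub_le {r : ℝ} (hr : 1 ≤ r) (s : Multiset ℂ) :
    CircleIntegrable (fun z => (s.map fun a => Real.posLog ‖z - a‖⁻¹).sum) 0 r ∧
      Real.circleAverage (fun z => (s.map fun a => Real.posLog ‖z - a‖⁻¹).sum) 0 r
        ≤ s.card * (1 / r) := by
  induction s using Multiset.induction with
  | empty => simp [Real.circleAverage_const]
  | cons a s ih =>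
    obtain ⟨i, h⟩ := ih
    obtain ⟨j, h'⟩ := circleAverage_posLog_inv_norm_sub_le hr a
    simp only [Multiset.map_cons, Multiset.sum_cons, Multiset.card_cons]
    refine ⟨j.add i, ?_⟩
    have := Real.circleAverage_add j i
    simp only [Pi.add_def] at this
    rw [this]
    push_cast
    linarith

lemma sum_le_card_mul_exp_sum_posLog (s : Multiset ℂ) (x : ℂ → ℝ) :
    (s.map x).sum ≤ s.card * Real.exp (s.map fun a => Real.posLog (x a)).sum ∧
      0 ≤ (s.map fun a => Real.posLog (x a)).sum := by
  induction s using Multiset.induction with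
  | empty => simp
  | cons a s ih =>
    simp only [Multiset.map_cons, Multiset.sum_cons, Multiset.card_cons]
    have h0 := Real.posLog_nonneg (x := x a)
    refine ⟨?_, add_nonneg h0 ih.2⟩
    have h1 : x a ≤ Real.exp (Real.posLog (x a)) := by
      rcases le_or_gt (x a) 0 with h | h
      · exact h.trans (Real.exp_pos _).le
      · calc x a = Real.exp (Real.log (x a)) := (Real.exp_log h).symm
          _ ≤ _ := Real.exp_le_exp.2 (le_max_right _ _)
    have h2 : Real.exp (Real.posLog (x a)) ≤
        Real.exp (Real.posLog (x a) + (s.map fun a => Real.posLog (x a)).sum) :=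
      Real.exp_le_exp.2 (by linarith [ih.2])
    have h3 : (s.card : ℝ) * Real.exp (s.map fun a => Real.posLog (x a)).sum ≤
        s.card * Real.exp (Real.posLog (x a) + (s.map fun a => Real.posLog (x a)).sum) := by
      gcongr; linarith
    push_cast
    linarith [ih.1]

lemma logDeriv_prod_mul (s : Multiset ℂ) {G : ℂ → ℂ} (hG : Differentiable ℂ G) {z : ℂ}
    (hz : (s.map fun a => z - a).prod * G z ≠ 0) :
    logDeriv (fun z => (s.map fun a => z - a).prod * G z) z =
      (s.map fun a => (z - a)⁻¹).sum + logDeriv G z := by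
  induction s using Multiset.induction generalizing G with
  | empty => simp
  | cons a s ih =>
    simp only [Multiset.map_cons, Multiset.prod_cons, Multiset.sum_cons] at hz ⊢
    have h1 : ∀ z, (z - a) * (s.map fun a => z - a).prod * G z =
        (s.map fun a => z - a).prod * ((z - a) * G z) := fun z => by ring
    simp only [h1] at hz ⊢
    have hza : z - a ≠ 0 := left_ne_zero_of_mul (right_ne_zero_of_mul hz)
    have hGz : G z ≠ 0 := right_ne_zero_of_mul (right_ne_zero_of_mul hz)
    rw [ih (G := fun z => (z - a) * G z) (by fun_prop) hz,
      logDeriv_mul (f := fun z => z - a) z hza hGz (by fun_prop) (hG z)]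
    have : logDeriv (fun z => z - a) z = (z - a)⁻¹ := by
      rw [logDeriv_apply, deriv_sub_const_fun, deriv_id'', one_div]
    rw [this]
    ring

lemma FactorsOn.posLog_logDeriv_le {F G : ℂ → ℂ} {C R : ℝ} {s : Multiset ℂ} (hC : 0 ≤ C)
    (h : FactorsOn F C R s G) {z : ℂ} (hz : z ∈ closedBall 0 R) (hF : F z ≠ 0) :
    Real.posLog ‖deriv F z / F z‖ ≤
      Real.log (1 + C + C * R) + (s.map fun a => Real.posLog ‖z - a‖⁻¹).sum := by
  have hFe : F = fun z => (s.map fun a => z - a).prod * G z := funext h.eq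
  have hF' : (s.map fun a => z - a).prod * G z ≠ 0 := by rwa [← h.eq]
  have e : deriv F z / F z = (s.map fun a => (z - a)⁻¹).sum + deriv G z / G z := by
    rw [← logDeriv_apply, hFe, logDeriv_prod_mul s h.diff hF', logDeriv_apply]
  have hGz : 0 < ‖G z‖ := norm_pos_iff.2 (right_ne_zero_of_mul hF')
  have h1 : ‖deriv G z / G z‖ ≤ C := by
    rw [norm_div, div_le_iff₀ hGz]
    exact h.deriv_le z hz
  have h2 : ‖(s.map fun a => (z - a)⁻¹).sum‖ ≤ (s.map fun a => ‖z - a‖⁻¹).sum := by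
    refine (norm_multiset_sum_le _).trans ?_
    simp
  obtain ⟨h3, h4⟩ := sum_le_card_mul_exp_sum_posLog s fun a => ‖z - a‖⁻¹
  set S := (s.map fun a => Real.posLog ‖z - a‖⁻¹).sum
  have h5 : 1 ≤ Real.exp S := Real.one_le_exp h4
  have hcard := h.card_le
  have hCR : 0 ≤ C * R := le_trans (by positivity) hcard
  have h6 : ‖deriv F z / F z‖ ≤ (1 + C + C * R) * Real.exp S := by
    rw [e]
    refine (norm_add_le _ _).trans ?_
    nlinarith
  refine (Real.posLog_le_posLog (norm_nonneg _) h6).trans ?_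
  rw [Real.posLog_eq_log (by rw [abs_of_pos (by positivity)]; nlinarith),
    Real.log_mul (by positivity) (by positivity), Real.log_exp]

lemma Differentiable.meromorphic_complex {F : ℂ → ℂ} (hF : Differentiable ℂ F) : Meromorphic F :=
  fun z => (hF.analyticAt z).meromorphicAt

namespace ExpType

variable {F F₁ F₂ : ℂ → ℂ}

/-- The lemma on the logarithmic derivative, for entire functions of exponential type. -/
theorem smallProximity_deriv_div (hF : ExpType F) (hne : ∃ b, F b ≠ 0) :
    SmallProximity fun z => deriv F z / F z := by
  have hm : Meromorphic fun z => deriv F z / F z :=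
    hF.1.deriv.meromorphic_complex.div hF.1.meromorphic_complex
  obtain ⟨C, hC, h⟩ := hF.exists_factorsOn hne
  refine ⟨hm, fun ε hε => ?_⟩
  filter_upwards [eventually_ge_atTop (1 : ℝ), eventually_ge_atTop (C / (ε / 2)),
    Real.isLittleO_log_id_atTop.bound (by positivity : 0 < ε / 4),
    eventually_ge_atTop (Real.log (1 + 2 * C) / (ε / 4))] with r hr hr₁ hlog hr₂
  have hr0 : 0 < r := by linarith
  obtain ⟨s, G, hs⟩ := h r hr
  obtain ⟨i, hi⟩ := circleAverage_sum_posLog_inv_norm_sub_le hr s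
  have i₀ := circleIntegrable_const (Real.log (1 + C + C * r)) (0 : ℂ) r
  have key := circleAverage_mono_of_ne_zero hF.1 hne hr0 (hm.circleIntegrable_posLog_norm 0 r)
    (i₀.add i) fun z hz hz0 => hs.posLog_logDeriv_le hC (sphere_subset_closedBall hz) hz0
  rw [Real.circleAverage_add i₀ i, Real.circleAverage_const] at key
  have hcard : s.card * (1 / r) ≤ C := by
    rw [mul_one_div, div_le_iff₀ hr0]
    exact hs.card_le
  have hlog' : Real.log (1 + C + C * r) ≤ Real.log (1 + 2 * C) + Real.log r := by
    rw [← Real.log_mul (by positivity) hr0.ne']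
    exact Real.log_le_log (by positivity) (by nlinarith)
  rw [id, Real.norm_eq_abs, Real.norm_eq_abs, abs_of_pos hr0] at hlog
  have := (le_abs_self _).trans hlog
  rw [div_le_iff₀ (by positivity)] at hr₁ hr₂
  linarith

lemma deriv (hF : ExpType F) : ExpType (deriv F) := by
  obtain ⟨d, B, hB, h⟩ := hF
  refine ⟨d.deriv, 2 * B, by positivity, fun z => ?_⟩
  have := Complex.norm_deriv_le_of_forall_mem_sphere_norm_le (c := z) (f := F) one_pos
    d.diffContOnCl (C := Real.exp (2 * B * (‖z‖ + 1))) fun w hw => ?_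
  · simpa using this
  · refine (h w).trans (Real.exp_le_exp.2 ?_)
    have h1 : ‖w‖ ≤ ‖z‖ + 1 := by
      have := norm_le_norm_add_norm_sub' w z
      rw [mem_sphere_iff_norm.1 hw] at this
      exact this
    nlinarith [norm_nonneg z]

lemma iteratedDeriv (hF : ExpType F) (j : ℕ) : ExpType (iteratedDeriv j F) := by
  induction j with
  | zero => rwa [iteratedDeriv_zero]
  | succ j ih => rw [iteratedDeriv_succ]; exact ih.deriv

lemma mul (h₁ : ExpType F₁) (h₂ : ExpType F₂) : ExpType fun z => F₁ z * F₂ z := by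
  obtain ⟨d₁, B₁, hB₁, h₁⟩ := h₁
  obtain ⟨d₂, B₂, hB₂, h₂⟩ := h₂
  refine ⟨d₁.mul d₂, B₁ + B₂, by positivity, fun z => ?_⟩
  rw [norm_mul, add_mul, Real.exp_add]
  exact mul_le_mul (h₁ z) (h₂ z) (norm_nonneg _) (Real.exp_pos _).le

lemma add (h₁ : ExpType F₁) (h₂ : ExpType F₂) : ExpType fun z => F₁ z + F₂ z := by
  obtain ⟨d₁, B₁, hB₁, h₁⟩ := h₁
  obtain ⟨d₂, B₂, hB₂, h₂⟩ := h₂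
  refine ⟨d₁.add d₂, B₁ + B₂ + 1, by positivity, fun z => ?_⟩
  have hz := norm_nonneg z
  have e₁ : Real.exp (B₁ * (‖z‖ + 1)) ≤ Real.exp ((B₁ + B₂) * (‖z‖ + 1)) := by
    gcongr; linarith
  have e₂ : Real.exp (B₂ * (‖z‖ + 1)) ≤ Real.exp ((B₁ + B₂) * (‖z‖ + 1)) := by
    gcongr; linarith
  have e₃ : 2 ≤ Real.exp (‖z‖ + 1) := by
    have := Real.add_one_le_exp (‖z‖ + 1)
    linarith
  rw [add_mul _ (1 : ℝ), one_mul, Real.exp_add]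
  have := norm_add_le (F₁ z) (F₂ z)
  nlinarith [h₁ z, h₂ z, Real.exp_pos ((B₁ + B₂) * (‖z‖ + 1))]

lemma const (a : ℂ) : ExpType fun _ => a := by
  refine ⟨differentiable_const a, ‖a‖, norm_nonneg a, fun z => ?_⟩
  have := Real.add_one_le_exp (‖a‖ * (‖z‖ + 1))
  nlinarith [norm_nonneg a, norm_nonneg z, mul_nonneg (norm_nonneg a) (norm_nonneg z)]

lemma smallProximity_iteratedDeriv_div (hF : ExpType F) (hne : ∃ b, F b ≠ 0) (j : ℕ) :
    SmallProximity fun z => _root_.iteratedDeriv j F z / F z := by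
  induction j with
  | zero =>
    refine (SmallProximity.const 1).of_norm_le ?_ hF.1 hne fun z hz => ?_
    · simp only [iteratedDeriv_zero]
      exact hF.1.meromorphic_complex.div hF.1.meromorphic_complex
    · simp [iteratedDeriv_zero, hz]
  | succ j ih =>
    by_cases h0 : ∃ b, _root_.iteratedDeriv j F b ≠ 0
    · refine ((hF.iteratedDeriv j).smallProximity_deriv_div h0 |>.mul ih).of_norm_le
        ((hF.iteratedDeriv (j + 1)).1.meromorphic_complex.div hF.1.meromorphic_complex)
        (hF.iteratedDeriv j).1 h0 fun z hz => ?_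
      rw [iteratedDeriv_succ, div_mul_div_cancel₀ hz]
    · push Not at h0
      have : _root_.iteratedDeriv (j + 1) F = fun _ => 0 := by
        rw [iteratedDeriv_succ, show _root_.iteratedDeriv j F = fun _ => 0 from funext h0]
        simp
      simp only [this, zero_div]
      exact SmallProximity.const 0

end ExpType

lemma posLog_add_le_add {x y : ℝ} (hx : 0 ≤ x) (hy : 0 ≤ y) :
    Real.posLog (x + y) ≤ Real.posLog x + y := by
  rw [Real.posLog_eq_log_max_one hx, Real.posLog_eq_log_max_one (by positivity)]
  have h1 : 1 ≤ max 1 x := le_max_left _ _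
  have h2 : max 1 (x + y) ≤ max 1 x * Real.exp y := by
    have h3 := Real.add_one_le_exp y
    have h4 : x ≤ max 1 x := le_max_right _ _
    refine max_le ?_ ?_ <;> nlinarith
  have := Real.log_le_log (by positivity) h2
  rwa [Real.log_mul (by positivity) (by positivity), Real.log_exp] at this

lemma norm_le_mul_exp_of_deriv_le {G : ℂ → ℂ} (hG : Differentiable ℂ G) {C R : ℝ}
    (h : ∀ z ∈ closedBall 0 R, ‖deriv G z‖ ≤ C * ‖G z‖) {c : ℂ} (hc : ‖c‖ ≤ R) :
    ‖G c‖ ≤ ‖G 0‖ * Real.exp (C * ‖c‖) := by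
  have hd : ∀ t : ℝ, HasDerivAt (fun t : ℝ => G (t * c)) (deriv G (t * c) * c) t := fun t => by
    have h1 : HasDerivAt (fun t : ℝ => (t : ℂ) * c) c t := by
      simpa using (Complex.ofRealCLM.hasDerivAt (x := t)).mul_const c
    exact (hG (t * c)).hasDerivAt.comp t h1
  have key := norm_le_gronwallBound_of_norm_deriv_right_le (f := fun t : ℝ => G (t * c))
    (f' := fun t : ℝ => deriv G (t * c) * c) (δ := ‖G 0‖) (K := C * ‖c‖) (ε := 0) (a := 0) (b := 1)
    (fun t _ => (hd t).continuousAt.continuousWithinAt) (fun t _ => (hd t).hasDerivWithinAt)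
    (by simp) (fun t ht => by
      rw [norm_mul, add_zero]
      have := h (t * c) (by
        rw [mem_closedBall_zero_iff, norm_mul, Complex.norm_real, Real.norm_eq_abs,
          abs_of_nonneg ht.1]
        nlinarith [ht.1, ht.2, norm_nonneg c])
      nlinarith [norm_nonneg c]) 1 (by simp)
  simpa [gronwallBound_ε0] using key

lemma circleAverage_log_norm_prod_mul (s : Multiset ℂ) {G : ℂ → ℂ} (hG : Differentiable ℂ G)
    {c : ℂ} {r : ℝ} (hr : 0 < r) (h0 : ∀ z ∈ closedBall c r, G z ≠ 0) :
    Real.circleAverage (fun z => Real.log ‖(s.map fun a => z - a).prod * G z‖) c r =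
      (s.map fun a => Real.log r + Real.posLog (r⁻¹ * ‖c - a‖)).sum + Real.log ‖G c‖ := by
  induction s using Multiset.induction with
  | empty =>
    simp only [Multiset.map_zero, Multiset.prod_zero, one_mul, Multiset.sum_zero, zero_add]
    refine AnalyticOnNhd.circleAverage_log_norm_of_ne_zero (fun z _ => hG.analyticAt z) ?_
    rwa [abs_of_pos hr]
  | cons a s ih =>
    have hdP : Differentiable ℂ fun z : ℂ => (s.map fun a => z - a).prod * G z := by
      refine Differentiable.mul ?_ hG
      clear ih
      induction s using Multiset.induction with
      | empty => simp
      | cons b s ih =>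
        simp only [Multiset.map_cons, Multiset.prod_cons]
        exact (differentiable_id.sub_const b).mul ih
    have i₁ : CircleIntegrable (fun z : ℂ => Real.log ‖z - a‖) c r :=
      circleIntegrable_log_norm_sub_const r
    have i₂ := hdP.circleIntegrable_log_norm c r
    have hdQ : Differentiable ℂ fun z => (z - a) * ((s.map fun a => z - a).prod * G z) :=
      (differentiable_id.sub_const a).mul hdP
    obtain ⟨b, hb, hb'⟩ : ∃ b ∈ closedBall c r, b ∉ (a ::ₘ s).toFinset :=
      (infinite_of_mem_nhds c (closedBall_mem_nhds c hr)).exists_notMem_finset _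
    have hne : ∃ b, (fun z => (z - a) * ((s.map fun a => z - a).prod * G z)) b ≠ 0 := by
      refine ⟨b, ?_⟩
      rw [Multiset.mem_toFinset, Multiset.mem_cons, not_or] at hb'
      refine mul_ne_zero (sub_ne_zero.2 hb'.1) (mul_ne_zero ?_ (h0 b hb))
      rw [Ne, Multiset.prod_eq_zero_iff, Multiset.mem_map]
      rintro ⟨x, hx, hx'⟩
      exact hb'.2 (sub_eq_zero.1 hx' ▸ hx)
    have e : ∀ z, (fun z => (z - a) * ((s.map fun a => z - a).prod * G z)) z ≠ 0 →
        Real.log ‖((a ::ₘ s).map fun a => z - a).prod * G z‖ =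
          Real.log ‖z - a‖ + Real.log ‖(s.map fun a => z - a).prod * G z‖ := fun z hz => by
      rw [Multiset.map_cons, Multiset.prod_cons, mul_assoc, norm_mul,
        Real.log_mul (norm_ne_zero_iff.2 (left_ne_zero_of_mul hz))
          (norm_ne_zero_iff.2 (right_ne_zero_of_mul hz))]
    have i₀ : CircleIntegrable
        (fun z => Real.log ‖((a ::ₘ s).map fun a => z - a).prod * G z‖) c r := by
      simpa only [Multiset.map_cons, Multiset.prod_cons, mul_assoc] using
        hdQ.circleIntegrable_log_norm c r
    rw [le_antisymm
      (circleAverage_mono_of_ne_zero hdQ hne hr i₀ (i₁.add i₂) fun z _ hz => (e z hz).le)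
      (circleAverage_mono_of_ne_zero hdQ hne hr (i₁.add i₂) i₀ fun z _ hz => (e z hz).ge),
      Real.circleAverage_add i₁ i₂, ih,
      circleAverage_log_norm_sub_const_eq_log_radius_add_posLog hr.ne', Multiset.map_cons,
      Multiset.sum_cons]
    ring

lemma FactorsOn.circleAverage_log_norm_le {F G : ℂ → ℂ} {C r : ℝ} {s : Multiset ℂ}
    (h : FactorsOn F C r s G) (hr : 1 ≤ r) {c : ℂ} (hc : ‖c‖ ≤ r) :
    Real.circleAverage (fun z => Real.log ‖F z‖) c r ≤
      Real.circleAverage (fun z => Real.log ‖F z‖) 0 r + 2 * C * ‖c‖ := by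
  have hr0 : 0 < r := by linarith
  have e : ∀ z, Real.log ‖F z‖ = Real.log ‖(s.map fun a => z - a).prod * G z‖ := fun z => by
    rw [h.eq]
  simp only [e]
  rw [circleAverage_log_norm_prod_mul s h.diff hr0 fun z hz => h.ne_zero z ?_,
    circleAverage_log_norm_prod_mul s h.diff hr0 fun z hz =>
      h.ne_zero z (closedBall_subset_closedBall (by linarith) hz)]
  swap
  · rw [mem_closedBall_zero_iff]
    have := norm_le_norm_add_norm_sub' z c
    rw [mem_closedBall_iff_norm] at hz
    linarith
  have h0 : G 0 ≠ 0 := h.ne_zero 0 (by simp; linarith)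
  have hc0 : G c ≠ 0 := h.ne_zero c (by simp; linarith)
  have hG : Real.log ‖G c‖ ≤ Real.log ‖G 0‖ + C * ‖c‖ := by
    have := Real.log_le_log (norm_pos_iff.2 hc0) (norm_le_mul_exp_of_deriv_le h.diff h.deriv_le hc)
    rwa [Real.log_mul (norm_ne_zero_iff.2 h0) (Real.exp_pos _).ne', Real.log_exp] at this
  have hS : (s.map fun a => Real.log r + Real.posLog (r⁻¹ * ‖c - a‖)).sum ≤
      (s.map fun a => Real.log r + Real.posLog (r⁻¹ * ‖0 - a‖)).sum + s.card * (r⁻¹ * ‖c‖) := by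
    clear e h hG hc0 h0
    induction s using Multiset.induction with
    | empty => simp
    | cons a s ih =>
      simp only [Multiset.map_cons, Multiset.sum_cons, Multiset.card_cons]
      have h1 : r⁻¹ * ‖c - a‖ ≤ r⁻¹ * ‖0 - a‖ + r⁻¹ * ‖c‖ := by
        rw [← mul_add]
        gcongr
        rw [zero_sub, norm_neg, add_comm]
        exact norm_sub_le c a
      have h2 := Real.posLog_le_posLog (by positivity) h1
      have h3 := posLog_add_le_add (x := r⁻¹ * ‖0 - a‖) (y := r⁻¹ * ‖c‖) (by positivity)
        (by positivity)
      push_cast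
      linarith
  have hcard : s.card * (r⁻¹ * ‖c‖) ≤ C * ‖c‖ := by
    rw [← mul_assoc, ← div_eq_mul_inv]
    gcongr
    rw [div_le_iff₀ hr0]
    exact h.card_le
  linarith

lemma SmallLogMean.comp_add {F : ℂ → ℂ} (hF : ExpType F) (hne : ∃ b, F b ≠ 0)
    (h : SmallLogMean F) (c : ℂ) : SmallLogMean fun z => F (z + c) := by
  obtain ⟨C, hC, hfac⟩ := hF.exists_factorsOn hne
  intro ε hε
  filter_upwards [h (ε / 2) (by positivity), eventually_ge_atTop (1 : ℝ),
    eventually_ge_atTop ‖c‖, eventually_ge_atTop (2 * C * ‖c‖ / (ε / 2))] with r h₁ h₂ h₃ h₄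
  obtain ⟨s, G, hs⟩ := hfac r h₂
  have key := hs.circleAverage_log_norm_le h₂ h₃
  have e : Real.circleAverage (fun z => Real.log ‖F (z + c)‖) 0 r =
      Real.circleAverage (fun z => Real.log ‖F z‖) c r := by
    have := Real.circleAverage_map_add_const (f := fun z => Real.log ‖F z‖) (c := c) (R := r)
    exact this
  rw [e]
  rw [div_le_iff₀ (by positivity)] at h₄
  linarith

lemma exists_factor {F : ℂ → ℂ} (hF : Differentiable ℂ F) (hne : ∃ b, F b ≠ 0) {R : ℝ}
    (hR : 0 < R) : ∃ (s : Multiset ℂ) (G : ℂ → ℂ), Differentiable ℂ G ∧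
      (∀ z, F z = (s.map fun a => z - a).prod * G z) ∧ ∀ z ∈ closedBall (0 : ℂ) R, G z ≠ 0 := by
  obtain ⟨b, hb⟩ := hne
  have hb0 : 0 < ‖F b‖ := norm_pos_iff.2 hb
  set L := ‖b‖ + R with hL
  have hL0 : 0 < L := by positivity
  obtain ⟨M, hM⟩ := (isCompact_closedBall (0 : ℂ) (2 * L + R)).exists_bound_of_continuousOn
    hF.continuous.continuousOn
  let P : ℕ → Prop := fun n => ∃ (s : Multiset ℂ) (G : ℂ → ℂ), s.card = n ∧
    (∀ a ∈ s, ‖a‖ ≤ R) ∧ Differentiable ℂ G ∧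
    ∀ z, F z = (s.map (fun a => z - a)).prod * G z
  have hP0 : P 0 := ⟨0, F, rfl, by simp, hF, by simp⟩
  have hPb : ∀ n, P n → n ≤ ⌊M / ‖F b‖⌋₊ := by
    rintro n ⟨s, G, rfl, hs, hG, hFG⟩
    have h1 : ‖G b‖ ≤ M / (2 * L) ^ s.card := by
      refine Complex.norm_le_of_forall_mem_frontier_norm_le (U := ball 0 (2 * L + R))
        isBounded_ball hG.diffContOnCl (fun w hw => ?_) ?_
      · rw [frontier_ball _ (by positivity)] at hw
        rw [le_div_iff₀ (by positivity)]
        have h2 := hM w (sphere_subset_closedBall hw)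
        rw [mem_sphere_zero_iff_norm] at hw
        rw [hFG, norm_mul, mul_comm] at h2
        refine le_trans ?_ h2
        gcongr
        refine pow_card_le_norm_prod s (by positivity) w fun a ha => ?_
        have := norm_sub_norm_le w a
        have := hs a ha
        linarith
      · rw [closure_ball _ (by positivity), mem_closedBall_zero_iff]
        linarith [norm_nonneg b]
    have h2 : ‖F b‖ ≤ L ^ s.card * (M / (2 * L) ^ s.card) := by
      rw [hFG, norm_mul]
      refine mul_le_mul (norm_prod_le_pow_card s hL0.le b fun a ha => ?_) h1 (norm_nonneg _)
        (by positivity)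
      have := norm_sub_le b a
      have := hs a ha
      linarith
    have h3 : L ^ s.card * (M / (2 * L) ^ s.card) = M / 2 ^ s.card := by
      rw [mul_pow]
      field_simp
    rw [h3, le_div_iff₀ (by positivity), mul_comm, ← le_div_iff₀ hb0] at h2
    refine Nat.le_floor (le_trans ?_ h2)
    exact_mod_cast Nat.lt_two_pow_self.le
  classical
  have hmax := Nat.findGreatest_spec (P := P) (Nat.zero_le ⌊M / ‖F b‖⌋₊) hP0
  obtain ⟨s, G, hsc, hs, hG, hFG⟩ := hmax
  refine ⟨s, G, hG, hFG, fun z hz hGz => ?_⟩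
  obtain ⟨H, hH, hGH⟩ := exists_eq_sub_mul_of_eq_zero hG hGz
  have hP : P (s.card + 1) := by
    refine ⟨z ::ₘ s, H, by simp, ?_, hH, fun w => ?_⟩
    · intro a ha
      rcases Multiset.mem_cons.1 ha with rfl | ha
      · simpa using hz
      · exact hs a ha
    · rw [hFG, hGH]; simp; ring
  have := Nat.le_findGreatest (hPb _ hP) hP
  omega

lemma exists_reflected_factor {R : ℝ} (hR : 0 < R) {a : ℂ} (ha : ‖a‖ ≠ R) :
    ∃ p : ℂ → ℂ, Differentiable ℂ p ∧ (∀ z ∈ closedBall (0 : ℂ) R, p z ≠ 0 ∧ ‖z - a‖ ≤ ‖p z‖) ∧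
      ∀ z ∈ sphere (0 : ℂ) R, ‖p z‖ = ‖z - a‖ := by
  rcases lt_or_gt_of_ne ha with ha | ha
  · have key : ∀ z : ℂ, ‖(R ^ 2 - starRingEnd ℂ a * z) / R‖ ^ 2 =
        ‖z - a‖ ^ 2 + (R ^ 2 - ‖z‖ ^ 2) * (R ^ 2 - ‖a‖ ^ 2) / R ^ 2 := fun z => by
      rw [norm_div, div_pow, Complex.norm_real, Real.norm_eq_abs, sq_abs, ← Complex.ofReal_pow]
      simp only [Complex.sq_norm, Complex.normSq_apply, Complex.sub_re, Complex.sub_im,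
        Complex.mul_re, Complex.mul_im, Complex.ofReal_re, Complex.ofReal_im, Complex.conj_re,
        Complex.conj_im]
      field_simp
      ring
    have hRa : 0 < R ^ 2 - ‖a‖ ^ 2 := by nlinarith [norm_nonneg a]
    refine ⟨fun z => (R ^ 2 - starRingEnd ℂ a * z) / R, by fun_prop, fun z hz => ⟨?_, ?_⟩,
      fun z hz => ?_⟩
    · rw [mem_closedBall_zero_iff] at hz
      refine div_ne_zero (fun h => ?_) (by exact_mod_cast hR.ne')
      have h1 := congrArg norm (sub_eq_zero.1 h)
      rw [norm_pow, Complex.norm_real, Real.norm_eq_abs, abs_of_pos hR, norm_mul,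
        RCLike.norm_conj] at h1
      nlinarith [norm_nonneg a, norm_nonneg z]
    · rw [mem_closedBall_zero_iff] at hz
      refine le_of_sq_le_sq ?_ (norm_nonneg _)
      rw [key]
      have : 0 ≤ R ^ 2 - ‖z‖ ^ 2 := by nlinarith [norm_nonneg z]
      have : 0 ≤ (R ^ 2 - ‖z‖ ^ 2) * (R ^ 2 - ‖a‖ ^ 2) / R ^ 2 := by positivity
      linarith
    · rw [mem_sphere_zero_iff_norm] at hz
      rw [← sq_eq_sq₀ (norm_nonneg _) (norm_nonneg _), key, hz]
      simp
  · refine ⟨fun z => z - a, by fun_prop, fun z hz => ⟨?_, le_rfl⟩, fun z _ => rfl⟩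
    rw [mem_closedBall_zero_iff] at hz
    refine sub_ne_zero.2 fun h => ?_
    rw [h] at hz
    linarith

lemma exists_reflected_prod {R : ℝ} (hR : 0 < R) (s : Multiset ℂ) (hs : ∀ a ∈ s, ‖a‖ ≠ R) :
    ∃ p : ℂ → ℂ, Differentiable ℂ p ∧
      (∀ z ∈ closedBall (0 : ℂ) R, p z ≠ 0 ∧ ‖(s.map fun a => z - a).prod‖ ≤ ‖p z‖) ∧
      ∀ z ∈ sphere (0 : ℂ) R, ‖p z‖ = ‖(s.map fun a => z - a).prod‖ := by
  induction s using Multiset.induction with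
  | empty => exact ⟨fun _ => 1, by fun_prop, by simp, by simp⟩
  | cons a s ih =>
    obtain ⟨p, hp, h₁, h₂⟩ := ih fun b hb => hs b (Multiset.mem_cons_of_mem hb)
    obtain ⟨q, hq, h₃, h₄⟩ := exists_reflected_factor hR (hs a (Multiset.mem_cons_self a s))
    refine ⟨fun z => q z * p z, hq.mul hp, fun z hz => ⟨?_, ?_⟩, fun z hz => ?_⟩
    · exact mul_ne_zero (h₃ z hz).1 (h₁ z hz).1
    · rw [Multiset.map_cons, Multiset.prod_cons, norm_mul, norm_mul]
      exact mul_le_mul (h₃ z hz).2 (h₁ z hz).2 (norm_nonneg _) (norm_nonneg _)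
    · rw [Multiset.map_cons, Multiset.prod_cons, norm_mul, norm_mul, h₂ z hz, h₄ z hz]

lemma posLog_norm_le_circleAverage_of_ne_zero {H : ℂ → ℂ} (hH : Differentiable ℂ H) {r R : ℝ}
    (hr : 0 < r) (hR : 2 * r < R) (h0 : ∀ z ∈ closedBall (0 : ℂ) R, H z ≠ 0) {w : ℂ}
    (hw : ‖w‖ ≤ r) :
    Real.log ‖H w‖ ≤ 3 * Real.circleAverage (fun z => Real.posLog ‖H z‖) 0 R := by
  have hR0 : 0 < R := by linarith
  have hwR : w ∈ ball (0 : ℂ) R := by rw [mem_ball_zero_iff]; linarith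
  have hharm : InnerProductSpace.HarmonicOnNhd (fun z => Real.log ‖H z‖) (closedBall 0 R) :=
    fun z hz => (hH.analyticAt z).harmonicAt_log_norm (h0 z hz)
  have hP := InnerProductSpace.HarmonicOnNhd.circleAverage_re_herglotzRieszKernel_smul hharm hwR
  have hK : ContinuousOn (herglotzRieszKernel 0 w) (sphere 0 |R|) :=
    continuousOn_herglotzRieszKernel_sphere hwR
  rw [abs_of_pos hR0] at hK
  have hlog : ContinuousOn (fun z => Real.log ‖H z‖) (sphere 0 R) := by
    refine ContinuousOn.log hH.continuous.norm.continuousOn fun z hz => ?_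
    exact norm_ne_zero_iff.2 (h0 z (sphere_subset_closedBall hz))
  have i₁ : CircleIntegrable ((Complex.re ∘ herglotzRieszKernel 0 w) •
      fun z => Real.log ‖H z‖) 0 R :=
    ((Complex.continuous_re.comp_continuousOn hK).smul hlog).circleIntegrable hR0.le
  have i₂ := (hH.meromorphic_complex.circleIntegrable_posLog_norm 0 R).const_smul (a := (3 : ℝ))
  rw [← hP, ← smul_eq_mul, ← Real.circleAverage_smul]
  refine Real.circleAverage_mono i₁ i₂ fun z hz => ?_
  rw [abs_of_pos hR0] at hz
  have k₁ := re_herglotzRieszKernel_le hz hwR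
  have k₂ := le_re_herglotzRieszKernel hz hwR
  simp only [Pi.smul_apply', Function.comp_apply, herglotzRieszKernel_def, smul_eq_mul,
    Pi.smul_apply]
  simp only [sub_zero] at k₁ k₂ ⊢
  have k₃ : (R + ‖w‖) / (R - ‖w‖) ≤ 3 := by
    rw [div_le_iff₀ (by linarith)]
    linarith
  have k₄ : 0 ≤ (R - ‖w‖) / (R + ‖w‖) := div_nonneg (by linarith) (by positivity)
  have l₁ : Real.log ‖H z‖ ≤ Real.posLog ‖H z‖ := le_max_right _ _
  have l₂ := Real.posLog_nonneg (x := ‖H z‖)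
  calc _ ≤ ((z + w) / (z - w)).re * Real.posLog ‖H z‖ := by
        apply mul_le_mul_of_nonneg_left l₁ (k₄.trans k₂)
    _ ≤ _ := by
        apply mul_le_mul_of_nonneg_right (k₁.trans k₃) l₂

/-- The maximum modulus of an entire function is controlled by its proximity function. -/
theorem exists_posLog_norm_le_circleAverage {F : ℂ → ℂ} (hF : Differentiable ℂ F) {r : ℝ}
    (hr : 0 < r) : ∃ R ∈ Set.Ioo (2 * r) (3 * r), ∀ w, ‖w‖ ≤ r →
      Real.posLog ‖F w‖ ≤ 3 * Real.circleAverage (fun z => Real.posLog ‖F z‖) 0 R := by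
  by_cases hne : ∃ b, F b ≠ 0
  · obtain ⟨s, G, hG, hFG, hG0⟩ := exists_factor hF hne (by positivity : 0 < 3 * r)
    obtain ⟨R, hR, hRs⟩ : ∃ R ∈ Set.Ioo (2 * r) (3 * r), R ∉ (s.map norm).toFinset :=
      (Set.Ioo_infinite (by linarith)).exists_notMem_finset _
    have hR0 : 0 < R := by linarith [hR.1]
    obtain ⟨p, hp, h₁, h₂⟩ := exists_reflected_prod hR0 s fun a ha h => by
      rw [Multiset.mem_toFinset, Multiset.mem_map] at hRs
      exact hRs ⟨a, ha, h⟩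
    refine ⟨R, hR, fun w hw => ?_⟩
    have hav : Real.circleAverage (fun z => Real.posLog ‖p z * G z‖) 0 R =
        Real.circleAverage (fun z => Real.posLog ‖F z‖) 0 R := by
      refine Real.circleAverage_congr_sphere fun z hz => ?_
      rw [abs_of_pos hR0] at hz
      simp only [norm_mul, h₂ z hz, hFG z]
    have hwR : w ∈ closedBall (0 : ℂ) R := by
      rw [mem_closedBall_zero_iff]; linarith [hR.1]
    have h0 : ∀ z ∈ closedBall (0 : ℂ) R, p z * G z ≠ 0 := fun z hz =>
      mul_ne_zero (h₁ z hz).1 (hG0 z (closedBall_subset_closedBall hR.2.le hz))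
    have key := posLog_norm_le_circleAverage_of_ne_zero (hp.mul hG) hr hR.1 h0 hw
    simp only [Pi.mul_apply, hav] at key
    have hnn : 0 ≤ Real.circleAverage (fun z => Real.posLog ‖F z‖) 0 R :=
      Real.circleAverage_nonneg_of_nonneg fun z _ => Real.posLog_nonneg
    refine max_le (by positivity) ?_
    rcases eq_or_ne (F w) 0 with h | h
    · rw [h, norm_zero, Real.log_zero]; positivity
    · refine le_trans (Real.log_le_log (norm_pos_iff.2 h) ?_) key
      rw [hFG, norm_mul, norm_mul]
      gcongr
      exact (h₁ w hwR).2
  · push Not at hne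
    refine ⟨5 / 2 * r, ⟨by linarith, by linarith⟩, fun w _ => ?_⟩
    simp [hne, Real.circleAverage_const]

lemma nevCharEntire_eq_circleAverage (f : ℂ → ℂ) (r : ℝ) :
    nevCharEntire f r = Real.circleAverage (fun z => Real.posLog ‖f z‖) 0 r := by
  simp only [nevCharEntire, Real.circleAverage_def, circleMap, zero_add, smul_eq_mul, logPlus,
    Real.posLog, max_comm]

/-- An entire function of finite order satisfies a pointwise bound by the exponential of a
polynomial. -/
theorem exists_norm_le_exp_pow {f : ℂ → ℂ} (hf : Differentiable ℂ f)
    (hord : growthOrderEntire f < ⊤) :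
    ∃ (K : ℝ) (A : ℕ), 0 ≤ K ∧ ∀ z, ‖f z‖ ≤ Real.exp (K * (1 + ‖z‖) ^ A) := by
  obtain ⟨A, hA, -⟩ := EReal.lt_iff_exists_real_btwn.1 hord
  have hev := eventually_lt_of_limsup_lt hA
  obtain ⟨r₀, hr₀⟩ := eventually_atTop.1 (hev.and (eventually_gt_atTop (1 : ℝ)))
  set N := ⌈A⌉₊ with hN
  have hT : ∀ r, r₀ ≤ r → Real.circleAverage (fun z => Real.posLog ‖f z‖) 0 r ≤ r ^ N := by
    intro r hr
    obtain ⟨h₁, h₂⟩ := hr₀ r hr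
    rw [EReal.coe_lt_coe_iff, div_lt_iff₀ (Real.log_pos h₂)] at h₁
    rw [← nevCharEntire_eq_circleAverage]
    rcases le_or_gt (nevCharEntire f r) 0 with h | h
    · exact h.trans (by positivity)
    · have h3 : Real.log (nevCharEntire f r) ≤ A * Real.log r := (le_max_left _ _).trans h₁.le
      have h4 : A * Real.log r ≤ N * Real.log r := by
        have := Real.log_pos h₂
        gcongr
        exact Nat.le_ceil A
      rw [← Real.log_le_log_iff h (by positivity), Real.log_pow]
      exact h3.trans h4
  have hr₀1 : 1 < r₀ := (hr₀ r₀ le_rfl).2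
  refine ⟨3 * (3 * r₀) ^ N, N, by positivity, fun z => ?_⟩
  have hρ : 0 < r₀ * (1 + ‖z‖) := by positivity
  obtain ⟨R, hR, h⟩ := exists_posLog_norm_le_circleAverage hf hρ
  have h1 := h z (by nlinarith [norm_nonneg z])
  have h2 := hT R (by nlinarith [hR.1, norm_nonneg z])
  have hR0 : 0 < R := by linarith [hR.1]
  have h3 : R ^ N ≤ (3 * (r₀ * (1 + ‖z‖))) ^ N := by gcongr; exact hR.2.le
  have h4 : Real.posLog ‖f z‖ ≤ 3 * (3 * r₀) ^ N * (1 + ‖z‖) ^ N := by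
    rw [mul_assoc 3, ← mul_pow]
    rw [← mul_assoc 3] at h3
    linarith
  rcases eq_or_ne (f z) 0 with h0 | h0
  · rw [h0, norm_zero]; positivity
  · rw [← Real.log_le_iff_le_exp (norm_pos_iff.2 h0)]
    exact (le_max_right _ _).trans h4

section Growth

variable {k : ℕ} {c w p₁ p₂ α₁ α₂ : ℂ} {f : ℂ → ℂ}

/-- One step of the bootstrap for the growth of solutions: a radial bound for `log ‖f‖` is
improved by a factor `4`, up to a linear term. -/
lemma exists_growth_step (hw : w ≠ 0) (hf : Differentiable ℂ f)
    (heq : ∀ z, f z ^ 4 + w * f z ^ 3 * deriv f z + iteratedDeriv k f (z + c)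
      = p₁ * Complex.exp (α₁ * z) + p₂ * Complex.exp (α₂ * z)) :
    ∃ B : ℝ, 0 ≤ B ∧ ∀ h : ℝ → ℝ, (∀ r, 0 ≤ r → 0 ≤ h r) →
      (∀ r s, 0 ≤ r → r ≤ s → h r ≤ h s) → (∀ z, ‖f z‖ ≤ Real.exp (h ‖z‖)) →
      ∀ z, ‖f z‖ ≤ Real.exp ((B * (‖z‖ + 1) + h (‖z‖ + (‖c‖ + 1))) / 4) := by
  set κ := ‖4 / w‖ with hκ
  set α := ‖α₁‖ + ‖α₂‖ with hα
  set q := ‖p₁‖ + ‖p₂‖ + k.factorial with hq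
  refine ⟨2 * κ + α + ‖f 0‖ ^ 4 + κ * q, by positivity, fun h h0 hmono hh z => ?_⟩
  set r := ‖z‖ with hr
  set H := h (r + (‖c‖ + 1)) with hH
  have hr0 : 0 ≤ r := norm_nonneg z
  have hH0 : 0 ≤ H := h0 _ (by positivity)
  have hE1 : 1 ≤ Real.exp H := Real.one_le_exp hH0
  have hA1 : 1 ≤ Real.exp (α * r) := Real.one_le_exp (by positivity)
  have hg : ∀ ζ : ℂ, ‖ζ‖ ≤ r → ‖iteratedDeriv k f (ζ + c)‖ ≤ k.factorial * Real.exp H := by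
    intro ζ hζ
    have := Complex.norm_iteratedDeriv_le_of_forall_mem_sphere_norm_le k one_pos
      (f := f) (c := ζ + c) hf.diffContOnCl (C := Real.exp H) fun x hx => by
        refine (hh x).trans (Real.exp_le_exp.2 (hmono _ _ (norm_nonneg _) ?_))
        have h1 := norm_le_norm_add_norm_sub' x (ζ + c)
        have h2 := norm_add_le ζ c
        rw [mem_sphere_iff_norm.1 hx] at h1
        linarith
    simpa using this
  have he : ∀ (β ζ : ℂ), ‖ζ‖ ≤ r → ‖Complex.exp (β * ζ)‖ ≤ Real.exp (‖β‖ * r) := by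
    intro β ζ hζ
    refine (Complex.norm_exp_le_exp_norm _).trans (Real.exp_le_exp.2 ?_)
    rw [norm_mul]
    gcongr
  have hrhs : ∀ ζ : ℂ, ‖ζ‖ ≤ r → ‖p₁ * Complex.exp (α₁ * ζ) + p₂ * Complex.exp (α₂ * ζ) -
      iteratedDeriv k f (ζ + c)‖ ≤ q * (Real.exp (α * r) * Real.exp H) := by
    intro ζ hζ
    have a1 : Real.exp (‖α₁‖ * r) ≤ Real.exp (α * r) * Real.exp H := by
      refine le_trans (Real.exp_le_exp.2 ?_) (le_mul_of_one_le_right (Real.exp_pos _).le hE1)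
      gcongr; rw [hα]; linarith [norm_nonneg α₂]
    have a2 : Real.exp (‖α₂‖ * r) ≤ Real.exp (α * r) * Real.exp H := by
      refine le_trans (Real.exp_le_exp.2 ?_) (le_mul_of_one_le_right (Real.exp_pos _).le hE1)
      gcongr; rw [hα]; linarith [norm_nonneg α₁]
    have a3 : Real.exp H ≤ Real.exp (α * r) * Real.exp H :=
      le_mul_of_one_le_left (Real.exp_pos _).le hA1
    calc _ ≤ ‖p₁‖ * ‖Complex.exp (α₁ * ζ)‖ + ‖p₂‖ * ‖Complex.exp (α₂ * ζ)‖ +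
          ‖iteratedDeriv k f (ζ + c)‖ := by
            refine (norm_sub_le _ _).trans ?_
            gcongr
            refine (norm_add_le _ _).trans ?_
            rw [norm_mul, norm_mul]
      _ ≤ ‖p₁‖ * (Real.exp (α * r) * Real.exp H) + ‖p₂‖ * (Real.exp (α * r) * Real.exp H) +
          k.factorial * (Real.exp (α * r) * Real.exp H) := by
            gcongr
            · exact (he α₁ ζ hζ).trans a1
            · exact (he α₂ ζ hζ).trans a2
            · exact (hg ζ hζ).trans (by gcongr)
      _ = _ := by rw [hq]; ring
  set Y : ℂ → ℂ := fun ζ => Complex.exp (4 / w * ζ) * f ζ ^ 4 with hY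
  have hY' : ∀ ζ, HasDerivAt Y (4 / w * Complex.exp (4 / w * ζ) *
      (p₁ * Complex.exp (α₁ * ζ) + p₂ * Complex.exp (α₂ * ζ) - iteratedDeriv k f (ζ + c))) ζ := by
    intro ζ
    have d1 : HasDerivAt (fun ζ => Complex.exp (4 / w * ζ))
        (Complex.exp (4 / w * ζ) * (4 / w)) ζ := by
      simpa using ((hasDerivAt_id ζ).const_mul (4 / w)).cexp
    have d2 := d1.mul ((hf ζ).hasDerivAt.pow 4)
    refine d2.congr_deriv ?_
    rw [← heq ζ]
    simp only [Pi.pow_apply]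
    field_simp
    push_cast
    ring
  have hbd : ∀ ζ ∈ closedBall (0 : ℂ) r, ‖deriv Y ζ‖ ≤
      κ * Real.exp (κ * r) * (q * (Real.exp (α * r) * Real.exp H)) := by
    intro ζ hζ
    rw [mem_closedBall_zero_iff] at hζ
    rw [(hY' ζ).deriv, norm_mul, norm_mul]
    gcongr
    · exact he _ ζ hζ
    · exact hrhs ζ hζ
  have hmv := (convex_closedBall (0 : ℂ) r).norm_image_sub_le_of_norm_deriv_le
    (fun ζ _ => (hY' ζ).differentiableAt) hbd (x := 0) (y := z) (by simpa using hr0)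
    (by simp [hr])
  have hYz : ‖Y z‖ ≤ ‖f 0‖ ^ 4 +
      κ * Real.exp (κ * r) * (q * (Real.exp (α * r) * Real.exp H)) * r := by
    have h1 := norm_le_norm_add_norm_sub' (Y z) (Y 0)
    have h2 : ‖Y 0‖ = ‖f 0‖ ^ 4 := by simp [hY]
    rw [sub_zero] at hmv
    linarith
  have hfz : ‖f z‖ ^ 4 ≤ Real.exp (κ * r) * ‖Y z‖ := by
    have h1 : f z ^ 4 = Complex.exp (-(4 / w) * z) * Y z := by
      rw [hY, ← mul_assoc, ← Complex.exp_add]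
      simp
    rw [← norm_pow, h1, norm_mul]
    gcongr
    have := he (-(4 / w)) z le_rfl
    rwa [norm_neg] at this
  have hfin : ‖f z‖ ^ 4 ≤ Real.exp ((2 * κ + α + ‖f 0‖ ^ 4 + κ * q) * (r + 1) + H) := by
    set e₁ := Real.exp (κ * r) with he₁
    have he₁1 : 1 ≤ e₁ := Real.one_le_exp (by positivity)
    set e₂ := Real.exp (α * r) with he₂
    set e₃ := Real.exp H with he₃
    have hq0 : 0 ≤ q := by positivity
    have hκ0 : 0 ≤ κ := norm_nonneg _
    have h5 : ‖f 0‖ ^ 4 ≤ e₁ * e₂ * e₃ * ‖f 0‖ ^ 4 := by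
      refine le_mul_of_one_le_left (by positivity) ?_
      exact one_le_mul_of_one_le_of_one_le (one_le_mul_of_one_le_of_one_le he₁1 hA1) hE1
    have h6 : ‖f z‖ ^ 4 ≤ e₁ * e₁ * e₂ * e₃ * (‖f 0‖ ^ 4 + κ * q * r) := by
      refine hfz.trans ?_
      calc e₁ * ‖Y z‖ ≤ e₁ * (e₁ * e₂ * e₃ * ‖f 0‖ ^ 4 + κ * e₁ * (q * (e₂ * e₃)) * r) := by
            gcongr
            linarith
        _ = _ := by ring
    refine h6.trans ?_
    have h7 : ‖f 0‖ ^ 4 + κ * q * r ≤ Real.exp ((‖f 0‖ ^ 4 + κ * q) * (r + 1)) := by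
      have := Real.add_one_le_exp ((‖f 0‖ ^ 4 + κ * q) * (r + 1))
      have : 0 ≤ ‖f 0‖ ^ 4 * r := by positivity
      have : 0 ≤ κ * q := by positivity
      linarith
    calc _ ≤ e₁ * e₁ * e₂ * e₃ * Real.exp ((‖f 0‖ ^ 4 + κ * q) * (r + 1)) := by gcongr
      _ = Real.exp (κ * r + κ * r + α * r + H + (‖f 0‖ ^ 4 + κ * q) * (r + 1)) := by
        simp only [Real.exp_add, he₁, he₂, he₃]
      _ ≤ _ := by
        refine Real.exp_le_exp.2 ?_
        have : 0 ≤ α := by positivity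
        linarith
  refine le_of_pow_le_pow_left₀ four_ne_zero (Real.exp_pos _).le (hfin.trans_eq ?_)
  rw [← Real.exp_nat_mul]
  congr 1
  push_cast
  ring

/-- Finite order solutions of the equation are of exponential type. -/
theorem expType_of_solution (hw : w ≠ 0) (hf : Differentiable ℂ f)
    (hord : growthOrderEntire f < ⊤)
    (heq : ∀ z, f z ^ 4 + w * f z ^ 3 * deriv f z + iteratedDeriv k f (z + c)
      = p₁ * Complex.exp (α₁ * z) + p₂ * Complex.exp (α₂ * z)) : ExpType f := by
  obtain ⟨K, A, hK, hb⟩ := exists_norm_le_exp_pow hf hord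
  obtain ⟨B, hB, hstep⟩ := exists_growth_step hw hf heq
  set d := ‖c‖ + 1 with hd
  have hd0 : 0 < d := by positivity
  have hJ : ∀ J : ℕ, ∀ z, ‖f z‖ ≤
      Real.exp (B * (‖z‖ + (1 + d)) + K * (1 + ‖z‖ + J * d) ^ A / 4 ^ J) := by
    intro J
    induction J with
    | zero =>
      intro z
      refine (hb z).trans (Real.exp_le_exp.2 ?_)
      have : 0 ≤ B * (‖z‖ + (1 + d)) := by positivity
      simpa using this
    | succ J ih =>
      intro z
      refine (hstep (fun r => B * (r + (1 + d)) + K * (1 + r + J * d) ^ A / 4 ^ J)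
        (fun r hr => by positivity) (fun r s hr hs => by gcongr) ih z).trans
        (Real.exp_le_exp.2 ?_)
      have e : 1 + (‖z‖ + d) + J * d = 1 + ‖z‖ + (J + 1 : ℕ) * d := by push_cast; ring
      simp only [e]
      rw [pow_succ (4 : ℝ) J]
      have h1 : K * (1 + ‖z‖ + (J + 1 : ℕ) * d) ^ A / (4 ^ J * 4) =
        K * (1 + ‖z‖ + (J + 1 : ℕ) * d) ^ A / 4 ^ J / 4 := by rw [div_div]
      rw [h1]
      have : 0 ≤ B * d := by positivity
      have : 0 ≤ B * ‖z‖ := by positivity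
      linarith
  refine ⟨hf, B * (1 + d), by positivity, fun z => ?_⟩
  have hlim : Tendsto (fun J : ℕ => Real.exp (B * (‖z‖ + (1 + d)) +
      K * (1 + ‖z‖ + J * d) ^ A / 4 ^ J)) atTop
      (nhds (Real.exp (B * (‖z‖ + (1 + d)) + 0))) := by
    refine (Real.continuous_exp.tendsto _).comp (tendsto_const_nhds.add ?_)
    have h0 : Tendsto (fun J : ℕ => K * (1 + ‖z‖ + d) ^ A * (((J : ℝ) ^ A + 1) / 4 ^ J))
        atTop (nhds 0) := by
      have t1 := (tendsto_pow_const_div_const_pow_of_one_lt A (r := (4 : ℝ)) (by norm_num)).add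
        (tendsto_pow_const_div_const_pow_of_one_lt 0 (r := (4 : ℝ)) (by norm_num))
      have t2 := t1.const_mul (K * (1 + ‖z‖ + d) ^ A)
      rw [add_zero, mul_zero] at t2
      refine t2.congr fun J => ?_
      rw [pow_zero, add_div]
    refine squeeze_zero (fun J => by positivity) (fun J => ?_) h0
    rw [← mul_div_assoc, mul_assoc K]
    gcongr
    rcases Nat.eq_zero_or_pos J with rfl | hJ
    · have h1 : (1 + ‖z‖ + (0 : ℕ) * d) ^ A ≤ (1 + ‖z‖ + d) ^ A := by
        gcongr
        simpa using hd0.le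
      exact h1.trans (le_mul_of_one_le_right (by positivity) (by simp))
    · have h1 : (1 : ℝ) ≤ J := by exact_mod_cast hJ
      have h2 : 1 + ‖z‖ + J * d ≤ (1 + ‖z‖ + d) * J := by
        have := norm_nonneg z
        nlinarith
      calc (1 + ‖z‖ + J * d) ^ A ≤ ((1 + ‖z‖ + d) * J) ^ A := by gcongr
        _ = (1 + ‖z‖ + d) ^ A * J ^ A := mul_pow _ _ _
        _ ≤ _ := by gcongr; linarith
  have := ge_of_tendsto' hlim fun J => hJ J z
  refine this.trans (Real.exp_le_exp.2 ?_)
  have : 0 ≤ B * d * ‖z‖ := by positivity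
  linarith

end Growth

section Counting

variable {f : ℂ → ℂ}

lemma divisor_eq_zeroMult (hf : Differentiable ℂ f) (hne : ∃ b, f b ≠ 0) {U : Set ℂ} {z : ℂ}
    (hz : z ∈ U) : MeromorphicOn.divisor f U z = zeroMult f z := by
  obtain ⟨b, hb⟩ := hne
  have ha : AnalyticAt ℂ f z := hf.analyticAt z
  rw [MeromorphicOn.AnalyticOnNhd.divisor_apply (fun x _ => hf.analyticAt x) hz]
  have hfin : analyticOrderAt f z ≠ ⊤ := by
    rw [Ne, analyticOrderAt_eq_top]
    intro h
    have := AnalyticOnNhd.eq_of_eventuallyEq (fun x _ => hf.analyticAt x)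
      (g := fun _ => (0 : ℂ)) (fun x _ => analyticAt_const) h
    exact hb (congrFun this b)
  obtain ⟨n, hn⟩ := ENat.ne_top_iff_exists.1 hfin
  have hn' := (analyticOrderAt_eq_nat_iff_iteratedDeriv_eq_zero ha).1 hn.symm
  have hm : zeroMult f z = n := by
    refine le_antisymm (Nat.sInf_le hn'.2) (le_csInf ⟨n, hn'.2⟩ fun m hm => ?_)
    by_contra h
    exact hm (hn'.1 m (not_le.1 h))
  rw [← hn, hm]
  rfl

lemma integral_indicator_div {a R : ℝ} (ha : 0 < a) (haR : a ≤ R) :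
    IntervalIntegrable (fun t : ℝ => if a ≤ t then 1 / t else 0) volume 0 R ∧
      ∫ t in (0 : ℝ)..R, (if a ≤ t then 1 / t else 0) = Real.log R - Real.log a := by
  have e : (fun t : ℝ => if a ≤ t then 1 / t else 0) = (Set.Ici a).indicator fun t => 1 / t := by
    ext t
    simp [Set.indicator_apply]
  have hs : Set.Ici a ∩ Set.Ioc 0 R = Set.Icc a R := by
    ext t
    simp only [Set.mem_inter_iff, Set.mem_Ici, Set.mem_Ioc, Set.mem_Icc]
    exact ⟨fun h => ⟨h.1, h.2.2⟩, fun h => ⟨h.1, ha.trans_le h.1, h.2⟩⟩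
  have hR : 0 < R := ha.trans_le haR
  rw [e, intervalIntegrable_iff_integrableOn_Ioc_of_le hR.le,
    intervalIntegral.integral_of_le hR.le, integral_indicator measurableSet_Ici, IntegrableOn,
    integrable_indicator_iff measurableSet_Ici, IntegrableOn,
    Measure.restrict_restrict measurableSet_Ici, hs]
  constructor
  · refine ContinuousOn.integrableOn_compact isCompact_Icc ?_
    exact continuousOn_const.div continuousOn_id fun t ht => (ha.trans_le ht.1).ne'
  · rw [integral_Icc_eq_integral_Ioc, ← intervalIntegral.integral_of_le haR,
      integral_one_div_of_pos ha hR, Real.log_div hR.ne' ha.ne']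

theorem circleAverage_log_norm_eq_integZeroCount (hf : Differentiable ℂ f)
    (hne : ∃ b, f b ≠ 0) {R : ℝ} (hR : 0 < R) :
    Real.circleAverage (fun z => Real.log ‖f z‖) 0 R =
      integZeroCount f R + Real.log ‖meromorphicTrailingCoeffAt f 0‖ := by
  classical
  set D := MeromorphicOn.divisor f (closedBall (0 : ℂ) |R|) with hD
  have hfin : D.support.Finite := D.finiteSupport (isCompact_closedBall _ _)
  have hDz : ∀ u, ‖u‖ ≤ R → D u = zeroMult f u := fun u hu =>
    divisor_eq_zeroMult hf hne (by simpa [abs_of_pos hR] using hu)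
  set S := hfin.toFinset with hS
  have hSR : ∀ u ∈ S, ‖u‖ ≤ R := fun u hu => by
    have := D.supportWithinDomain (hfin.mem_toFinset.1 hu)
    simpa [abs_of_pos hR] using this
  have hcount : ∀ t ≤ R, (zeroCount f t : ℝ) =
      ∑ u ∈ S, if ‖u‖ ≤ t then (zeroMult f u : ℝ) else 0 := by
    intro t ht
    have h1 : zeroCount f t = ∑ u ∈ S, if ‖u‖ ≤ t then zeroMult f u else 0 := by
      rw [zeroCount, finsum_mem_def]
      rw [finsum_eq_sum_of_support_subset (s := S)]
      · refine Finset.sum_congr rfl fun u _ => ?_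
        simp [Set.indicator_apply]
      · intro u hu
        have hu1 : u ∈ closedBall (0 : ℂ) t := Set.mem_of_indicator_ne_zero hu
        rw [Function.mem_support, Set.indicator_of_mem hu1] at hu
        rw [Finset.mem_coe, hS, hfin.mem_toFinset, Function.mem_support,
          hDz u ((mem_closedBall_zero_iff.1 hu1).trans ht)]
        exact_mod_cast hu
    rw [h1]
    push_cast
    rfl
  have hzero : (zeroCount f 0 : ℝ) = zeroMult f 0 := by
    simp [zeroCount]
  have hint : ∫ t in (0 : ℝ)..R, ((zeroCount f t : ℝ) - zeroCount f 0) / t =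
      ∑ u ∈ S, if u = 0 then 0 else zeroMult f u * (Real.log R - Real.log ‖u‖) := by
    have h1 : ∀ t ∈ Set.uIcc 0 R, ((zeroCount f t : ℝ) - zeroCount f 0) / t =
        ∑ u ∈ S, if u = 0 then 0 else zeroMult f u * (if ‖u‖ ≤ t then 1 / t else 0) := by
      intro t ht
      rw [Set.uIcc_of_le hR.le] at ht
      rw [hcount t ht.2, hcount 0 hR.le, ← Finset.sum_sub_distrib, Finset.sum_div]
      refine Finset.sum_congr rfl fun u _ => ?_
      by_cases hu : u = 0
      · simp [hu, ht.1]
      · have hu' : ¬ ‖u‖ ≤ 0 := by simpa using hu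
        rw [if_neg hu', if_neg hu]
        split_ifs <;> ring
    rw [intervalIntegral.integral_congr h1, intervalIntegral.integral_finsetSum]
    · refine Finset.sum_congr rfl fun u hu => ?_
      split_ifs with h
      · simp
      · rw [intervalIntegral.integral_const_mul,
          (integral_indicator_div (norm_pos_iff.2 h) (hSR u hu)).2]
    · intro u hu
      split_ifs with h
      · simp
      · exact (integral_indicator_div (norm_pos_iff.2 h) (hSR u hu)).1.const_mul _
  rw [MeromorphicOn.circleAverage_log_norm hR.ne'
    (fun z _ => hf.meromorphic_complex z), integZeroCount, hint, hzero, ← hD,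
    hDz 0 (by simpa using hR.le),
    finsum_eq_sum_of_support_subset (s := S)]
  · have : ∑ u ∈ S, (D u : ℝ) * Real.log (R * ‖0 - u‖⁻¹) =
        ∑ u ∈ S, if u = 0 then 0 else zeroMult f u * (Real.log R - Real.log ‖u‖) := by
      refine Finset.sum_congr rfl fun u hu => ?_
      split_ifs with h
      · simp [h]
      · rw [hDz u (hSR u hu), zero_sub, norm_neg, ← div_eq_mul_inv,
          Real.log_div hR.ne' (norm_ne_zero_iff.2 h)]
        simp
    rw [this]
    push_cast
    ring
  · intro u hu
    rw [Finset.mem_coe, hS, hfin.mem_toFinset, Function.mem_support]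
    intro h
    simp [h] at hu

lemma circleAverage_log_norm_mono (hf : Differentiable ℂ f) {r s : ℝ} (hr : 0 < r)
    (hrs : r ≤ s) : Real.circleAverage (fun z => Real.log ‖f z‖) 0 r ≤
      Real.circleAverage (fun z => Real.log ‖f z‖) 0 s := by
  have hm := hf.meromorphic_complex
  have h := Function.locallyFinsuppWithin.logCounting_mono
    (MeromorphicOn.AnalyticOnNhd.divisor_nonneg fun x (_ : x ∈ Set.univ) => hf.analyticAt x)
    (Set.mem_Ioi.2 hr) (Set.mem_Ioi.2 (hr.trans_le hrs)) hrs
  rw [Function.locallyFinsuppWithin.logCounting_divisor_eq_circleAverage_sub_const hm hr.ne',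
    Function.locallyFinsuppWithin.logCounting_divisor_eq_circleAverage_sub_const hm
      (hr.trans_le hrs).ne'] at h
  linarith

/-- If the zeros of an entire function of exponential type are few, then the means of
`log ‖f‖` are small. -/
theorem ExpType.smallLogMean_of_smallFn (hf : ExpType f) (hne : ∃ b, f b ≠ 0)
    (hN : SmallFn (integZeroCount f) (nevCharEntire f)) : SmallLogMean f := by
  obtain ⟨d, B, hB, hb⟩ := hf
  obtain ⟨E, hE, h⟩ := hN
  have hT : ∀ r, 0 < r → nevCharEntire f r ≤ B * (r + 1) := by
    intro r hr
    rw [nevCharEntire_eq_circleAverage]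
    refine (Real.circleAverage_mono
      (d.meromorphic_complex.circleIntegrable_posLog_norm 0 r)
      (circleIntegrable_const (B * (r + 1)) 0 r) fun z hz => ?_).trans_eq
      (Real.circleAverage_const _ _ _)
    rw [abs_of_pos hr, mem_sphere_zero_iff_norm] at hz
    refine (Real.posLog_le_posLog (norm_nonneg _) (hb z)).trans ?_
    rw [hz]
    refine max_le (by positivity) ?_
    rw [Real.log_exp]
  set L := (volume E).toReal + 1 with hL
  have hL0 : 0 < L := by positivity
  intro ε hε
  set δ := ε / (2 * (B + 1)) with hδ
  have hδ0 : 0 < δ := by positivity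
  have hδB : δ * B ≤ ε / 2 := by
    rw [hδ, div_mul_eq_mul_div, div_le_div_iff₀ (by positivity) two_pos]
    nlinarith
  obtain ⟨R, hR⟩ := h δ hδ0
  set κ := Real.log ‖meromorphicTrailingCoeffAt f 0‖ with hκ
  filter_upwards [eventually_ge_atTop R, eventually_gt_atTop 0,
    eventually_ge_atTop ((ε / 2 * (L + 1) + κ) / (ε / 2))] with r hrR hr0 hr
  obtain ⟨s, hs, hsE⟩ : ∃ s ∈ Set.Icc r (r + L), s ∉ E := by
    by_contra hcon
    push Not at hcon
    have h1 : volume (Set.Icc r (r + L)) ≤ volume E := measure_mono hcon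
    rw [Real.volume_Icc, add_sub_cancel_left, ← ENNReal.ofReal_toReal hE.ne,
      ENNReal.ofReal_le_ofReal_iff ENNReal.toReal_nonneg] at h1
    linarith
  have hs0 : 0 < s := hr0.trans_le hs.1
  refine (circleAverage_log_norm_mono d hr0 hs.1).trans ?_
  rw [circleAverage_log_norm_eq_integZeroCount d hne hs0]
  have h2 := (le_abs_self _).trans (hR s (hrR.trans hs.1) hsE)
  have h3 : δ * nevCharEntire f s ≤ ε / 2 * (r + L + 1) := by
    calc δ * nevCharEntire f s ≤ δ * (B * (s + 1)) := by gcongr; exact hT s hs0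
      _ = δ * B * (s + 1) := by ring
      _ ≤ _ := by
        gcongr
        exact hs.2
  rw [div_le_iff₀ (by positivity)] at hr
  linarith

end Counting

section ExponentialSums

lemma hasDerivAt_cexp_mul (β z : ℂ) :
    HasDerivAt (fun z => Complex.exp (β * z)) (β * Complex.exp (β * z)) z := by
  simpa [mul_comm] using ((hasDerivAt_id z).const_mul β).cexp

lemma iteratedDeriv_cexp_mul (β : ℂ) (j : ℕ) :
    iteratedDeriv j (fun z => Complex.exp (β * z)) = fun z => β ^ j * Complex.exp (β * z) := by
  induction j with
  | zero => simp
  | succ j ih =>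
    rw [iteratedDeriv_succ, ih]
    ext z
    rw [((hasDerivAt_cexp_mul β z).const_mul (β ^ j)).deriv]
    ring

lemma eq_mul_exp_of_deriv_eq {F : ℂ → ℂ} (dF : Differentiable ℂ F) {β : ℂ}
    (h : ∀ z, deriv F z = β * F z) (z : ℂ) : F z = F 0 * Complex.exp (β * z) := by
  have hd : ∀ z, HasDerivAt (fun z => Complex.exp (-β * z) * F z) 0 z := fun z =>
    ((hasDerivAt_cexp_mul (-β) z).mul (dF z).hasDerivAt).congr_deriv (by rw [h]; ring)
  have hc := is_const_of_deriv_eq_zero (fun z => (hd z).differentiableAt)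
    (fun z => (hd z).deriv) z 0
  have he : Complex.exp (-β * z) * Complex.exp (β * z) = 1 := by
    rw [← Complex.exp_add]
    simp
  simp only [mul_zero, Complex.exp_zero, one_mul] at hc
  rw [← hc, mul_right_comm, he, one_mul]

lemma eq_zero_of_exp_add_exp_eq_zero {β₁ β₂ a b : ℂ} (hβ : β₁ ≠ β₂)
    (h : ∀ z, a * Complex.exp (β₁ * z) + b * Complex.exp (β₂ * z) = 0) : a = 0 ∧ b = 0 := by
  have h0 := h 0
  have h1 : a * (β₁ * Complex.exp (β₁ * 0)) + b * (β₂ * Complex.exp (β₂ * 0)) = 0 := by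
    rw [← (((hasDerivAt_cexp_mul β₁ 0).const_mul a).add
      ((hasDerivAt_cexp_mul β₂ 0).const_mul b)).deriv]
    have : ((fun z => a * Complex.exp (β₁ * z)) + fun z => b * Complex.exp (β₂ * z)) =
        fun _ => 0 := funext h
    rw [this, deriv_const]
  simp only [mul_zero, Complex.exp_zero, mul_one] at h0 h1
  have ha : a * (β₁ - β₂) = 0 := by linear_combination h1 - β₂ * h0
  have ha0 := (mul_eq_zero.1 ha).resolve_right (sub_ne_zero.2 hβ)
  exact ⟨ha0, by simpa [ha0] using h0⟩

end ExponentialSums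

section Splitting

variable {α₁ α₂ : ℂ} {F : ℂ → ℂ}

/-- The logarithmic derivative, shifted by a constant. -/
lemma smallProximity_deriv_div_sub (hF : ExpType F) (hne : ∃ b, F b ≠ 0) (a : ℂ) :
    SmallProximity fun z => deriv F z / F z + -a :=
  (hF.smallProximity_deriv_div hne).add (.const _)

/-- The quotient of `F'' - (α₁ + α₂) F' + α₁ α₂ F` by `F` has small proximity function. -/
lemma smallProximity_second_order_div (hF : ExpType F) (hne : ∃ b, F b ≠ 0)
    (α₁ α₂ : ℂ) : SmallProximity fun z =>
      iteratedDeriv 2 F z / F z + -(α₁ + α₂) * (deriv F z / F z) + α₁ * α₂ :=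
  ((hF.smallProximity_iteratedDeriv_div hne 2).add
    ((SmallProximity.const _).mul (hF.smallProximity_deriv_div hne))).add (.const _)

/-- A solution of `F'' - (α₁ + α₂) F' + α₁ α₂ F = 0` with small logarithmic means is a multiple
of a single exponential. -/
lemma exists_eq_exp_of_second_order (hα : α₁ ≠ α₂) (hF : ExpType F)
    (hS : (∃ b, F b ≠ 0) → SmallLogMean F)
    (h : ∀ z, iteratedDeriv 2 F z - (α₁ + α₂) * deriv F z + α₁ * α₂ * F z = 0) :
    ∃ c₁ c₂ : ℂ, (c₁ = 0 ∨ c₂ = 0) ∧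
      ∀ z, F z = c₁ * Complex.exp (α₁ * z) + c₂ * Complex.exp (α₂ * z) := by
  have d := hF.1
  have d' := d.deriv
  have h2 : ∀ z, iteratedDeriv 2 F z = deriv (deriv F) z := fun z => by
    rw [iteratedDeriv_succ, iteratedDeriv_one]
  have key : ∀ β γ : ℂ, β + γ = α₁ + α₂ → β * γ = α₁ * α₂ → ∃ c : ℂ,
      ∀ z, deriv F z - β * F z = c * Complex.exp (γ * z) := by
    intro β γ hs hp
    refine ⟨_, fun z => eq_mul_exp_of_deriv_eq (F := fun z => deriv F z - β * F z)
      (d'.sub (d.const_mul β)) (fun z => ?_) z⟩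
    have := ((d' z).hasDerivAt.sub ((d z).hasDerivAt.const_mul β)).deriv
    have e : (deriv F - fun z => β * F z) = fun z => deriv F z - β * F z := rfl
    rw [e] at this
    rw [this, ← h2]
    linear_combination h z - deriv F z * hs + F z * hp
  obtain ⟨a₂, ha₂⟩ := key α₁ α₂ rfl rfl
  obtain ⟨a₁, ha₁⟩ := key α₂ α₁ (add_comm _ _) (mul_comm _ _)
  have hα' : α₁ - α₂ ≠ 0 := sub_ne_zero.2 hα
  refine ⟨a₁ / (α₁ - α₂), -a₂ / (α₁ - α₂), ?_, fun z => ?_⟩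
  · by_contra! hcon
    have hc₁ : a₁ ≠ 0 := fun h => hcon.1 (by simp [h])
    have hc₂ : a₂ ≠ 0 := fun h => hcon.2 (by simp [h])
    have hne : ∃ b, F b ≠ 0 := by
      by_contra! h0
      have hF0 : F = fun _ => 0 := funext h0
      exact hc₁ (by simpa [hF0] using (ha₁ 0).symm)
    refine not_smallLogMean hα d (differentiable_const 1) ⟨0, one_ne_zero⟩ hne
      ((SmallProximity.const a₁⁻¹).mul (smallProximity_deriv_div_sub hF hne α₂))
      ((SmallProximity.const a₂⁻¹).mul (smallProximity_deriv_div_sub hF hne α₁))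
      (fun z hz => ?_) (fun z hz => ?_) (hS hne)
    · field_simp
      linear_combination -ha₁ z
    · field_simp
      linear_combination -ha₂ z
  · field_simp
    linear_combination ha₁ z - ha₂ z

/-- Two functions with small logarithmic means whose sum is a combination of two exponentials
satisfy the differential equation `F'' - (α₁ + α₂) F' + α₁ α₂ F = 0`. -/
lemma second_order_eq_zero_of_add_eq {φ g : ℂ → ℂ} {p₁ p₂ : ℂ} (hp₁ : p₁ ≠ 0) (hp₂ : p₂ ≠ 0)
    (hα : α₁ ≠ α₂) (hφ : ExpType φ) (hg : ExpType g)
    (hSφ : (∃ b, φ b ≠ 0) → SmallLogMean φ) (hSg : (∃ b, g b ≠ 0) → SmallLogMean g)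
    (h : ∀ z, φ z + g z = p₁ * Complex.exp (α₁ * z) + p₂ * Complex.exp (α₂ * z)) :
    (∀ z, iteratedDeriv 2 φ z - (α₁ + α₂) * deriv φ z + α₁ * α₂ * φ z = 0) ∧
      ∀ z, iteratedDeriv 2 g z - (α₁ + α₂) * deriv g z + α₁ * α₂ * g z = 0 := by
  have h2 : ∀ F : ℂ → ℂ, iteratedDeriv 2 F = deriv (deriv F) := fun F => by
    rw [iteratedDeriv_succ, iteratedDeriv_one]
  have h' : ∀ z, deriv φ z + deriv g z =
      α₁ * p₁ * Complex.exp (α₁ * z) + α₂ * p₂ * Complex.exp (α₂ * z) := by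
    intro z
    have e1 := ((hφ.1 z).hasDerivAt.add (hg.1 z).hasDerivAt).deriv
    have e2 : φ + g = fun z => p₁ * Complex.exp (α₁ * z) + p₂ * Complex.exp (α₂ * z) := funext h
    rw [← e1, e2, (((hasDerivAt_cexp_mul α₁ z).const_mul p₁).fun_add
      ((hasDerivAt_cexp_mul α₂ z).const_mul p₂)).deriv]
    ring
  have h'' : ∀ z, iteratedDeriv 2 φ z + iteratedDeriv 2 g z =
      α₁ ^ 2 * p₁ * Complex.exp (α₁ * z) + α₂ ^ 2 * p₂ * Complex.exp (α₂ * z) := by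
    intro z
    have e1 := ((hφ.1.deriv z).hasDerivAt.add (hg.1.deriv z).hasDerivAt).deriv
    have e2 : deriv φ + deriv g =
      fun z => α₁ * p₁ * Complex.exp (α₁ * z) + α₂ * p₂ * Complex.exp (α₂ * z) := funext h'
    rw [h2, h2, ← e1, e2, (((hasDerivAt_cexp_mul α₁ z).const_mul (α₁ * p₁)).fun_add
      ((hasDerivAt_cexp_mul α₂ z).const_mul (α₂ * p₂))).deriv]
    ring
  have hneg : ∀ z, iteratedDeriv 2 g z - (α₁ + α₂) * deriv g z + α₁ * α₂ * g z =
      -(iteratedDeriv 2 φ z - (α₁ + α₂) * deriv φ z + α₁ * α₂ * φ z) := fun z => by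
    linear_combination h'' z - (α₁ + α₂) * h' z + α₁ * α₂ * h z
  suffices hφ0 : ∀ z, iteratedDeriv 2 φ z - (α₁ + α₂) * deriv φ z + α₁ * α₂ * φ z = 0 from
    ⟨hφ0, fun z => by rw [hneg, hφ0, neg_zero]⟩
  by_contra! hψ
  have hneφ : ∃ b, φ b ≠ 0 := by
    by_contra! h0
    obtain ⟨b, hb⟩ := hψ
    have : φ = fun _ => 0 := funext h0
    simp [this] at hb
  have hneg' : ∃ b, g b ≠ 0 := by
    by_contra! h0
    obtain ⟨b, hb⟩ := hψ
    have e := hneg b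
    have : g = fun _ => 0 := funext h0
    simp only [this, h2, deriv_const', mul_zero, sub_zero, add_zero] at e
    exact hb (by rw [h2]; exact neg_eq_zero.1 e.symm)
  obtain ⟨b, hb⟩ : ∃ b, φ b * g b ≠ 0 := by
    by_contra! h0
    have := AnalyticOnNhd.eq_zero_or_eq_zero_of_mul_eq_zero (U := Set.univ)
      (fun z _ => hφ.1.analyticAt z) (fun z _ => hg.1.analyticAt z) (fun z _ => h0 z)
      isPreconnected_univ
    obtain ⟨b, hb⟩ := hneφ
    obtain ⟨b', hb'⟩ := hneg'
    exact this.elim (fun h => hb (h b trivial)) fun h => hb' (h b' trivial)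
  have hα₁₂ : α₁ - α₂ ≠ 0 := sub_ne_zero.2 hα
  have hα₂₁ : α₂ - α₁ ≠ 0 := sub_ne_zero.2 hα.symm
  have hP : ∀ a p : ℂ, SmallProximity _ := fun a p => (SmallProximity.const p).mul
    (((SmallProximity.const (-1)).mul ((smallProximity_deriv_div_sub hφ hneφ a).mul
      (smallProximity_second_order_div hg hneg' α₁ α₂))).add
      ((smallProximity_deriv_div_sub hg hneg' a).mul
        (smallProximity_second_order_div hφ hneφ α₁ α₂)))
  have dψ : Differentiable ℂ
      fun z => iteratedDeriv 2 φ z - (α₁ + α₂) * deriv φ z + α₁ * α₂ * φ z :=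
    ((hφ.iteratedDeriv 2).1.sub (hφ.1.deriv.const_mul _)).add (hφ.1.const_mul _)
  refine not_smallLogMean hα (Φ := fun z => φ z * g z) (hφ.1.mul hg.1) dψ hψ ⟨b, hb⟩
    (hP α₂ ((α₁ - α₂) * p₁)⁻¹) (hP α₁ ((α₂ - α₁) * p₂)⁻¹) (fun z hz => ?_) (fun z hz => ?_)
    ((hSφ hneφ).mul (hSg hneg') hφ.1 hg.1 ⟨b, hb⟩)
  · have hz₁ := left_ne_zero_of_mul hz
    have hz₂ := right_ne_zero_of_mul hz
    have e : (α₁ - α₂) * p₁ * Complex.exp (α₁ * z) =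
        (deriv φ z - α₂ * φ z) + (deriv g z - α₂ * g z) := by
      linear_combination α₂ * h z - h' z
    field_simp
    linear_combination (iteratedDeriv 2 φ z - (α₁ + α₂) * deriv φ z + α₁ * α₂ * φ z) * e
      + (deriv φ z - α₂ * φ z) * hneg z
  · have hz₁ := left_ne_zero_of_mul hz
    have hz₂ := right_ne_zero_of_mul hz
    have e : (α₂ - α₁) * p₂ * Complex.exp (α₂ * z) =
        (deriv φ z - α₁ * φ z) + (deriv g z - α₁ * g z) := by
      linear_combination α₁ * h z - h' z
    field_simp
    linear_combination (iteratedDeriv 2 φ z - (α₁ + α₂) * deriv φ z + α₁ * α₂ * φ z) * e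
      + (deriv φ z - α₁ * φ z) * hneg z

/-- Two functions with small logarithmic means whose sum is a combination of two exponentials
are, up to order, the two terms of that combination. -/
theorem eq_exp_of_add_eq {φ g : ℂ → ℂ} {p₁ p₂ : ℂ} (hp₁ : p₁ ≠ 0) (hp₂ : p₂ ≠ 0)
    (hα : α₁ ≠ α₂) (hφ : ExpType φ) (hg : ExpType g)
    (hSφ : (∃ b, φ b ≠ 0) → SmallLogMean φ) (hSg : (∃ b, g b ≠ 0) → SmallLogMean g)
    (h : ∀ z, φ z + g z = p₁ * Complex.exp (α₁ * z) + p₂ * Complex.exp (α₂ * z)) :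
    (∀ z, φ z = p₂ * Complex.exp (α₂ * z) ∧ g z = p₁ * Complex.exp (α₁ * z)) ∨
      ∀ z, φ z = p₁ * Complex.exp (α₁ * z) ∧ g z = p₂ * Complex.exp (α₂ * z) := by
  obtain ⟨hφ0, hg0⟩ := second_order_eq_zero_of_add_eq hp₁ hp₂ hα hφ hg hSφ hSg h
  obtain ⟨c₁, c₂, hc, hφe⟩ := exists_eq_exp_of_second_order hα hφ hSφ hφ0
  obtain ⟨d₁, d₂, hd, hge⟩ := exists_eq_exp_of_second_order hα hg hSg hg0
  obtain ⟨h1, h2⟩ := eq_zero_of_exp_add_exp_eq_zero hα (a := c₁ + d₁ - p₁) (b := c₂ + d₂ - p₂)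
    fun z => by linear_combination h z - hφe z - hge z
  rcases hc with rfl | rfl
  · have e1 : d₁ = p₁ := by linear_combination h1
    have e2 : d₂ = 0 := hd.resolve_left (e1 ▸ hp₁)
    subst e1 e2
    have e3 : c₂ = p₂ := by linear_combination h2
    subst e3
    exact .inl fun z => ⟨by simpa using hφe z, by simpa using hge z⟩
  · have e1 : d₂ = p₂ := by linear_combination h2
    have e2 : d₁ = 0 := hd.resolve_right (e1 ▸ hp₂)
    subst e1 e2
    have e3 : c₁ = p₁ := by linear_combination h1
    subst e3
    exact .inr fun z => ⟨by simpa using hφe z, by simpa using hge z⟩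

end Splitting

section Solutions

variable {k : ℕ} {f : ℂ → ℂ}

/-- If a derivative of `f` is a multiple of an exponential and the logarithmic means of `f` are
small, then so is `f` itself. -/
lemma eq_exp_of_iteratedDeriv_eq (hf : ExpType f) (hS : SmallLogMean f) (hne : ∃ b, f b ≠ 0)
    {β C : ℂ} (hβ : β ≠ 0) (hC : C ≠ 0)
    (h : ∀ z, iteratedDeriv k f z = C * Complex.exp (β * z)) (z : ℂ) :
    f z = C / β ^ k * Complex.exp (β * z) := by
  classical
  set E : ℂ → ℂ := fun z => C / β ^ k * Complex.exp (β * z) with hE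
  have dE : Differentiable ℂ E := fun z =>
    ((hasDerivAt_cexp_mul β z).const_mul _).differentiableAt
  have hEj : ∀ j z, iteratedDeriv j E z = C / β ^ k * (β ^ j * Complex.exp (β * z)) := by
    intro j z
    rw [hE, iteratedDeriv_const_mul_field, iteratedDeriv_cexp_mul]
  have hsub : ∀ j z, iteratedDeriv j (f - E) z = iteratedDeriv j f z - iteratedDeriv j E z :=
    fun j z => iteratedDeriv_sub (hf.1.contDiff.contDiffAt) dE.contDiff.contDiffAt
  have hk : ∃ m, ∀ z, iteratedDeriv m (f - E) z = 0 := by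
    refine ⟨k, fun z => ?_⟩
    rw [hsub, h, hEj]
    field_simp
    ring
  suffices h0 : Nat.find hk = 0 by
    have := Nat.find_spec hk z
    rw [h0, iteratedDeriv_zero, Pi.sub_apply] at this
    exact sub_eq_zero.1 this
  by_contra h0
  obtain ⟨j, hj⟩ := Nat.exists_eq_succ_of_ne_zero h0
  have hspec := Nat.find_spec hk
  rw [hj] at hspec
  have hconst : ∀ z, iteratedDeriv j (f - E) z = iteratedDeriv j (f - E) 0 := fun z => by
    refine is_const_of_deriv_eq_zero ?_ (fun x => ?_) z 0
    · exact (hf.1.sub dE).contDiff.differentiable_iteratedDeriv j (n := (j + 1 : ℕ))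
        (by exact_mod_cast Nat.lt_succ_self j)
    · rw [← iteratedDeriv_succ]
      exact hspec x
  set κ := iteratedDeriv j (f - E) 0 with hκ
  have hκ0 : κ ≠ 0 := fun h => Nat.find_min hk (by omega : j < Nat.find hk)
    fun z => (hconst z).trans h
  refine not_smallLogMean hβ hf.1 (differentiable_const 1) ⟨0, one_ne_zero⟩ hne (β₂ := 0)
    ((SmallProximity.const C⁻¹).mul (hf.smallProximity_iteratedDeriv_div hne k))
    ((SmallProximity.const κ⁻¹).mul ((hf.smallProximity_iteratedDeriv_div hne j).add
      ((SmallProximity.const (-β ^ j / β ^ k)).mul (hf.smallProximity_iteratedDeriv_div hne k))))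
    (fun z hz => ?_) (fun z hz => ?_) hS
  · rw [h]
    field_simp
  · have := hsub j z
    rw [hconst, hEj] at this
    rw [h, zero_mul, Complex.exp_zero]
    field_simp
    field_simp at this
    linear_combination this

lemma exists_exp_of_eq (hf : ExpType f) (hS : SmallLogMean f) (hne : ∃ b, f b ≠ 0)
    {c w α β p q : ℂ} (hα : α ≠ 0) (hp : p ≠ 0) (hq : q ≠ 0)
    (h₁ : ∀ z, iteratedDeriv k f (z + c) = p * Complex.exp (α * z))
    (h₂ : ∀ z, f z ^ 4 + w * f z ^ 3 * deriv f z = q * Complex.exp (β * z)) :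
    ∃ C : ℂ, C ≠ 0 ∧ (∀ z, f z = C * Complex.exp (α * z)) ∧ 1 + α * w ≠ 0 ∧
      4 * α = β ∧ C ^ 4 * (1 + α * w) = q := by
  set C := p * Complex.exp (-(α * c)) / α ^ k with hC
  have hC0 : C ≠ 0 := div_ne_zero (mul_ne_zero hp (Complex.exp_ne_zero _)) (pow_ne_zero _ hα)
  have hfe : ∀ z, f z = C * Complex.exp (α * z) := by
    refine eq_exp_of_iteratedDeriv_eq hf hS hne hα (mul_ne_zero hp (Complex.exp_ne_zero _))
      fun z => ?_
    have := h₁ (z - c)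
    rw [sub_add_cancel] at this
    rw [this, mul_assoc, ← Complex.exp_add]
    congr 2
    ring
  have hd : ∀ z, deriv f z = C * (α * Complex.exp (α * z)) := fun z => by
    rw [funext hfe]
    exact ((hasDerivAt_cexp_mul α z).const_mul C).deriv
  have h : ∀ z, C ^ 4 * (1 + α * w) * Complex.exp (4 * α * z) = q * Complex.exp (β * z) := by
    intro z
    rw [← h₂, hd, hfe, show 4 * α * z = (4 : ℕ) * (α * z) by push_cast; ring,
      Complex.exp_nat_mul]
    ring
  have h0 : C ^ 4 * (1 + α * w) = q := by simpa using h 0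
  refine ⟨C, hC0, hfe, fun h1 => hq (by rw [← h0, h1, mul_zero]), ?_, h0⟩
  by_contra hne'
  refine hq (eq_zero_of_exp_add_exp_eq_zero hne' (a := q) (b := -q) fun z => ?_).1
  linear_combination h z - Complex.exp (4 * α * z) * h0

end Solutions

theorem statement1 (n k : ℕ) (hn : n = 4) (c w p₁ p₂ α₁ α₂ : ℂ)
    (hw : w ≠ 0) (hp₁ : p₁ ≠ 0) (hp₂ : p₂ ≠ 0) (hα₁ : α₁ ≠ 0) (hα₂ : α₂ ≠ 0)
    (hα : α₁ ≠ α₂) (f : ℂ → ℂ) (hf : Differentiable ℂ f)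
    (htrans : TranscendentalEntire f) (hord : growthOrderEntire f < ⊤)
    (hN : SmallFn (integZeroCount f) (nevCharEntire f))
    (heq : ∀ z : ℂ, f z ^ n + w * f z ^ (n - 1) * deriv f z + iteratedDeriv k f (z + c)
      = p₁ * Complex.exp (α₁ * z) + p₂ * Complex.exp (α₂ * z)) :
    ∃ a C : ℂ, a ≠ 0 ∧ C ≠ 0 ∧ (∀ z : ℂ, f z = C * Complex.exp (a * z)) ∧
      1 + a * w ≠ 0 ∧
      ((a = α₁ ∧ (n : ℂ) * a = α₂ ∧ C ^ n * (1 + a * w) = p₂) ∨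
       (a = α₂ ∧ (n : ℂ) * a = α₁ ∧ C ^ n * (1 + a * w) = p₁)) := by
  subst hn
  have hne : ∃ b, f b ≠ 0 := by
    by_contra! h
    exact htrans ⟨0, fun z => by simp [h]⟩
  have hE : ExpType f := expType_of_solution hw hf hord heq
  have hS : SmallLogMean f := hE.smallLogMean_of_smallFn hne hN
  have ⟨b, hb⟩ := hne
  have hφE : ExpType fun z => f z ^ 4 + w * f z ^ 3 * deriv f z := by
    have := ((hE.mul hE).mul hE).mul (hE.add ((ExpType.const w).mul hE.deriv))
    convert this using 2
    ring
  have hφS : (∃ b, f b ^ 4 + w * f b ^ 3 * deriv f b ≠ 0) →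
      SmallLogMean fun z => f z ^ 4 + w * f z ^ 3 * deriv f z := by
    intro hφ
    have h2 := hS.mul hS hf hf ⟨b, mul_ne_zero hb hb⟩
    have d2 := hf.fun_mul hf
    have hb4 : f b * f b * (f b * f b) ≠ 0 := by simpa using hb
    refine (h2.mul h2 d2 d2 ⟨b, hb4⟩).of_norm_le
      ((SmallProximity.const 1).add ((SmallProximity.const w).mul
        (hE.smallProximity_deriv_div hne))) (d2.fun_mul d2) hφE.1 hφ ⟨b, hb4⟩ fun z hz => ?_
    have hz' : f z ≠ 0 := left_ne_zero_of_mul (left_ne_zero_of_mul hz)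
    rw [← norm_mul]
    refine le_of_eq (congrArg _ ?_)
    field_simp
  have hgS : (∃ b, iteratedDeriv k f (b + c) ≠ 0) →
      SmallLogMean fun z => iteratedDeriv k f (z + c) := by
    rintro ⟨b', hb'⟩
    refine SmallLogMean.comp_add (hE.iteratedDeriv k) ⟨_, hb'⟩ (hS.of_norm_le
      (hE.smallProximity_iteratedDeriv_div hne k) hf (hE.iteratedDeriv k).1 ⟨_, hb'⟩ hne
      fun z hz => ?_) c
    rw [← norm_mul, div_mul_cancel₀ _ hz]
  rcases eq_exp_of_add_eq hp₁ hp₂ hα hφE ((hE.iteratedDeriv k).comp_add c) hφS hgS heq with h | h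
  · obtain ⟨C, hC, h1, h2, h3, h4⟩ := exists_exp_of_eq hE hS hne hα₁ hp₁ hp₂
      (fun z => (h z).2) fun z => (h z).1
    exact ⟨α₁, C, hα₁, hC, h1, h2, .inl ⟨rfl, by exact_mod_cast h3, h4⟩⟩
  · obtain ⟨C, hC, h1, h2, h3, h4⟩ := exists_exp_of_eq hE hS hne hα₂ hp₂ hp₁
      (fun z => (h z).2) fun z => (h z).1
    exact ⟨α₂, C, hα₂, hC, h1, h2, .inr ⟨rfl, by exact_mod_cast h3, h4⟩⟩
end
end
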